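/- Let 1 < p < ∞, let γ ∈ (−1, 2p−1) with γ ≠ p−1, and let ν ∈ ℝ satisfy ν ∉ { (2 + nπ/κ)p − 2 : n ∈ ℕ } ∪ { (2 − nπ/κ)p − 2 : n ∈ ℕ }. Then there exist constants 0 < c ≤ C < ∞, independent of u, such that for every function u : ℝ² → ℂ that is smooth, has compact support contained in ℝ² \ {0}, and vanishes on ∂𝒟 \ {0}, one has: c · Σ_{|α| ≤ 2} ( ∫_𝒟 | ρ_∘(x)^{|α|−2} ∂^α u(x) |^p · w_{γ,ν}(x) dx )^{1/p} ≤ ( ∫_𝒟 |Δu(x)|^p · w_{γ,ν}(x) dx )^{1/p} ≤ C · Σ_{|α| ≤ 2} ( ∫_𝒟 | ρ_∘(x)^{|α|−2} ∂^α u(x) |^p · w_{γ,ν}(x) dx )^{1/p}, where Δu = ∂_{x₁}² u + ∂_{x₂}² u. -/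

import Mathlib

open MeasureTheory Set Real
open scoped ENNReal

noncomputable section

/-- The planar angular domain with opening angle `κ`, as a subset of `ℝ × ℝ`. -/
def D2 (κ : ℝ) : Set (ℝ × ℝ) :=
  {x | ∃ r φ : ℝ, 0 < r ∧ 0 < φ ∧ φ < κ ∧ x = (r * Real.cos φ, r * Real.sin φ)}

/-- Partial derivative in the first variable. -/
def pd1 (f : ℝ × ℝ → ℂ) : ℝ × ℝ → ℂ := fun x => deriv (fun s => f (s, x.2)) x.1

/-- Partial derivative in the second variable. -/
def pd2 (f : ℝ × ℝ → ℂ) : ℝ × ℝ → ℂ := fun x => deriv (fun s => f (x.1, s)) x.2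

/-- Iterated partial derivative `∂_{x₁}^{α₁} ∂_{x₂}^{α₂} f` for a multi-index `α`. -/
def pdMix (α : ℕ × ℕ) (f : ℝ × ℝ → ℂ) : ℝ × ℝ → ℂ := pd1^[α.1] (pd2^[α.2] f)

/-- The Euler-coordinate parametrization `(z, φ) ↦ (eᶻ cos φ, eᶻ sin φ)`. -/
def eulerMap (p : ℝ × ℝ) : ℝ × ℝ := (Real.exp p.1 * Real.cos p.2, Real.exp p.1 * Real.sin p.2)

/-- The strip `ℝ × (0, κ)`. -/
def strip (κ : ℝ) : Set (ℝ × ℝ) := {p | 0 < p.2 ∧ p.2 < κ}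

/-- Euclidean norm on `ℝ × ℝ`. -/
def enorm2 (x : ℝ × ℝ) : ℝ := Real.sqrt (x.1 ^ 2 + x.2 ^ 2)

/-- Euclidean distance from `x` to the boundary of `𝒟`. -/
def rhoD2 (κ : ℝ) (x : ℝ × ℝ) : ℝ :=
  sInf ((fun y => enorm2 (x - y)) '' frontier (D2 κ))

/-- The mixed power weight `w_{γ,ν}(x) = ρ_∘(x)^{ν-γ} ρ_𝒟(x)^γ`. -/
def wgt2 (κ γ ν : ℝ) (x : ℝ × ℝ) : ℝ := enorm2 x ^ (ν - γ) * rhoD2 κ x ^ γ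

/-- The multi-indices `α ∈ ℕ₀²` with `|α| ≤ k`, as a finset. -/
def idx (k : ℕ) : Finset (ℕ × ℕ) :=
  Finset.filter (fun α : ℕ × ℕ => α.1 + α.2 ≤ k)
    (Finset.range (k + 1) ×ˢ Finset.range (k + 1))

local notation "oR" => ENNReal.ofReal
local notation "cI" => Complex.I
local notation "cE" => Complex.exp
local notation "cBall" => Metric.closedBall
local notation "R2" => ℝ × ℝ
local notation "bl" => (by linarith)
local notation "bp" => (by positivity)
local notation "bn" => (by norm_num)

lemma hasDerivAt_integral_cpt {X : Type*} [TopologicalSpace X] [CompactSpace X]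
    [MeasurableSpace X] [BorelSpace X] [SecondCountableTopology X] (μ : Measure X)
    [IsFiniteMeasure μ] (F F' : X → ℝ → ℝ)
    (hF : Continuous (fun q : X × ℝ => F q.1 q.2)) (hF' : Continuous (fun q : X × ℝ => F' q.1 q.2))
    (hd : ∀ x t, HasDerivAt (F x) (F' x t) t) (t : ℝ) :
    HasDerivAt (fun t => ∫ x, F x t ∂μ) (∫ x, F' x t ∂μ) t := by
  have hK : IsCompact ((univ : Set X) ×ˢ (cBall t 1)) :=
    isCompact_univ.prod (isCompact_closedBall t 1)
  obtain ⟨M, hM⟩ := hK.exists_bound_of_continuousOn hF'.continuousOn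
  have hc : ∀ t, Continuous (fun x => F x t) := fun t => hF.comp (Continuous.prodMk_left t)
  have hc' : ∀ t, Continuous (fun x => F' x t) := fun t => hF'.comp (Continuous.prodMk_left t)
  have hI : ∀ t, Integrable (fun x => F x t) μ := by
    intro t
    obtain ⟨B, hB⟩ := isCompact_univ.exists_bound_of_continuousOn (hc t).continuousOn
    exact Integrable.of_bound (hc t).aestronglyMeasurable B (Filter.Eventually.of_forall fun x => hB x (mem_univ _))
  exact (hasDerivAt_integral_of_dominated_loc_of_deriv_le (bound := fun _ => M)
    (s := Metric.ball t 1) (Metric.ball_mem_nhds t one_pos)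
    (Filter.Eventually.of_forall fun t => (hc t).aestronglyMeasurable) (hI t)
    (hc' t).aestronglyMeasurable
    (Filter.Eventually.of_forall fun x s hs => hM (x, s) ⟨mem_univ _, Metric.ball_subset_closedBall hs⟩)
    (integrable_const M) (Filter.Eventually.of_forall fun x s _ => hd x s)).2

lemma hasDerivAt_rp (q q' : ℝ → ℝ) (p t : ℝ) (hq : 0 < q t) (h : HasDerivAt q (q' t) t) :
    HasDerivAt (fun t => q t ^ p) (p * q t ^ (p - 1) * q' t) t := by
  have := h.rpow_const (p := p) (Or.inl hq.ne')
  refine this.congr_deriv ?_; ring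

lemma hasDerivAt_rp2 (q q' q'' : ℝ → ℝ) (p t : ℝ) (hq : 0 < q t) (h : HasDerivAt q (q' t) t)
    (h' : HasDerivAt q' (q'' t) t) :
    HasDerivAt (fun t => p * q t ^ (p - 1) * q' t)
      (p * q t ^ (p - 1) * q'' t + p * (p - 1) * q t ^ (p - 2) * q' t ^ 2) t := by
  have h1 := ((hasDerivAt_rp q q' (p - 1) t hq h).const_mul p).fun_mul h'
  refine h1.congr_deriv ?_
  rw [show p - 1 - 1 = p - 2 by ring]; ring

lemma nonneg_of_convex_tendsto (f f' f'' : ℝ → ℝ) (h1 : ∀ t, HasDerivAt f (f' t) t)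
    (h2 : ∀ t, HasDerivAt f' (f'' t) t) (h3 : ∀ t, 0 ≤ f'' t) (l : ℝ) (hl : 0 ≤ l)
    (hlim : Filter.Tendsto f Filter.atTop (nhds l)) : 0 ≤ f 0 := by
  have mono : Monotone f' := monotone_of_hasDerivAt_nonneg h2 h3
  by_contra hneg
  push Not at hneg
  have hev : ∀ᶠ t in Filter.atTop, f 0 / 2 < f t := hlim.eventually (lt_mem_nhds bl)
  obtain ⟨T, hT1, hT2⟩ := (hev.and (Filter.eventually_gt_atTop 0)).exists
  obtain ⟨c, hc, hc'⟩ := exists_hasDerivAt_eq_slope f f' hT2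
    (fun x _ => (h1 x).continuousAt.continuousWithinAt) (fun x _ => h1 x)
  have hpos : 0 < f' c := by
    rw [hc']; apply div_pos <;> linarith
  have hgrow : ∀ t, T ≤ t → f T + f' c * (t - T) ≤ f t := by
    intro t ht
    rcases ht.eq_or_lt with rfl | ht
    · simp
    obtain ⟨d, hd, hd'⟩ := exists_hasDerivAt_eq_slope f f' ht
      (fun x _ => (h1 x).continuousAt.continuousWithinAt) (fun x _ => h1 x)
    have : f' c ≤ f' d := mono (by have := hc.2; have := hd.1; linarith)
    rw [hd', le_div_iff₀ bl] at this
    linarith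
  have hev2 : ∀ᶠ t in Filter.atTop, f t < l + 1 := hlim.eventually (gt_mem_nhds bl)
  obtain ⟨t, ht1, ht2⟩ := (hev2.and (Filter.eventually_ge_atTop
    (max T (T + (l + 1 - f T) / f' c)))).exists
  have h4 := hgrow t (le_trans (le_max_left _ _) ht2)
  have h5 : (l + 1 - f T) / f' c ≤ t - T := by
    have := le_trans (le_max_right _ _) ht2; linarith
  rw [div_le_iff₀ hpos] at h5
  nlinarith

def hq1 (ε : ℝ) (a c : ℂ) : ℝ := ‖a + c‖ ^ 2 + ε ^ 2
def hq2 (ε : ℝ) (a c : ℂ) : ℝ := ‖a‖ ^ 2 + ‖c‖ ^ 2 + ε ^ 2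
def hq1' (a c a1 c1 : ℂ) : ℝ := 2 * inner ℝ (a + c) (a1 + c1)
def hq2' (a c a1 c1 : ℂ) : ℝ := 2 * inner ℝ a a1 + 2 * inner ℝ c c1
def hq1'' (a c a1 c1 a2 c2 : ℂ) : ℝ := 2 * (inner ℝ (a + c) (a2 + c2) + ‖a1 + c1‖ ^ 2)
def hq2'' (a c a1 c1 a2 c2 : ℂ) : ℝ :=
  2 * (inner ℝ a a2 + ‖a1‖ ^ 2) + 2 * (inner ℝ c c2 + ‖c1‖ ^ 2)
def hU0 (K ε p : ℝ) (a c : ℂ) : ℝ := K * hq1 ε a c ^ p - hq2 ε a c ^ p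
def hU1 (K ε p : ℝ) (a c a1 c1 : ℂ) : ℝ :=
  K * (p * hq1 ε a c ^ (p - 1) * hq1' a c a1 c1) - p * hq2 ε a c ^ (p - 1) * hq2' a c a1 c1
def hU2 (K ε p : ℝ) (a c a1 c1 a2 c2 : ℂ) : ℝ :=
  K * (p * hq1 ε a c ^ (p - 1) * hq1'' a c a1 c1 a2 c2
      + p * (p - 1) * hq1 ε a c ^ (p - 2) * hq1' a c a1 c1 ^ 2)
    - (p * hq2 ε a c ^ (p - 1) * hq2'' a c a1 c1 a2 c2
      + p * (p - 1) * hq2 ε a c ^ (p - 2) * hq2' a c a1 c1 ^ 2)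

lemma hq1_pos {ε : ℝ} (hε : 0 < ε) (a c : ℂ) : 0 < hq1 ε a c := by unfold hq1; positivity
lemma hq2_pos {ε : ℝ} (hε : 0 < ε) (a c : ℂ) : 0 < hq2 ε a c := by unfold hq2; positivity

section
variable (K ε p : ℝ) (hε : 0 < ε) (a c a1 c1 a2 c2 : ℝ → ℂ) (t : ℝ)
  (ha : HasDerivAt a (a1 t) t) (hc : HasDerivAt c (c1 t) t)
  (ha1 : HasDerivAt a1 (a2 t) t) (hc1 : HasDerivAt c1 (c2 t) t)

include ha hc in
lemma hq1_deriv : HasDerivAt (fun t => hq1 ε (a t) (c t)) (hq1' (a t) (c t) (a1 t) (c1 t)) t := by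
  unfold hq1 hq1'
  exact (ha.add hc).norm_sq.add_const _

include ha hc in
lemma hq2_deriv : HasDerivAt (fun t => hq2 ε (a t) (c t)) (hq2' (a t) (c t) (a1 t) (c1 t)) t := by
  unfold hq2 hq2'
  exact (ha.norm_sq.add hc.norm_sq).add_const _

include ha hc ha1 hc1 in
lemma hq1'_deriv : HasDerivAt (fun t => hq1' (a t) (c t) (a1 t) (c1 t))
    (hq1'' (a t) (c t) (a1 t) (c1 t) (a2 t) (c2 t)) t := by
  unfold hq1' hq1''
  refine (((ha.fun_add hc).inner ℝ (ha1.fun_add hc1)).const_mul 2).congr_deriv ?_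
  rw [real_inner_self_eq_norm_sq]

include ha hc ha1 hc1 in
lemma hq2'_deriv : HasDerivAt (fun t => hq2' (a t) (c t) (a1 t) (c1 t))
    (hq2'' (a t) (c t) (a1 t) (c1 t) (a2 t) (c2 t)) t := by
  unfold hq2' hq2''
  refine (((ha.inner ℝ ha1).const_mul 2).fun_add ((hc.inner ℝ hc1).const_mul 2)).congr_deriv ?_
  rw [real_inner_self_eq_norm_sq, real_inner_self_eq_norm_sq]

include hε ha hc in
lemma hU0_deriv : HasDerivAt (fun t => hU0 K ε p (a t) (c t))
    (hU1 K ε p (a t) (c t) (a1 t) (c1 t)) t := by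
  unfold hU0 hU1
  exact ((hasDerivAt_rp _ (fun t => hq1' (a t) (c t) (a1 t) (c1 t)) p t (hq1_pos hε _ _)
    (hq1_deriv ε a c a1 c1 t ha hc)).const_mul K).sub
    (hasDerivAt_rp _ (fun t => hq2' (a t) (c t) (a1 t) (c1 t)) p t (hq2_pos hε _ _)
    (hq2_deriv ε a c a1 c1 t ha hc))

include hε ha hc ha1 hc1 in
lemma hU1_deriv : HasDerivAt (fun t => hU1 K ε p (a t) (c t) (a1 t) (c1 t))
    (hU2 K ε p (a t) (c t) (a1 t) (c1 t) (a2 t) (c2 t)) t := by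
  unfold hU1 hU2
  exact ((hasDerivAt_rp2 _ _ (fun t => hq1'' (a t) (c t) (a1 t) (c1 t) (a2 t) (c2 t)) p t
    (hq1_pos hε _ _)
    (hq1_deriv ε a c a1 c1 t ha hc) (hq1'_deriv a c a1 c1 a2 c2 t ha hc ha1 hc1)).const_mul K).sub
    (hasDerivAt_rp2 _ _ (fun t => hq2'' (a t) (c t) (a1 t) (c1 t) (a2 t) (c2 t)) p t
    (hq2_pos hε _ _)
    (hq2_deriv ε a c a1 c1 t ha hc) (hq2'_deriv a c a1 c1 a2 c2 t ha hc ha1 hc1))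
end

section
variable {X : Type*} [TopologicalSpace X] (K ε p : ℝ) (hε : 0 < ε) (a c a1 c1 a2 c2 : X → ℂ)
  (ha : Continuous a) (hc : Continuous c) (ha1 : Continuous a1) (hc1 : Continuous c1)
  (ha2 : Continuous a2) (hc2 : Continuous c2)

include hε ha hc in
lemma hq_cont (r : ℝ) : Continuous (fun x => hq1 ε (a x) (c x) ^ r) ∧
    Continuous (fun x => hq2 ε (a x) (c x) ^ r) := by
  constructor
  · refine Continuous.rpow_const ?_ (fun x => Or.inl (hq1_pos hε _ _).ne')
    unfold hq1; fun_prop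
  · refine Continuous.rpow_const ?_ (fun x => Or.inl (hq2_pos hε _ _).ne')
    unfold hq2; fun_prop

include hε ha hc in
lemma hU0_cont : Continuous (fun x => hU0 K ε p (a x) (c x)) := by
  unfold hU0
  exact (continuous_const.mul (hq_cont ε hε a c ha hc p).1).sub (hq_cont ε hε a c ha hc p).2

include hε ha hc ha1 hc1 in
lemma hU1_cont : Continuous (fun x => hU1 K ε p (a x) (c x) (a1 x) (c1 x)) := by
  have h1 := hq_cont ε hε a c ha hc (p-1)
  obtain ⟨h1, h2⟩ := h1
  unfold hU1 hq1' hq2'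
  fun_prop

include hε ha hc ha1 hc1 ha2 hc2 in
lemma hU2_cont : Continuous (fun x => hU2 K ε p (a x) (c x) (a1 x) (c1 x) (a2 x) (c2 x)) := by
  obtain ⟨h1, h2⟩ := hq_cont ε hε a c ha hc (p-1)
  obtain ⟨h3, h4⟩ := hq_cont ε hε a c ha hc (p-2)
  unfold hU2 hq1' hq2' hq1'' hq2''
  fun_prop
end

set_option maxHeartbeats 1000000 in
lemma hU2_nonneg (p ε : ℝ) (hε : 0 < ε) (hp : 1 / 2 < p) (hp' : p ≤ 1) (a c a1 c1 a2 c2 : ℂ) :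
    0 ≤ hU2 (2 / (2 * p - 1)) ε p a c a1 c1 a2 c2
      + hU2 (2 / (2 * p - 1)) ε p a c (-cI * a1) (cI * c1) (-a2) (-c2) := by
  set N : ℝ := ‖a1‖ ^ 2 + ‖c1‖ ^ 2 with hN
  have hN0 : 0 ≤ N := by positivity
  set K := 2 / (2 * p - 1) with hK
  set Q1 := hq1 ε a c with hQ1
  set Q2 := hq2 ε a c with hQ2
  have hQ1p : 0 < Q1 := hq1_pos hε a c
  have hQ2p : 0 < Q2 := hq2_pos hε a c
  have hnorm : ‖a1 + c1‖ ^ 2 + ‖-cI * a1 + cI * c1‖ ^ 2 = 2 * N := by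
    have : -cI * a1 + cI * c1 = - cI * (a1 - c1) := by ring
    rw [this, norm_mul, norm_neg, Complex.norm_I, one_mul, hN]
    have := parallelogram_law_with_norm ℝ a1 c1
    nlinarith
  have s1 : hq1'' a c a1 c1 a2 c2 + hq1'' a c (-cI * a1) (cI * c1) (-a2) (-c2)
      = 4 * N := by
    unfold hq1''
    rw [show -a2 + -c2 = -(a2 + c2) by ring, inner_neg_right]
    linarith
  have s2 : hq2'' a c a1 c1 a2 c2 + hq2'' a c (-cI * a1) (cI * c1) (-a2) (-c2)
      = 4 * N := by
    unfold hq2''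
    rw [inner_neg_right, inner_neg_right, norm_mul, norm_mul, norm_neg, Complex.norm_I]
    linarith
  have s3 : hq1' a c a1 c1 ^ 2 + hq1' a c (-cI * a1) (cI * c1) ^ 2
      ≤ 8 * (Q1 * N) := by
    unfold hq1'
    have e1 : (inner ℝ (a + c) (a1 + c1) : ℝ) ^ 2 ≤ ‖a + c‖ ^ 2 * ‖a1 + c1‖ ^ 2 := by
      rw [← mul_pow]; exact sq_le_sq' (by linarith [neg_le_of_abs_le (abs_real_inner_le_norm (a+c) (a1+c1))]) (real_inner_le_norm _ _)
    have e2 : (inner ℝ (a + c) (-cI * a1 + cI * c1) : ℝ) ^ 2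
        ≤ ‖a + c‖ ^ 2 * ‖-cI * a1 + cI * c1‖ ^ 2 := by
      rw [← mul_pow]; exact sq_le_sq' (by linarith [neg_le_of_abs_le (abs_real_inner_le_norm (a+c) (-cI * a1 + cI * c1))]) (real_inner_le_norm _ _)
    have e3 : ‖a + c‖ ^ 2 ≤ Q1 := by rw [hQ1]; unfold hq1; nlinarith
    have e4 : ‖a + c‖ ^ 2 * (2 * N) ≤ Q1 * (2 * N) := by gcongr
    rw [← hnorm] at e4
    nlinarith
  have hr : Q1 ^ (p - 1) = Q1 ^ (p - 2) * Q1 := by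
    rw [show p - 1 = (p - 2) + 1 by ring, rpow_add hQ1p, rpow_one]
  have hpos1 : 0 < Q1 ^ (p - 2) := rpow_pos_of_pos hQ1p _
  have hpos2 : 0 < Q2 ^ (p - 2) := rpow_pos_of_pos hQ2p _
  have hcmp : Q2 ^ (p - 1) ≤ 2 * Q1 ^ (p - 1) := by
    have h12 : Q1 ≤ 2 * Q2 := by
      rw [hQ1, hQ2]; unfold hq1 hq2
      have := norm_add_le a c
      have h3 : ‖a + c‖ ^ 2 ≤ (‖a‖ + ‖c‖) ^ 2 := by gcongr
      nlinarith [sq_nonneg (‖a‖ - ‖c‖), sq_nonneg ε]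
    have h4 : (2 * Q2) ^ (p - 1) ≤ Q1 ^ (p - 1) := by
      apply rpow_le_rpow_of_nonpos hQ1p h12; linarith
    rw [mul_rpow bn hQ2p.le] at h4
    have h5 : (2 : ℝ) ^ (-1 : ℝ) ≤ 2 ^ (p - 1) :=
      rpow_le_rpow_of_exponent_le bn bl
    rw [rpow_neg_one] at h5
    have h6 : 0 < Q2 ^ (p - 1) := rpow_pos_of_pos hQ2p _
    nlinarith
  have hK' : K * (2 * p - 1) = 2 := by rw [hK]; field_simp; rw [div_self]; linarith
  have hKpos : 0 < K := by rw [hK]; apply div_pos <;> linarith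
  have key : hU2 K ε p a c a1 c1 a2 c2
      + hU2 K ε p a c (-cI * a1) (cI * c1) (-a2) (-c2)
      = K * p * (Q1 ^ (p - 1) * (4 * N) + (p - 1) * Q1 ^ (p - 2) *
          (hq1' a c a1 c1 ^ 2 + hq1' a c (-cI * a1) (cI * c1) ^ 2))
        - p * (Q2 ^ (p - 1) * (4 * N) + (p - 1) * Q2 ^ (p - 2) *
          (hq2' a c a1 c1 ^ 2 + hq2' a c (-cI * a1) (cI * c1) ^ 2)) := by
    unfold hU2
    rw [← hQ1, ← hQ2]
    linear_combination K * p * Q1 ^ (p - 1) * s1 - p * Q2 ^ (p - 1) * s2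
  rw [key]
  have b1 : 4 * (2 * p - 1) * N * Q1 ^ (p - 1) ≤ Q1 ^ (p - 1) * (4 * N) + (p - 1) * Q1 ^ (p - 2) *
          (hq1' a c a1 c1 ^ 2 + hq1' a c (-cI * a1) (cI * c1) ^ 2) := by
    have : (1 - p) * Q1 ^ (p - 2) *
          (hq1' a c a1 c1 ^ 2 + hq1' a c (-cI * a1) (cI * c1) ^ 2) ≤
          (1 - p) * Q1 ^ (p - 2) * (8 * (Q1 * N)) :=
      mul_le_mul_of_nonneg_left s3 (mul_nonneg bl hpos1.le)
    rw [hr]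
    linarith
  have b2 : Q2 ^ (p - 1) * (4 * N) + (p - 1) * Q2 ^ (p - 2) *
          (hq2' a c a1 c1 ^ 2 + hq2' a c (-cI * a1) (cI * c1) ^ 2)
          ≤ 8 * N * Q1 ^ (p - 1) := by
    have h1 : 0 ≤ (1 - p) * Q2 ^ (p - 2) *
          (hq2' a c a1 c1 ^ 2 + hq2' a c (-cI * a1) (cI * c1) ^ 2) :=
      mul_nonneg (mul_nonneg bl hpos2.le) bp
    have h2 : Q2 ^ (p - 1) * (4 * N) ≤ 2 * Q1 ^ (p - 1) * (4 * N) := by gcongr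
    linarith
  have b3 : K * p * (4 * (2 * p - 1) * N * Q1 ^ (p - 1)) ≤ K * p * (Q1 ^ (p - 1) * (4 * N) + (p - 1) * Q1 ^ (p - 2) *
          (hq1' a c a1 c1 ^ 2 + hq1' a c (-cI * a1) (cI * c1) ^ 2)) :=
    mul_le_mul_of_nonneg_left b1 bp
  have b4 := mul_le_mul_of_nonneg_left b2 (show 0 ≤ p by linarith)
  have b5 : K * p * (4 * (2 * p - 1) * N * Q1 ^ (p - 1)) = p * (8 * N * Q1 ^ (p - 1)) := by
    linear_combination (4 * p * N * Q1 ^ (p - 1)) * hK'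
  linarith

def gS {X ι : Type*} (S : Finset ι) (co : ι → ℂ) (lam : ι → ℝ) (e : ι → X → ℂ) (x : X) (σ t : ℝ) : ℂ :=
  ∑ i ∈ S, co i * e i x * cE (cI * lam i * σ - |lam i| * t)

lemma gS_dt {X ι : Type*} (S : Finset ι) (co co' : ι → ℂ) (lam : ι → ℝ) (e : ι → X → ℂ) (x : X) (σ t : ℝ)
    (h : ∀ i ∈ S, co' i = - |lam i| * co i) :
    HasDerivAt (fun t => gS S co lam e x σ t) (gS S co' lam e x σ t) t := by
  unfold gS
  refine HasDerivAt.fun_sum fun i hi => ?_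
  have h1 : HasDerivAt (fun t : ℝ => (cI * lam i * σ - ((|lam i| : ℝ) : ℂ) * (t:ℂ))) (-((|lam i| : ℝ) : ℂ)) t := by
    have := ((Complex.ofRealCLM.hasDerivAt (x := t)).const_mul ((|lam i| : ℝ) : ℂ)).const_sub (cI * lam i * σ)
    simpa using this
  refine (h1.cexp.const_mul (co i * e i x)).congr_deriv ?_
  rw [h i hi]; ring

lemma gS_ds {X ι : Type*} (S : Finset ι) (co co' : ι → ℂ) (lam : ι → ℝ) (e : ι → X → ℂ) (x : X) (σ t : ℝ)
    (h : ∀ i ∈ S, co' i = cI * lam i * co i) :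
    HasDerivAt (fun σ => gS S co lam e x σ t) (gS S co' lam e x σ t) σ := by
  unfold gS
  refine HasDerivAt.fun_sum fun i hi => ?_
  have h1 : HasDerivAt (fun s : ℝ => (cI * lam i * (s:ℂ) - |lam i| * (t:ℂ))) (cI * lam i) σ := by
    have := ((Complex.ofRealCLM.hasDerivAt (x := σ)).const_mul (cI * lam i)).sub_const (|lam i| * (t:ℂ))
    simpa using this
  refine (h1.cexp.const_mul (co i * e i x)).congr_deriv ?_
  rw [h i hi]; ring

lemma gS_cont {X ι : Type*} [TopologicalSpace X] (S : Finset ι) (co : ι → ℂ) (lam : ι → ℝ) (e : ι → X → ℂ)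
    (he : ∀ i, Continuous (e i)) :
    Continuous (fun q : X × R2 => gS S co lam e q.1 q.2.1 q.2.2) := by
  unfold gS
  fun_prop

lemma gS_mul {X ι : Type*} (S : Finset ι) (co : ι → ℂ) (lam : ι → ℝ) (e : ι → X → ℂ) (x : X) (σ t : ℝ) (c : ℂ) :
    c * gS S co lam e x σ t = gS S (fun i => c * co i) lam e x σ t := by
  unfold gS
  rw [Finset.mul_sum]; refine Finset.sum_congr rfl fun i _ => ?_; ring

lemma gS_inv {X ι : Type*} (S : Finset ι) (co : ι → ℂ) (lam : ι → ℝ) (e : ι → X → ℂ) (τ : X → X) (σ : ℝ)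
    (h : ∀ i x, e i (τ x) = cE (cI * lam i * σ) * e i x) (x : X) (t : ℝ) :
    gS S co lam e x σ t = gS S co lam e (τ x) 0 t := by
  unfold gS
  refine Finset.sum_congr rfl fun i _ => ?_
  rw [h, sub_eq_add_neg, Complex.exp_add]
  simp; ring


lemma conv_abs {X : Type*} [TopologicalSpace X] [CompactSpace X]
    [MeasurableSpace X] [BorelSpace X] [SecondCountableTopology X] (μ : Measure X)
    [IsFiniteMeasure μ] (U0 U1 U2 V1 V2 : X → ℝ → ℝ → ℝ)
    (hinv : ∀ σ : ℝ, ∃ τ : X → X, MeasurePreserving τ μ μ ∧ ∀ x t, U0 x σ t = U0 (τ x) 0 t)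
    (d1 : ∀ x σ t, HasDerivAt (fun t => U0 x σ t) (U1 x σ t) t)
    (d2 : ∀ x σ t, HasDerivAt (fun t => U1 x σ t) (U2 x σ t) t)
    (d3 : ∀ x σ t, HasDerivAt (fun σ => U0 x σ t) (V1 x σ t) σ)
    (d4 : ∀ x σ t, HasDerivAt (fun σ => V1 x σ t) (V2 x σ t) σ)
    (k0 : Continuous (fun q : X × R2 => U0 q.1 q.2.1 q.2.2))
    (k1 : Continuous (fun q : X × R2 => U1 q.1 q.2.1 q.2.2))
    (k2 : Continuous (fun q : X × R2 => U2 q.1 q.2.1 q.2.2))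
    (k3 : Continuous (fun q : X × R2 => V1 q.1 q.2.1 q.2.2))
    (k4 : Continuous (fun q : X × R2 => V2 q.1 q.2.1 q.2.2))
    (hpos : ∀ x t, 0 ≤ U2 x 0 t + V2 x 0 t)
    (l : ℝ) (hl : 0 ≤ l)
    (hlim : Filter.Tendsto (fun t => ∫ x, U0 x 0 t ∂μ) Filter.atTop (nhds l)) :
    0 ≤ ∫ x, U0 x 0 0 ∂μ := by
  have ct : Continuous (fun q : X × ℝ => ((q.1, 0, q.2) : X × R2)) := by fun_prop
  have e1 := fun t => hasDerivAt_integral_cpt μ (fun x t => U0 x 0 t) (fun x t => U1 x 0 t)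
    (k0.comp ct) (k1.comp ct) (fun x t => d1 x 0 t) t
  have e2 := fun t => hasDerivAt_integral_cpt μ (fun x t => U1 x 0 t) (fun x t => U2 x 0 t)
    (k1.comp ct) (k2.comp ct) (fun x t => d2 x 0 t) t
  have cs : ∀ t : ℝ, Continuous (fun q : X × ℝ => ((q.1, q.2, t) : X × R2)) := by
    intro t; fun_prop
  have e3 := fun t σ => hasDerivAt_integral_cpt μ (fun x σ => U0 x σ t) (fun x σ => V1 x σ t)
    (k0.comp (cs t)) (k3.comp (cs t)) (fun x σ => d3 x σ t) σ
  have e4 := fun t σ => hasDerivAt_integral_cpt μ (fun x σ => V1 x σ t) (fun x σ => V2 x σ t)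
    (k3.comp (cs t)) (k4.comp (cs t)) (fun x σ => d4 x σ t) σ
  have const : ∀ t σ, ∫ x, U0 x σ t ∂μ = ∫ x, U0 x 0 t ∂μ := by
    intro t σ
    obtain ⟨τ, hτ, hτ'⟩ := hinv σ
    have h1 : ∀ x, U0 x σ t = U0 (τ x) 0 t := by
      intro x; exact hτ' x t
    simp_rw [h1]
    have hcx : Continuous (fun x => U0 x 0 t) := k0.comp (by fun_prop : Continuous fun x : X => ((x, 0, t) : X × R2))
    rw [← hτ.map_eq] 
    rw [integral_map hτ.measurable.aemeasurable hcx.aestronglyMeasurable, hτ.map_eq]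
  have zero1 : ∀ t σ, ∫ x, V1 x σ t ∂μ = 0 := by
    intro t σ
    have h := e3 t σ
    simp_rw [const t] at h
    exact h.unique (hasDerivAt_const _ _)
  have zero2 : ∀ t, ∫ x, V2 x 0 t ∂μ = 0 := by
    intro t
    have h := e4 t 0
    simp_rw [zero1 t] at h
    exact h.unique (hasDerivAt_const _ _)
  have int : ∀ f : X → ℝ, Continuous f → Integrable f μ := by
    intro f hf
    obtain ⟨B, hB⟩ := isCompact_univ.exists_bound_of_continuousOn hf.continuousOn
    exact Integrable.of_bound hf.aestronglyMeasurable B (Filter.Eventually.of_forall fun x => hB x (mem_univ _))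
  have pos : ∀ t, 0 ≤ ∫ x, U2 x 0 t ∂μ := by
    intro t
    have cx : Continuous fun x : X => ((x, 0, t) : X × R2) := by fun_prop
    have hs : ∫ x, (U2 x 0 t + V2 x 0 t) ∂μ = ∫ x, U2 x 0 t ∂μ + ∫ x, V2 x 0 t ∂μ :=
      integral_add (int _ (k2.comp cx)) (int _ (k4.comp cx))
    rw [zero2 t, add_zero] at hs
    rw [← hs]
    refine integral_nonneg fun x => ?_
    exact hpos x t
  exact nonneg_of_convex_tendsto _ _ _ e1 e2 pos l hl hlim

lemma half_abs {X : Type*} [TopologicalSpace X] [CompactSpace X]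
    [MeasurableSpace X] [BorelSpace X] [SecondCountableTopology X] (μ : Measure X)
    [IsFiniteMeasure μ] (p ε K : ℝ) (hp : 1 / 2 < p) (hp' : p ≤ 1) (hε : 0 < ε) (hK : K = 2 / (2 * p - 1))
    (a a1 a2 c c1 c2 : X → ℝ → ℝ → ℂ)
    (hinv : ∀ σ : ℝ, ∃ τ : X → X, MeasurePreserving τ μ μ ∧
      ∀ x t, a x σ t = a (τ x) 0 t ∧ c x σ t = c (τ x) 0 t)
    (at1 : ∀ x σ t, HasDerivAt (fun t => a x σ t) (a1 x σ t) t)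
    (at2 : ∀ x σ t, HasDerivAt (fun t => a1 x σ t) (a2 x σ t) t)
    (ct1 : ∀ x σ t, HasDerivAt (fun t => c x σ t) (c1 x σ t) t)
    (ct2 : ∀ x σ t, HasDerivAt (fun t => c1 x σ t) (c2 x σ t) t)
    (as1 : ∀ x σ t, HasDerivAt (fun σ => a x σ t) (-cI * a1 x σ t) σ)
    (as2 : ∀ x σ t, HasDerivAt (fun σ => -cI * a1 x σ t) (-a2 x σ t) σ)
    (cs1 : ∀ x σ t, HasDerivAt (fun σ => c x σ t) (cI * c1 x σ t) σ)
    (cs2 : ∀ x σ t, HasDerivAt (fun σ => cI * c1 x σ t) (-c2 x σ t) σ)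
    (ca : Continuous (fun q : X × R2 => a q.1 q.2.1 q.2.2))
    (ca1 : Continuous (fun q : X × R2 => a1 q.1 q.2.1 q.2.2))
    (ca2 : Continuous (fun q : X × R2 => a2 q.1 q.2.1 q.2.2))
    (cc : Continuous (fun q : X × R2 => c q.1 q.2.1 q.2.2))
    (cc1 : Continuous (fun q : X × R2 => c1 q.1 q.2.1 q.2.2))
    (cc2 : Continuous (fun q : X × R2 => c2 q.1 q.2.1 q.2.2))
    (l : ℝ) (hl : 0 ≤ l)
    (hlim : Filter.Tendsto (fun t => ∫ x, hU0 K ε p (a x 0 t) (c x 0 t) ∂μ) Filter.atTop (nhds l)) :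
    0 ≤ ∫ x, hU0 K ε p (a x 0 0) (c x 0 0) ∂μ := by
  refine conv_abs μ (fun x σ t => hU0 K ε p (a x σ t) (c x σ t))
    (fun x σ t => hU1 K ε p (a x σ t) (c x σ t) (a1 x σ t) (c1 x σ t))
    (fun x σ t => hU2 K ε p (a x σ t) (c x σ t) (a1 x σ t) (c1 x σ t) (a2 x σ t) (c2 x σ t))
    (fun x σ t => hU1 K ε p (a x σ t) (c x σ t) (-cI * a1 x σ t) (cI * c1 x σ t))
    (fun x σ t => hU2 K ε p (a x σ t) (c x σ t) (-cI * a1 x σ t) (cI * c1 x σ t)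
      (-a2 x σ t) (-c2 x σ t)) ?_ ?_ ?_ ?_ ?_ ?_ ?_ ?_ ?_ ?_ ?_ l hl hlim
  · intro σ
    obtain ⟨τ, hτ, hτ'⟩ := hinv σ
    exact ⟨τ, hτ, fun x t => by rw [(hτ' x t).1, (hτ' x t).2]⟩
  · exact fun x σ t => hU0_deriv K ε p hε _ _ (a1 x σ) (c1 x σ) t (at1 x σ t) (ct1 x σ t)
  · exact fun x σ t =>
      hU1_deriv K ε p hε (a x σ) (c x σ) (a1 x σ) (c1 x σ) (a2 x σ) (c2 x σ) t (at1 x σ t) (ct1 x σ t) (at2 x σ t) (ct2 x σ t)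
  · exact fun x σ t =>
      hU0_deriv K ε p hε (fun σ => a x σ t) (fun σ => c x σ t) (fun σ => -cI * a1 x σ t)
      (fun σ => cI * c1 x σ t) σ (as1 x σ t) (cs1 x σ t)
  · exact fun x σ t =>
      hU1_deriv K ε p hε (fun σ => a x σ t) (fun σ => c x σ t) (fun σ => -cI * a1 x σ t)
      (fun σ => cI * c1 x σ t) (fun σ => -a2 x σ t) (fun σ => -c2 x σ t)
      σ (as1 x σ t) (cs1 x σ t) (as2 x σ t) (cs2 x σ t)
  · exact hU0_cont K ε p hε _ _ ca cc
  · exact hU1_cont K ε p hε _ _ _ _ ca cc ca1 cc1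
  · exact hU2_cont K ε p hε _ _ _ _ _ _ ca cc ca1 cc1 ca2 cc2
  · exact hU1_cont K ε p hε _ _ _ _ ca cc (ca1.const_mul _) (cc1.const_mul _)
  · exact hU2_cont K ε p hε _ _ _ _ _ _ ca cc (ca1.const_mul _) (cc1.const_mul _) ca2.neg cc2.neg
  · intro x t
    rw [hK]
    exact hU2_nonneg p ε hε hp hp' _ _ _ _ _ _

section
variable {X ι : Type*} [TopologicalSpace X] [CompactSpace X]
    [MeasurableSpace X] [BorelSpace X] [SecondCountableTopology X] (μ : Measure X)
    [IsFiniteMeasure μ] (S1 S2 : Finset ι) (lam : ι → ℝ) (e : ι → X → ℂ) (he : ∀ i, Continuous (e i))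
    (hinv : ∀ σ : ℝ, ∃ τ : X → X, MeasurePreserving τ μ μ ∧
      ∀ i x, e i (τ x) = cE (cI * lam i * σ) * e i x)
    (hS1 : ∀ i ∈ S1, 0 < lam i) (hS2 : ∀ i ∈ S2, lam i ≤ 0)

include he hinv hS1 hS2

lemma half_aux (p ε : ℝ) (hp : 1 / 2 < p) (hp' : p ≤ 1) (hε : 0 < ε) :
    0 ≤ ∫ x, hU0 (2 / (2 * p - 1)) ε p (∑ i ∈ S1, e i x) (∑ i ∈ S2, e i x) ∂μ := by
  set K := 2 / (2 * p - 1) with hK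
  let a := gS S1 1 lam e
  let a1 := gS S1 (fun i => -(lam i : ℂ)) lam e
  let a2 := gS S1 (fun i => (lam i : ℂ) * lam i) lam e
  let c := gS S2 1 lam e
  let c1 := gS S2 (fun i => (lam i : ℂ)) lam e
  let c2 := gS S2 (fun i => (lam i : ℂ) * lam i) lam e
  have abs1 : ∀ i ∈ S1, ((|lam i| : ℝ) : ℂ) = lam i := fun i hi => by rw [abs_of_pos (hS1 i hi)]
  have abs2 : ∀ i ∈ S2, ((|lam i| : ℝ) : ℂ) = -lam i := fun i hi => by
    rw [abs_of_nonpos (hS2 i hi)]; push_cast; rfl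
  have at1 : ∀ x σ t, HasDerivAt (fun t => a x σ t) (a1 x σ t) t := fun x σ t =>
    gS_dt S1 _ _ lam e x σ t fun i hi => by rw [abs1 i hi]; simp
  have at2 : ∀ x σ t, HasDerivAt (fun t => a1 x σ t) (a2 x σ t) t := fun x σ t =>
    gS_dt S1 _ _ lam e x σ t fun i hi => by rw [abs1 i hi]; ring
  have ct1 : ∀ x σ t, HasDerivAt (fun t => c x σ t) (c1 x σ t) t := fun x σ t =>
    gS_dt S2 _ _ lam e x σ t fun i hi => by rw [abs2 i hi]; simp
  have ct2 : ∀ x σ t, HasDerivAt (fun t => c1 x σ t) (c2 x σ t) t := fun x σ t =>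
    gS_dt S2 _ _ lam e x σ t fun i hi => by rw [abs2 i hi]; ring
  have as1 : ∀ x σ t, HasDerivAt (fun σ => a x σ t) (-cI * a1 x σ t) σ := fun x σ t => by
    simp only [a1, gS_mul]
    exact gS_ds S1 _ _ lam e x σ t fun i hi => by simp
  have as2 : ∀ x σ t, HasDerivAt (fun σ => -cI * a1 x σ t) (-a2 x σ t) σ := fun x σ t => by
    rw [show -a2 x σ t = (-1) * a2 x σ t by ring]
    simp only [a1, a2, gS_mul]
    exact gS_ds S1 _ _ lam e x σ t fun i hi => by
      linear_combination (-(lam i : ℂ) * lam i) * Complex.I_mul_I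
  have cs1 : ∀ x σ t, HasDerivAt (fun σ => c x σ t) (cI * c1 x σ t) σ := fun x σ t => by
    simp only [c1, gS_mul]
    exact gS_ds S2 _ _ lam e x σ t fun i hi => by simp
  have cs2 : ∀ x σ t, HasDerivAt (fun σ => cI * c1 x σ t) (-c2 x σ t) σ := fun x σ t => by
    rw [show -c2 x σ t = (-1) * c2 x σ t by ring]
    simp only [c1, c2, gS_mul]
    exact gS_ds S2 _ _ lam e x σ t fun i hi => by
      linear_combination (-(lam i : ℂ) * lam i) * Complex.I_mul_I
  have ca : Continuous (fun q : X × R2 => a q.1 q.2.1 q.2.2) := gS_cont _ _ _ _ he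
  have ca1 : Continuous (fun q : X × R2 => a1 q.1 q.2.1 q.2.2) := gS_cont _ _ _ _ he
  have ca2 : Continuous (fun q : X × R2 => a2 q.1 q.2.1 q.2.2) := gS_cont _ _ _ _ he
  have cc : Continuous (fun q : X × R2 => c q.1 q.2.1 q.2.2) := gS_cont _ _ _ _ he
  have cc1 : Continuous (fun q : X × R2 => c1 q.1 q.2.1 q.2.2) := gS_cont _ _ _ _ he
  have cc2 : Continuous (fun q : X × R2 => c2 q.1 q.2.1 q.2.2) := gS_cont _ _ _ _ he
  let z := fun (S : Finset ι) (x : X) (r : ℝ) => ∑ i ∈ S, e i x * ((r ^ |lam i| : ℝ) : ℂ)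
  have hz : ∀ S : Finset ι, Continuous (fun q : ℝ × X => z S q.2 q.1) := by
    intro S
    refine continuous_finsetSum _ fun i _ => ?_
    have : Continuous fun r : ℝ => r ^ |lam i| := Real.continuous_rpow_const (abs_nonneg _)
    fun_prop
  have gz : ∀ S x t, gS S 1 lam e x 0 t = z S x (Real.exp (-t)) := by
    intro S x t
    unfold gS
    refine Finset.sum_congr rfl fun i _ => ?_
    rw [← Real.exp_mul]; push_cast; simp; left; congr 1; ring
  have hH : Continuous (fun r => ∫ x in univ, hU0 K ε p (z S1 x r) (z S2 x r) ∂μ) := by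
    refine continuous_parametric_integral_of_continuous (f := fun r x => hU0 K ε p (z S1 x r) (z S2 x r)) ?_ isCompact_univ
    exact hU0_cont K ε p hε _ _ (hz S1) (hz S2)
  simp only [Measure.restrict_univ] at hH
  have hlim := (hH.tendsto 0).comp (Real.tendsto_exp_neg_atTop_nhds_zero)
  have hinv2 : ∀ σ : ℝ, ∃ τ : X → X, MeasurePreserving τ μ μ ∧
      ∀ x t, a x σ t = a (τ x) 0 t ∧ c x σ t = c (τ x) 0 t := by
    intro σ
    obtain ⟨τ, hτ, hτ'⟩ := hinv σ
    exact ⟨τ, hτ, fun x t => ⟨gS_inv S1 _ lam e τ σ hτ' x t, gS_inv S2 _ lam e τ σ hτ' x t⟩⟩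
  have hres := half_abs μ p ε K hp hp' hε hK a a1 a2 c c1 c2 hinv2 at1 at2 ct1 ct2 as1 as2 cs1 cs2
    ca ca1 ca2 cc cc1 cc2 _ ?_ (by
    refine hlim.congr fun t => ?_
    simp only [Function.comp]
    refine integral_congr_ae (Filter.Eventually.of_forall fun x => ?_)
    simp only [a, c, gz])
  · refine hres.trans_eq (integral_congr_ae (Filter.Eventually.of_forall fun x => ?_))
    simp only [a, c, gz, z]; simp
  · refine integral_nonneg fun x => ?_
    have : z S1 x 0 = 0 := Finset.sum_eq_zero fun i hi => by
      rw [Real.zero_rpow (abs_pos.2 (hS1 i hi).ne').ne']; simp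
    simp only [this, hU0, hq1, hq2, zero_add, norm_zero]
    have h1 : 1 ≤ K := by rw [hK, le_div_iff₀ bl]; linarith
    have h2 : 0 ≤ (‖z S2 x 0‖ ^ 2 + ε ^ 2) ^ p := by positivity
    simp only [ne_eq, OfNat.ofNat_ne_zero, not_false_eq_true, zero_pow, zero_add]
    rw [← sub_one_mul]
    exact mul_nonneg bl h2

lemma half_plane (p : ℝ) (hp : 1 < p) (hp' : p ≤ 2) :
    ∫ x, ‖∑ i ∈ S1, e i x‖ ^ p ∂μ ≤
      2 / (p - 1) * ∫ x, ‖(∑ i ∈ S1, e i x) + ∑ i ∈ S2, e i x‖ ^ p ∂μ := by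
  have cA : Continuous (fun x => ∑ i ∈ S1, e i x) := continuous_finsetSum _ fun i _ => he i
  have cB : Continuous (fun x => ∑ i ∈ S2, e i x) := continuous_finsetSum _ fun i _ => he i
  have int : ∀ f : X → ℝ, Continuous f → Integrable f μ := by
    intro f hf
    obtain ⟨B, hB⟩ := isCompact_univ.exists_bound_of_continuousOn hf.continuousOn
    exact Integrable.of_bound hf.aestronglyMeasurable B (Filter.Eventually.of_forall fun x => hB x (mem_univ _))
  have sqp : ∀ r : ℝ, 0 ≤ r → (r ^ 2) ^ (p / 2) = r ^ p := by
    intro r hr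
    rw [← Real.rpow_natCast r 2, ← Real.rpow_mul hr]; congr 1; push_cast; ring
  have main : ∀ ε, 0 < ε → ∫ x, ‖∑ i ∈ S1, e i x‖ ^ p ∂μ ≤
      2 / (p - 1) * ∫ x, (‖(∑ i ∈ S1, e i x) + ∑ i ∈ S2, e i x‖ ^ 2 + ε ^ 2) ^ (p / 2) ∂μ := by
    intro ε hε
    have h := half_aux μ S1 S2 lam e he hinv hS1 hS2 (p / 2) ε bl bl hε
    rw [show 2 * (p / 2) - 1 = p - 1 by ring] at h
    unfold hU0 at h
    obtain ⟨c1, c2⟩ := hq_cont ε hε _ _ cA cB (p / 2)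
    rw [integral_sub ((int _ c1).const_mul _) (int _ c2), integral_const_mul] at h
    refine le_trans ?_ (sub_nonneg.1 h)
    refine integral_mono (int _ (cA.norm.rpow_const fun x => Or.inr bl)) (int _ c2) fun x => ?_
    simp only [hq2]
    rw [← sqp _ (norm_nonneg _)]
    exact Real.rpow_le_rpow bp (by nlinarith [sq_nonneg ‖∑ i ∈ S2, e i x‖]) bl
  have hH : Continuous (fun ε : ℝ => ∫ x in univ, (‖(∑ i ∈ S1, e i x) + ∑ i ∈ S2, e i x‖ ^ 2 + ε ^ 2) ^ (p / 2) ∂μ) := by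
    refine continuous_parametric_integral_of_continuous (f := fun (ε : ℝ) x => (‖(∑ i ∈ S1, e i x) + ∑ i ∈ S2, e i x‖ ^ 2 + ε ^ 2) ^ (p / 2)) ?_ isCompact_univ
    refine Continuous.rpow_const ?_ fun _ => Or.inr bl
    fun_prop
  simp only [Measure.restrict_univ] at hH
  have hlim := ((hH.tendsto 0).const_mul (2 / (p - 1))).mono_left (nhdsWithin_le_nhds (s := Ioi 0))
  have := ge_of_tendsto hlim (Filter.eventually_of_mem self_mem_nhdsWithin fun ε hε => main ε hε)
  refine this.trans_eq ?_
  congr 1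
  refine integral_congr_ae (Filter.Eventually.of_forall fun x => ?_)
  simp [sqp]
end

abbrev TT := UnitAddTorus (Fin 2)
def muT : Measure TT := Measure.pi (fun _ => (AddCircle.haarAddCircle : Measure UnitAddCircle))

instance : IsProbabilityMeasure muT := by unfold muT; infer_instance
instance : muT.IsAddLeftInvariant := by unfold muT; infer_instance
instance : muT.IsAddRightInvariant := by unfold muT; infer_instance

lemma mFourier_add_arg (n : Fin 2 → ℤ) (x y : TT) :
    UnitAddTorus.mFourier n (x + y) = UnitAddTorus.mFourier n x * UnitAddTorus.mFourier n y := by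
  simp [UnitAddTorus.mFourier, Fin.prod_univ_two]
  simp only [AddCircle.toCircle_add]; push_cast; ring

lemma mFourier_coe (n : Fin 2 → ℤ) (a b : ℝ) :
    UnitAddTorus.mFourier n (![(a : UnitAddCircle), (b : UnitAddCircle)] : TT)
      = cE (2 * π * cI * (n 0 * a + n 1 * b)) := by
  simp only [UnitAddTorus.mFourier, ContinuousMap.coe_mk, Fin.prod_univ_two, Matrix.cons_val_zero, Matrix.cons_val_one, fourier_coe_apply]
  rw [← Complex.exp_add]; congr 1; push_cast; ring

def tp (S : Finset (Fin 2 → ℤ)) (a : (Fin 2 → ℤ) → ℂ) (x : TT) : ℂ :=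
  ∑ n ∈ S, a n * UnitAddTorus.mFourier n x

lemma tp_cont (S : Finset (Fin 2 → ℤ)) (a : (Fin 2 → ℤ) → ℂ) : Continuous (tp S a) := by
  unfold tp; fun_prop

def lamd (θ : ℝ) (n : Fin 2 → ℤ) : ℝ := n 0 * cos θ + n 1 * sin θ

open Classical in
lemma tp_half (p : ℝ) (hp : 1 < p) (hp' : p ≤ 2) (θ : ℝ) (S : Finset (Fin 2 → ℤ)) (a : (Fin 2 → ℤ) → ℂ) :
    ∫⁻ x, ‖∑ n ∈ S, (if 0 < lamd θ n then 1 else 0) * (a n * UnitAddTorus.mFourier n x)‖ₑ ^ p ∂muT ≤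
      oR (2 / (p - 1)) * ∫⁻ x, ‖tp S a x‖ₑ ^ p ∂muT := by
  have h := half_plane muT (S.filter fun n => 0 < lamd θ n) (S.filter fun n => ¬ 0 < lamd θ n)
    (lamd θ) (fun n x => a n * UnitAddTorus.mFourier n x) (by intro n; fun_prop) (by
      intro σ
      let y : TT := ![((σ * cos θ / (2 * π) : ℝ) : UnitAddCircle), ((σ * sin θ / (2 * π) : ℝ) : UnitAddCircle)]
      refine ⟨fun x => x + y, measurePreserving_add_right muT y, fun n x => ?_⟩
      simp only [mFourier_add_arg, y, mFourier_coe]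
      have : (2 * π * cI * (n 0 * ((σ * cos θ / (2 * π) : ℝ) : ℂ) + n 1 * ((σ * sin θ / (2 * π) : ℝ):ℂ)) : ℂ)
         = cI * ((lamd θ n : ℝ) : ℂ) * σ := by
        unfold lamd; push_cast
        have : (π : ℂ) ≠ 0 := by exact_mod_cast pi_ne_zero
        field_simp
      rw [this]; ring) (by simp) (by simp) p hp hp'
  have c1 : Continuous (fun x => ‖∑ i ∈ S.filter (fun n => 0 < lamd θ n), a i * UnitAddTorus.mFourier i x‖ ^ p) :=
    Continuous.rpow_const (by fun_prop) fun _ => Or.inr bl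
  have c2 : Continuous (fun x => ‖tp S a x‖ ^ p) :=
    Continuous.rpow_const (tp_cont S a).norm fun _ => Or.inr bl
  have int : ∀ f : TT → ℝ, Continuous f → Integrable f muT := by
    intro f hf
    obtain ⟨B, hB⟩ := isCompact_univ.exists_bound_of_continuousOn hf.continuousOn
    exact Integrable.of_bound hf.aestronglyMeasurable B (Filter.Eventually.of_forall fun x => hB x (mem_univ _))
  have hs : ∀ x, ∑ n ∈ S, (if 0 < lamd θ n then 1 else 0) * (a n * UnitAddTorus.mFourier n x) =
      ∑ i ∈ S.filter (fun n => 0 < lamd θ n), a i * UnitAddTorus.mFourier i x := by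
    intro x; rw [Finset.sum_filter]; refine Finset.sum_congr rfl fun n _ => ?_
    split_ifs <;> simp
  have hs2 : ∀ x, (∑ i ∈ S.filter (fun n => 0 < lamd θ n), a i * UnitAddTorus.mFourier i x) +
      ∑ i ∈ S.filter (fun n => ¬ 0 < lamd θ n), a i * UnitAddTorus.mFourier i x = tp S a x := by
    intro x; exact Finset.sum_filter_add_sum_filter_not _ _ _
  simp only [hs2] at h
  simp only [hs]
  have e1 := ENNReal.ofReal_le_ofReal h
  rw [ENNReal.ofReal_mul (by apply div_nonneg <;> linarith), ofReal_integral_eq_lintegral_ofReal (int _ c1)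
    (Filter.Eventually.of_forall fun x => by positivity), ofReal_integral_eq_lintegral_ofReal (int _ c2)
    (Filter.Eventually.of_forall fun x => by positivity)] at e1
  simpa only [← ENNReal.ofReal_rpow_of_nonneg (norm_nonneg _) (show 0 ≤ p by linarith), ofReal_norm] using e1

lemma lint_jensen {α : Type*} [MeasurableSpace α] (μ : Measure α) (f : α → ℝ≥0∞) (hf : AEMeasurable f μ)
    (p : ℝ) (hp : 1 < p) : (∫⁻ x, f x ∂μ) ^ p ≤ μ univ ^ (p - 1) * ∫⁻ x, f x ^ p ∂μ := by
  have hpq := Real.HolderConjugate.conjExponent hp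
  have h := ENNReal.lintegral_mul_le_Lp_mul_Lq μ hpq hf (aemeasurable_const (b := 1))
  simp only [Pi.mul_apply, mul_one, ENNReal.one_rpow, lintegral_one] at h
  have h2 := ENNReal.rpow_le_rpow h (show 0 ≤ p by linarith)
  rw [ENNReal.mul_rpow_of_nonneg _ _ bl, ← ENNReal.rpow_mul, ← ENNReal.rpow_mul,
    one_div_mul_cancel bl, ENNReal.rpow_one, mul_comm] at h2
  convert h2 using 3
  rw [Real.conjExponent]; have : p ≠ 0 := by linarith
  field_simp

def npl (n : Fin 2 → ℤ) : ℂ := n 0 + n 1 * cI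

def Rm (n : Fin 2 → ℤ) : ℂ := (starRingEnd ℂ (npl n)) / ‖npl n‖

open Classical in
lemma Rm_int (n : Fin 2 → ℤ) : Rm n = (1 / 2) * ∫ θ in (0 : ℝ)..(2 * π),
    cE (-cI * θ) * (if 0 < lamd θ n then 1 else 0) := by
  by_cases hn : npl n = 0
  · have h0 : (n 0 : ℝ) = 0 := by simpa [npl] using congrArg Complex.re hn
    have h1 : (n 1 : ℝ) = 0 := by simpa [npl] using congrArg Complex.im hn
    simp [Rm, hn, lamd, h0, h1]
  set β := Complex.arg (npl n) with hβ
  set r := ‖npl n‖ with hr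
  have hr0 : 0 < r := norm_pos_iff.2 hn
  have h0 : (n 0 : ℝ) = r * cos β := by
    rw [hr, hβ, Complex.norm_mul_cos_arg]; simp [npl]
  have h1 : (n 1 : ℝ) = r * sin β := by
    rw [hr, hβ, Complex.norm_mul_sin_arg]; simp [npl]
  have hl : ∀ θ, lamd θ n = r * cos (θ - β) := by
    intro θ; unfold lamd; rw [h0, h1, cos_sub]; ring
  have hc : ∀ θ, (0 < lamd θ n) = (0 < cos (θ - β)) := by
    intro θ; rw [hl, mul_pos_iff_of_pos_left hr0]
  have hR : Rm n = cE (-cI * β) := by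
    have : npl n = r * cE (β * cI) := (Complex.norm_mul_exp_arg_mul_I _).symm
    unfold Rm
    rw [← hr, this, map_mul, Complex.conj_ofReal, ← Complex.exp_conj]
    have hrc : (r : ℂ) ≠ 0 := by exact_mod_cast hr0.ne'
    rw [mul_div_assoc, mul_comm, div_mul_cancel₀ _ hrc]; simp; ring_nf
  simp only [hc]
  let F : ℝ → ℂ := fun t => cE (-cI * (t + β : ℝ)) * (if 0 < cos t then 1 else 0)
  have hF : ∀ θ : ℝ, cE (-cI * θ) * (if 0 < cos (θ - β) then 1 else 0) = F (θ - β) := by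
    intro θ; simp [F]
  have hper : Function.Periodic F (2 * π) := by
    intro t
    simp only [F, cos_add_two_pi]
    congr 1
    rw [show (-cI * ((t + 2 * π + β : ℝ) : ℂ)) = -cI * ((t + β : ℝ) : ℂ) - 2 * π * cI by
      push_cast; ring, Complex.exp_sub, Complex.exp_two_pi_mul_I, div_one]
  rw [intervalIntegral.integral_congr (g := fun θ => F (θ - β)) (fun θ _ => hF θ),
    intervalIntegral.integral_comp_sub_right F β]
  have := hper.intervalIntegral_add_eq (0 - β) (-π)
  rw [show 2 * π - β = 0 - β + 2 * π by ring, this, show -π + 2 * π = π by ring]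
  have hi : ∫ t in -π..π, F t = ∫ t in -(π/2)..(π/2), cE (-cI * (t + β : ℝ)) := by
    have hp := pi_pos
    rw [intervalIntegral.integral_of_le bl, intervalIntegral.integral_of_le bl,
      integral_Ioc_eq_integral_Ioo (x := -(π/2))]
    have hFi : ∀ t ∈ Ioc (-π) π, F t = (Ioo (-(π/2)) (π/2)).indicator
        (fun t : ℝ => cE (-cI * (t + β : ℝ))) t := by
      intro t ht
      by_cases h : t ∈ Ioo (-(π/2)) (π/2)
      · rw [indicator_of_mem h]
        simp [F, cos_pos_of_mem_Ioo h]
      · rw [indicator_of_notMem h]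
        have : ¬ 0 < cos t := by
          rw [not_lt]
          rcases le_or_gt (π/2) t with h2 | h2
          · exact cos_nonpos_of_pi_div_two_le_of_le h2 (by linarith [ht.2])
          · have h3 : t ≤ -(π/2) := by
              by_contra h4; exact h ⟨by linarith, h2⟩
            rw [← cos_neg]
            exact cos_nonpos_of_pi_div_two_le_of_le bl (by linarith [ht.1])
        simp [F, this]
    rw [setIntegral_congr_fun measurableSet_Ioc hFi, setIntegral_indicator measurableSet_Ioo]
    congr 2
    rw [inter_eq_right]
    exact fun t ht => ⟨by linarith [ht.1], by linarith [ht.2]⟩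
  rw [hi, hR]
  have : ∀ t : ℝ, cE (-cI * (t + β : ℝ)) = cE (-cI * β) * cE (-cI * t) := by
    intro t; rw [← Complex.exp_add]; congr 1; push_cast; ring
  simp only [this]
  rw [intervalIntegral.integral_const_mul, integral_exp_mul_complex (by simp)]
  have e1 : cE (-cI * (π/2 : ℝ)) = -cI := by
    rw [show -cI * ((π/2 : ℝ) : ℂ) = -(π / 2 * cI) by push_cast; ring, Complex.exp_neg, Complex.exp_pi_div_two_mul_I]
    simp
  have e2 : cE (-cI * (-(π/2) : ℝ)) = cI := by
    rw [show -cI * ((-(π/2) : ℝ) : ℂ) = (π / 2 * cI) by push_cast; ring, Complex.exp_pi_div_two_mul_I]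
  rw [e1, e2]
  field_simp
  ring_nf

open Classical in
lemma tp_R (p : ℝ) (hp : 1 < p) (hp' : p ≤ 2) : ∃ C : ℝ≥0∞, C ≠ ⊤ ∧ ∀ (S : Finset (Fin 2 → ℤ)) (a : (Fin 2 → ℤ) → ℂ),
    ∫⁻ x, ‖tp S (fun n => Rm n * a n) x‖ₑ ^ p ∂muT ≤ C * ∫⁻ x, ‖tp S a x‖ₑ ^ p ∂muT := by
  let ν : Measure ℝ := volume.restrict (Ioc 0 (2 * π))
  have hν : ν univ = oR (2 * π) := by simp [ν]
  refine ⟨ν univ ^ (p - 1) * (oR (2 / (p - 1)) * ν univ), ?_, fun S a => ?_⟩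
  · rw [hν]
    refine ENNReal.mul_ne_top (ENNReal.rpow_ne_top_of_nonneg bl ENNReal.ofReal_ne_top)
      (ENNReal.mul_ne_top ENNReal.ofReal_ne_top ENNReal.ofReal_ne_top)
  let G : ℝ → TT → ℂ := fun θ x => ∑ n ∈ S, (if 0 < lamd θ n then 1 else 0) * (a n * UnitAddTorus.mFourier n x)
  have hm : ∀ n, Measurable (fun θ : ℝ => (if 0 < lamd θ n then (1:ℂ) else 0)) := by
    intro n
    refine Measurable.ite ?_ measurable_const measurable_const
    have : Continuous (fun θ => lamd θ n) := by unfold lamd; fun_prop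
    exact (isOpen_lt continuous_const this).measurableSet
  have hGm : Measurable (fun q : TT × ℝ => G q.2 q.1) := by
    refine Finset.measurable_sum _ fun n _ => ?_
    refine ((hm n).comp measurable_snd).mul ?_
    have : Measurable fun x : TT => a n * UnitAddTorus.mFourier n x := Continuous.measurable (by fun_prop)
    exact this.comp measurable_fst
  have hrep : ∀ x, tp S (fun n => Rm n * a n) x = (1/2) * ∫ θ, cE (-cI * θ) * G θ x ∂ν := by
    intro x
    have hint : ∀ n, Integrable (fun θ : ℝ => cE (-cI * θ) * (if 0 < lamd θ n then (1:ℂ) else 0)) ν := by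
      intro n
      refine Integrable.of_bound ((Continuous.measurable (by fun_prop)).mul (hm n)).aestronglyMeasurable 1 (Filter.Eventually.of_forall fun θ => ?_)
      rw [norm_mul, show -cI * (θ : ℂ) = ((-θ : ℝ) : ℂ) * cI by push_cast; ring,
        Complex.norm_exp_ofReal_mul_I]
      split_ifs <;> simp
    have : ∀ θ : ℝ, cE (-cI * θ) * G θ x = ∑ n ∈ S,
        (cE (-cI * θ) * (if 0 < lamd θ n then (1:ℂ) else 0)) * (a n * UnitAddTorus.mFourier n x) := by
      intro θ; simp only [G]; rw [Finset.mul_sum]; refine Finset.sum_congr rfl fun n _ => ?_; ring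
    simp only [this]
    rw [integral_finsetSum _ fun n _ => (hint n).mul_const _, Finset.mul_sum]
    unfold tp
    refine Finset.sum_congr rfl fun n _ => ?_
    simp only [Rm_int]
    rw [intervalIntegral.integral_of_le bp, integral_mul_const]
    simp only [ν]
    ring
  have hb : ∀ x, ‖tp S (fun n => Rm n * a n) x‖ₑ ≤ ∫⁻ θ, ‖G θ x‖ₑ ∂ν := by
    intro x
    rw [hrep, enorm_mul]
    have h1 : ‖(1/2 : ℂ)‖ₑ ≤ 1 := by
      rw [← ofReal_norm, ← ENNReal.ofReal_one]; exact ENNReal.ofReal_le_ofReal bn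
    calc _ ≤ 1 * ∫⁻ θ, ‖cE (-cI * θ) * G θ x‖ₑ ∂ν :=
          mul_le_mul' h1 (enorm_integral_le_lintegral_enorm _)
      _ = _ := by
          rw [one_mul]; refine lintegral_congr fun θ => ?_
          rw [enorm_mul, ← ofReal_norm, show -cI * (θ : ℂ) = ((-θ : ℝ) : ℂ) * cI by push_cast; ring,
            Complex.norm_exp_ofReal_mul_I]; simp
  calc ∫⁻ x, ‖tp S (fun n => Rm n * a n) x‖ₑ ^ p ∂muT
      ≤ ∫⁻ x, ν univ ^ (p - 1) * ∫⁻ θ, ‖G θ x‖ₑ ^ p ∂ν ∂muT := by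
        refine lintegral_mono fun x => ?_
        refine (ENNReal.rpow_le_rpow (hb x) bl).trans ?_
        exact lint_jensen ν _ ((hGm.comp (measurable_prodMk_left (x := x))).enorm).aemeasurable p hp
    _ = ν univ ^ (p - 1) * ∫⁻ θ, ∫⁻ x, ‖G θ x‖ₑ ^ p ∂muT ∂ν := by
        rw [lintegral_const_mul, lintegral_lintegral_swap]
        · exact (hGm.enorm.pow_const p).aemeasurable
        · exact (hGm.enorm.pow_const p).lintegral_prod_right'
    _ ≤ ν univ ^ (p - 1) * ∫⁻ θ, (oR (2 / (p - 1)) * ∫⁻ x, ‖tp S a x‖ₑ ^ p ∂muT) ∂ν := by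
        gcongr with θ
        exact tp_half p hp hp' θ S a
    _ = _ := by rw [lintegral_const]; ring

def Mm (n : Fin 2 → ℤ) : ℂ := Rm n * Rm n

lemma tp_M (p : ℝ) (hp : 1 < p) (hp' : p ≤ 2) : ∃ C : ℝ≥0∞, C ≠ ⊤ ∧ ∀ (S : Finset (Fin 2 → ℤ)) (a : (Fin 2 → ℤ) → ℂ),
    ∫⁻ x, ‖tp S (fun n => Mm n * a n) x‖ₑ ^ p ∂muT ≤ C * ∫⁻ x, ‖tp S a x‖ₑ ^ p ∂muT := by
  obtain ⟨C, hC, h⟩ := tp_R p hp hp'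
  refine ⟨C * C, ENNReal.mul_ne_top hC hC, fun S a => ?_⟩
  have h1 := h S (fun n => Rm n * a n)
  have h2 := h S a
  simp only [Mm, mul_assoc]
  refine h1.trans ?_
  gcongr

section dens
local instance iMS : MeasureSpace UnitAddCircle := ⟨AddCircle.haarAddCircle⟩
local instance iHaar : Measure.IsAddHaarMeasure (volume : Measure UnitAddCircle) :=
  inferInstanceAs (Measure.IsAddHaarMeasure AddCircle.haarAddCircle)
local instance iProb : IsProbabilityMeasure (volume : Measure UnitAddCircle) :=
  inferInstanceAs (IsProbabilityMeasure AddCircle.haarAddCircle)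

lemma tp_dense0 (q : ℝ) (hq : 1 < q) (φ : TT → ℂ) (hφ : Measurable φ) (B : ℝ) (hB : ∀ x, ‖φ x‖ ≤ B)
    (ε : ℝ≥0∞) (hε : 0 < ε) : ∃ S a, (∫⁻ x, ‖φ x - tp S a x‖ₑ ^ q ∂(volume : Measure TT)) ^ (1 / q) < ε := by
  have : Fact (1 ≤ oR q) := ⟨by rw [← ENNReal.ofReal_one]; exact ENNReal.ofReal_le_ofReal hq.le⟩
  have hd := UnitAddTorus.span_mFourierLp_closure_eq_top (d := Fin 2) (p := oR q) ENNReal.ofReal_ne_top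
  have hmem : MemLp φ (oR q) (volume : Measure TT) :=
    MemLp.of_bound hφ.aestronglyMeasurable B (Filter.Eventually.of_forall hB)
  have h1 : hmem.toLp φ ∈ (Submodule.span ℂ (range (@UnitAddTorus.mFourierLp (Fin 2) _ (oR q) _))).topologicalClosure := by
    rw [hd]; trivial
  have h2 := (EMetric.mem_closure_iff.1 h1) ε hε
  obtain ⟨T, hT, hT'⟩ := h2
  obtain ⟨c, rfl⟩ := (Finsupp.mem_span_range_iff_exists_finsupp).1 hT
  refine ⟨c.support, c, ?_⟩
  rw [Lp.edist_def] at hT'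
  rw [eLpNorm_eq_lintegral_rpow_enorm_toReal (by simp; linarith) ENNReal.ofReal_ne_top, ENNReal.toReal_ofReal bl] at hT'
  refine lt_of_le_of_lt (le_of_eq ?_) hT'
  congr 1
  refine lintegral_congr_ae ?_
  have hc : ∀ S : Finset (Fin 2 → ℤ), (fun x => tp S c x) =ᵐ[volume] ⇑(∑ n ∈ S, c n • UnitAddTorus.mFourierLp (oR q) n : Lp ℂ (oR q) (volume : Measure TT)) := by
    intro S
    induction S using Finset.induction_on with
    | empty =>
      simp only [Finset.sum_empty, tp]
      exact (Lp.coeFn_zero _ _ _).symm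
    | insert n S hn ih =>
      rw [Finset.sum_insert hn]
      filter_upwards [Lp.coeFn_add (c n • UnitAddTorus.mFourierLp (oR q) n) (∑ n ∈ S, c n • UnitAddTorus.mFourierLp (oR q) n : Lp ℂ (oR q) (volume : Measure TT)),
        Lp.coeFn_smul (c n) (UnitAddTorus.mFourierLp (oR q) n), UnitAddTorus.coeFn_mFourierLp (oR q) n, ih] with x h1 h2 h3 h4
      rw [h1, Pi.add_apply, ← h4, h2, Pi.smul_apply, h3]
      simp only [tp, Finset.sum_insert hn, smul_eq_mul]
  filter_upwards [hc c.support, hmem.coeFn_toLp] with x h1 h2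
  simp only [Pi.sub_apply]
  rw [h1, h2]; rfl

lemma torus_lint (f : TT → ℝ≥0∞) (a : Fin 2 → ℝ) : ∫⁻ x, f x ∂muT =
    ∫⁻ (x : Fin 2 → ℝ) in {x : Fin 2 → ℝ | ∀ i, x i ∈ Ioc (a i) (a i + 1)}, f (fun i => x i) :=
  UnitAddTorus.lintegral_preimage f a

lemma torus_int (f : TT → ℂ) (a : Fin 2 → ℝ) : ∫ x, f x ∂muT =
    ∫ (x : Fin 2 → ℝ) in {x : Fin 2 → ℝ | ∀ i, x i ∈ Ioc (a i) (a i + 1)}, f (fun i => x i) :=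
  UnitAddTorus.integral_preimage f a
end dens

lemma tp_dense (q : ℝ) (hq : 1 < q) (φ : TT → ℂ) (hφ : Measurable φ) (B : ℝ) (hB : ∀ x, ‖φ x‖ ≤ B)
    (ε : ℝ≥0∞) (hε : 0 < ε) : ∃ S a, (∫⁻ x, ‖φ x - tp S a x‖ₑ ^ q ∂muT) ^ (1 / q) < ε :=
  tp_dense0 q hq φ hφ B hB ε hε

lemma l1_le_lq (q : ℝ) (hq : 1 < q) (f : TT → ℂ) (hf : Measurable f) :
    ∫⁻ x, ‖f x‖ₑ ∂muT ≤ (∫⁻ x, ‖f x‖ₑ ^ q ∂muT) ^ (1 / q) := by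
  have h := lint_jensen muT (fun x => ‖f x‖ₑ) hf.enorm.aemeasurable q hq
  rw [measure_univ, ENNReal.one_rpow, one_mul] at h
  have h2 := ENNReal.rpow_le_rpow h (show 0 ≤ 1 / q by positivity)
  rwa [← ENNReal.rpow_mul, mul_one_div_cancel bl, ENNReal.rpow_one] at h2

lemma dual_ext (q : ℝ) (hq : 1 < q) (g : TT → ℂ) (hg : Measurable g) (Bg : ℝ) (hBg : ∀ x, ‖g x‖ ≤ Bg)
    (C : ℝ≥0∞) (hC : C ≠ ⊤)
    (h : ∀ S a, ‖∫ x, g x * tp S a x ∂muT‖ₑ ≤ C * (∫⁻ x, ‖tp S a x‖ₑ ^ q ∂muT) ^ (1 / q))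
    (φ : TT → ℂ) (hφ : Measurable φ) (B : ℝ) (hB : ∀ x, ‖φ x‖ ≤ B) :
    ‖∫ x, g x * φ x ∂muT‖ₑ ≤ C * (∫⁻ x, ‖φ x‖ₑ ^ q ∂muT) ^ (1 / q) := by
  have hBg0 : 0 ≤ Bg := (norm_nonneg _).trans (hBg 0)
  refine ENNReal.le_of_forall_pos_le_add fun δ hδ _ => ?_
  set W : ℝ≥0∞ := C + oR Bg + 1 with hW
  have hWt : W ≠ ⊤ := by simp [hW, hC]
  have hW0 : W ≠ 0 := by simp [hW]
  obtain ⟨S, a, hT⟩ := tp_dense q hq φ hφ B hB (δ / W) (ENNReal.div_pos (by simpa using hδ.ne') hWt)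
  have hTm : Measurable (tp S a) := (tp_cont S a).measurable
  obtain ⟨BT, hBT⟩ := isCompact_univ.exists_bound_of_continuousOn (tp_cont S a).continuousOn
  have i1 : Integrable (fun x => g x * tp S a x) muT :=
    Integrable.of_bound (hg.mul hTm).aestronglyMeasurable (Bg * BT) (Filter.Eventually.of_forall fun x => by
      rw [norm_mul]; exact mul_le_mul (hBg x) (hBT x (mem_univ _)) (norm_nonneg _) hBg0)
  have i2 : Integrable (fun x => g x * (φ x - tp S a x)) muT :=
    Integrable.of_bound (hg.mul (hφ.sub hTm)).aestronglyMeasurable (Bg * (B + BT)) (Filter.Eventually.of_forall fun x => by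
      rw [norm_mul]; exact mul_le_mul (hBg x) ((norm_sub_le _ _).trans (add_le_add (hB x) (hBT x (mem_univ _)))) (norm_nonneg _) hBg0)
  have e : ∫ x, g x * φ x ∂muT = ∫ x, g x * tp S a x ∂muT + ∫ x, g x * (φ x - tp S a x) ∂muT := by
    rw [← integral_add i1 i2]; congr 1; ext x; ring
  have e1 : ‖∫ x, g x * (φ x - tp S a x) ∂muT‖ₑ ≤ oR Bg * (δ / W) := by
    refine (enorm_integral_le_lintegral_enorm _).trans ?_
    calc _ ≤ ∫⁻ x, oR Bg * ‖φ x - tp S a x‖ₑ ∂muT := by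
          refine lintegral_mono fun x => ?_
          rw [enorm_mul]; gcongr
          rw [← ofReal_norm]; exact ENNReal.ofReal_le_ofReal (hBg x)
      _ = oR Bg * ∫⁻ x, ‖φ x - tp S a x‖ₑ ∂muT := lintegral_const_mul _ (hφ.sub hTm).enorm
      _ ≤ _ := by gcongr; exact (l1_le_lq q hq _ (hφ.sub hTm)).trans hT.le
  have e2 : (∫⁻ x, ‖tp S a x‖ₑ ^ q ∂muT) ^ (1 / q) ≤ (∫⁻ x, ‖φ x‖ₑ ^ q ∂muT) ^ (1 / q) + δ / W := by
    have hm := eLpNorm'_add_le (μ := muT) (q := q) (f := φ) (g := fun x => tp S a x - φ x) hφ.aestronglyMeasurable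
      (hTm.sub hφ).aestronglyMeasurable hq.le
    unfold eLpNorm' at hm
    simp only [Pi.add_apply, add_sub_cancel] at hm
    refine hm.trans ?_
    gcongr
    refine le_trans (le_of_eq ?_) hT.le
    congr 1; refine lintegral_congr fun x => ?_
    rw [← enorm_neg, neg_sub]
  rw [e]
  calc _ ≤ ‖∫ x, g x * tp S a x ∂muT‖ₑ + ‖∫ x, g x * (φ x - tp S a x) ∂muT‖ₑ := enorm_add_le _ _
    _ ≤ C * ((∫⁻ x, ‖φ x‖ₑ ^ q ∂muT) ^ (1 / q) + δ / W) + oR Bg * (δ / W) := by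
        gcongr
        exact (h S a).trans (by gcongr)
    _ ≤ C * (∫⁻ x, ‖φ x‖ₑ ^ q ∂muT) ^ (1 / q) + W * (δ / W) := by
        rw [mul_add, add_assoc, ← add_mul]; gcongr; rw [hW]; exact le_self_add
    _ = _ := by rw [ENNReal.mul_div_cancel hW0 hWt]

lemma dual_lp (p q : ℝ) (hpq : p.HolderConjugate q) (g : TT → ℂ) (hg : Measurable g) (Bg : ℝ) (hBg : ∀ x, ‖g x‖ ≤ Bg)
    (C : ℝ≥0∞) (hC : C ≠ ⊤)
    (h : ∀ S a, ‖∫ x, g x * tp S a x ∂muT‖ₑ ≤ C * (∫⁻ x, ‖tp S a x‖ₑ ^ q ∂muT) ^ (1 / q)) :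
    (∫⁻ x, ‖g x‖ₑ ^ p ∂muT) ^ (1 / p) ≤ C := by
  have hp := hpq.lt
  have hq := hpq.symm.lt
  have hBg0 : 0 ≤ Bg := (norm_nonneg _).trans (hBg 0)
  let φ : TT → ℂ := fun x => (starRingEnd ℂ (g x)) * ((‖g x‖ ^ (p - 2) : ℝ) : ℂ)
  have hφm : Measurable φ := by
    have : Measurable (starRingEnd ℂ : ℂ → ℂ) := Complex.continuous_conj.measurable
    exact (this.comp hg).mul (Complex.measurable_ofReal.comp (hg.norm.pow_const _))
  have hφn : ∀ x, ‖φ x‖ = ‖g x‖ ^ (p - 1) := by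
    intro x
    simp only [φ, norm_mul, RCLike.norm_conj, Complex.norm_real]
    rw [norm_of_nonneg bp]
    rcases eq_or_lt_of_le (norm_nonneg (g x)) with h0 | h0
    · rw [← h0, zero_mul, zero_rpow bl]
    · nth_rewrite 1 [← rpow_one ‖g x‖]; rw [← rpow_add h0]; congr 1; ring
  have hgφ : ∀ x, g x * φ x = ((‖g x‖ ^ p : ℝ) : ℂ) := by
    intro x
    simp only [φ, ← mul_assoc, Complex.mul_conj]
    rw [Complex.normSq_eq_norm_sq, ← Complex.ofReal_mul]
    congr 1
    rcases eq_or_lt_of_le (norm_nonneg (g x)) with h0 | h0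
    · rw [← h0, zero_rpow (by linarith : p ≠ 0)]; simp
    · rw [← rpow_natCast, ← rpow_add h0]; congr 1; push_cast; ring
  have hb : ∀ x, ‖φ x‖ ≤ Bg ^ (p - 1) := by
    intro x; rw [hφn]; exact rpow_le_rpow (norm_nonneg _) (hBg x) bl
  have key := dual_ext q hq g hg Bg hBg C hC h φ hφm _ hb
  simp only [hgφ] at key
  set I := ∫⁻ x, ‖g x‖ₑ ^ p ∂muT with hI
  have hgi : Integrable (fun x => ‖g x‖ ^ p) muT :=
    Integrable.of_bound (hg.norm.pow_const _).aestronglyMeasurable (Bg ^ p) (Filter.Eventually.of_forall fun x => by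
      rw [norm_of_nonneg bp]; exact rpow_le_rpow (norm_nonneg _) (hBg x) bl)
  have hpe : ∀ x, oR (‖g x‖ ^ p) = ‖g x‖ₑ ^ p := by
    intro x; rw [← ENNReal.ofReal_rpow_of_nonneg (norm_nonneg _) bl, ofReal_norm]
  have hIeq : ‖∫ x, ((‖g x‖ ^ p : ℝ) : ℂ) ∂muT‖ₑ = I := by
    rw [integral_complex_ofReal, ← ofReal_norm, Complex.norm_real, norm_of_nonneg (integral_nonneg fun x => by positivity),
      ofReal_integral_eq_lintegral_ofReal hgi (Filter.Eventually.of_forall fun x => by positivity)]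
    simp only [hpe, hI]
  have hIt : I ≠ ⊤ := by
    rw [← hIeq]; exact enorm_ne_top
  have hI2 : ∫⁻ x, ‖φ x‖ₑ ^ q ∂muT = I := by
    refine lintegral_congr fun x => ?_
    rw [← ofReal_norm, hφn, ENNReal.ofReal_rpow_of_nonneg bp bl, ← rpow_mul (norm_nonneg _),
      ← hpe]
    congr 2
    have := hpq.sub_one_mul_conj; linarith
  rw [hIeq, hI2] at key
  rcases eq_or_ne I 0 with h0 | h0
  · rw [h0, ENNReal.zero_rpow_of_pos bp]; exact zero_le
  have e1 : 1 / p = 1 - 1 / q := by have := hpq.inv_add_inv_eq_one; simp only [one_div]; linarith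
  rw [e1, ENNReal.rpow_sub _ _ h0 hIt, ENNReal.rpow_one]
  exact ENNReal.div_le_of_le_mul key

lemma int_mFourier_zero (k : Fin 2 → ℤ) (hk : k ≠ 0) : ∫ x, UnitAddTorus.mFourier k x ∂muT = 0 := by
  have : ∃ y : TT, UnitAddTorus.mFourier k y = -1 := by
    by_cases h0 : k 0 = 0
    · have h1 : k 1 ≠ 0 := by
        intro h1; apply hk; ext i; fin_cases i <;> simp [h0, h1]
      have h1' : (k 1 : ℂ) ≠ 0 := by exact_mod_cast h1
      refine ⟨![((0 : ℝ) : UnitAddCircle), ((1 / (2 * k 1) : ℝ) : UnitAddCircle)], ?_⟩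
      rw [mFourier_coe, ← Complex.exp_pi_mul_I]; congr 1; push_cast; field_simp; simp
    · have h1' : (k 0 : ℂ) ≠ 0 := by exact_mod_cast h0
      refine ⟨![((1 / (2 * k 0) : ℝ) : UnitAddCircle), ((0 : ℝ) : UnitAddCircle)], ?_⟩
      rw [mFourier_coe, ← Complex.exp_pi_mul_I]; congr 1; push_cast; field_simp; simp
  obtain ⟨y, hy⟩ := this
  have h := integral_add_right_eq_self (μ := muT) (fun x => UnitAddTorus.mFourier k x) y
  simp only [mFourier_add_arg, hy, mul_neg, mul_one, integral_neg] at h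
  linear_combination (-1/2 : ℂ) * h

lemma Mm_neg (n : Fin 2 → ℤ) : Mm (-n) = Mm n := by
  have : npl (-n) = - npl n := by simp [npl]; ring
  simp only [Mm, Rm, this, map_neg, norm_neg]; ring

lemma int_tp_mul (S : Finset (Fin 2 → ℤ)) (a : (Fin 2 → ℤ) → ℂ) (g : TT → ℂ) (hg : Measurable g) (B : ℝ)
    (hB : ∀ x, ‖g x‖ ≤ B) :
    ∫ x, g x * tp S a x ∂muT = ∑ n ∈ S, a n * ∫ x, g x * UnitAddTorus.mFourier n x ∂muT := by
  simp only [tp, Finset.mul_sum]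
  have hi : ∀ n, Integrable (fun x => g x * UnitAddTorus.mFourier n x) muT := by
    intro n
    refine Integrable.of_bound (hg.mul (UnitAddTorus.mFourier n).continuous.measurable).aestronglyMeasurable B (Filter.Eventually.of_forall fun x => ?_)
    rw [norm_mul]
    have := (UnitAddTorus.mFourier n).norm_coe_le_norm x
    rw [UnitAddTorus.mFourier_norm] at this
    nlinarith [hB x, norm_nonneg (g x)]
  have : ∀ n x, g x * (a n * UnitAddTorus.mFourier n x) = a n * (g x * UnitAddTorus.mFourier n x) := by
    intro n x; ring
  simp only [this]
  rw [integral_finsetSum _ fun n _ => (hi n).const_mul _]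
  refine Finset.sum_congr rfl fun n _ => ?_
  rw [integral_const_mul]

lemma tp_bdd (S : Finset (Fin 2 → ℤ)) (a : (Fin 2 → ℤ) → ℂ) : ∃ B, ∀ x, ‖tp S a x‖ ≤ B := by
  obtain ⟨BT, hBT⟩ := isCompact_univ.exists_bound_of_continuousOn (tp_cont S a).continuousOn
  exact ⟨BT, fun x => hBT x (mem_univ _)⟩

lemma mult_swap (S S' : Finset (Fin 2 → ℤ)) (a b : (Fin 2 → ℤ) → ℂ) :
    ∫ x, tp S (fun n => Mm n * a n) x * tp S' b x ∂muT = ∫ x, tp S a x * tp S' (fun n => Mm n * b n) x ∂muT := by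
  obtain ⟨B1, h1⟩ := tp_bdd S (fun n => Mm n * a n)
  obtain ⟨B2, h2⟩ := tp_bdd S a
  rw [int_tp_mul S' b _ (tp_cont _ _).measurable B1 h1, int_tp_mul S' _ _ (tp_cont _ _).measurable B2 h2]
  refine Finset.sum_congr rfl fun m _ => ?_
  have hm : ∀ x, ‖UnitAddTorus.mFourier m x‖ ≤ 1 := fun x => by
    have := (UnitAddTorus.mFourier m).norm_coe_le_norm x
    rwa [UnitAddTorus.mFourier_norm] at this
  simp only [mul_comm (tp S _ _)]
  rw [int_tp_mul S _ _ (UnitAddTorus.mFourier m).continuous.measurable 1 hm,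
    int_tp_mul S _ _ (UnitAddTorus.mFourier m).continuous.measurable 1 hm, Finset.mul_sum, Finset.mul_sum]
  refine Finset.sum_congr rfl fun n _ => ?_
  simp only [← UnitAddTorus.mFourier_add]
  by_cases h : m + n = 0
  · have : m = -n := by rwa [← eq_neg_iff_add_eq_zero] at h
    rw [this, Mm_neg]; ring
  · rw [int_mFourier_zero _ h]; ring

lemma enorm_int_mul_le (p q : ℝ) (hpq : p.HolderConjugate q) (f g : TT → ℂ) (hf : Measurable f) (hg : Measurable g) :
    ‖∫ x, f x * g x ∂muT‖ₑ ≤ (∫⁻ x, ‖f x‖ₑ ^ p ∂muT) ^ (1 / p) * (∫⁻ x, ‖g x‖ₑ ^ q ∂muT) ^ (1 / q) := by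
  refine (enorm_integral_le_lintegral_enorm _).trans ?_
  simp only [enorm_mul]
  exact ENNReal.lintegral_mul_le_Lp_mul_Lq muT hpq hf.enorm.aemeasurable hg.enorm.aemeasurable

lemma tp_M_small (p : ℝ) (hp : 1 < p) (hp' : p ≤ 2) : ∃ C : ℝ≥0∞, C ≠ ⊤ ∧ ∀ (S : Finset (Fin 2 → ℤ)) (a : (Fin 2 → ℤ) → ℂ),
    (∫⁻ x, ‖tp S (fun n => Mm n * a n) x‖ₑ ^ p ∂muT) ^ (1 / p) ≤ C * (∫⁻ x, ‖tp S a x‖ₑ ^ p ∂muT) ^ (1 / p) := by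
  obtain ⟨C, hC, h⟩ := tp_M p hp hp'
  refine ⟨C ^ (1 / p), ENNReal.rpow_ne_top_of_nonneg bp hC, fun S a => ?_⟩
  rw [← ENNReal.mul_rpow_of_nonneg _ _ bp]
  exact ENNReal.rpow_le_rpow (h S a) bp

lemma tp_M_all (p : ℝ) (hp : 1 < p) : ∃ C : ℝ≥0∞, C ≠ ⊤ ∧ ∀ (S : Finset (Fin 2 → ℤ)) (a : (Fin 2 → ℤ) → ℂ),
    (∫⁻ x, ‖tp S (fun n => Mm n * a n) x‖ₑ ^ p ∂muT) ^ (1 / p) ≤ C * (∫⁻ x, ‖tp S a x‖ₑ ^ p ∂muT) ^ (1 / p) := by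
  rcases le_or_gt p 2 with h2 | h2
  · exact tp_M_small p hp h2
  have hpq := Real.HolderConjugate.conjExponent hp
  set q := Real.conjExponent p
  have hq2 : q ≤ 2 := by
    simp only [q, Real.conjExponent]; rw [div_le_iff₀ bl]; linarith
  obtain ⟨C, hC, h⟩ := tp_M_small q hpq.symm.lt hq2
  refine ⟨C, hC, fun S a => ?_⟩
  obtain ⟨B1, h1⟩ := tp_bdd S (fun n => Mm n * a n)
  have hfin : (∫⁻ x, ‖tp S a x‖ₑ ^ p ∂muT) ^ (1 / p) ≠ ⊤ := by
    obtain ⟨B2, h2⟩ := tp_bdd S a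
    refine ENNReal.rpow_ne_top_of_nonneg bp (ne_top_of_le_ne_top (b := ∫⁻ x, oR B2 ^ p ∂muT) ?_ ?_)
    · rw [lintegral_const, measure_univ, mul_one]; exact ENNReal.rpow_ne_top_of_nonneg bl ENNReal.ofReal_ne_top
    · refine lintegral_mono fun x => ?_
      refine ENNReal.rpow_le_rpow ?_ bl
      rw [← ofReal_norm]; exact ENNReal.ofReal_le_ofReal (h2 x)
  refine dual_lp p q hpq _ (tp_cont _ _).measurable B1 h1 _ (ENNReal.mul_ne_top hC hfin) fun S' b => ?_
  rw [mult_swap]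
  refine (enorm_int_mul_le p q hpq _ _ (tp_cont _ _).measurable (tp_cont _ _).measurable).trans ?_
  calc _ ≤ (∫⁻ x, ‖tp S a x‖ₑ ^ p ∂muT) ^ (1 / p) * (C * (∫⁻ x, ‖tp S' b x‖ₑ ^ q ∂muT) ^ (1 / q)) := by
        gcongr; exact h S' b
    _ = _ := by ring

lemma torus_lint2 (f : TT → ℝ≥0∞) (a b : ℝ) : ∫⁻ x, f x ∂muT =
    ∫⁻ z in (Ioc a (a + 1) ×ˢ Ioc b (b + 1) : Set (R2)), f ![(z.1 : UnitAddCircle), (z.2 : UnitAddCircle)] := by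
  rw [torus_lint f ![a, b]]
  rw [← (volume_preserving_finTwoArrow ℝ).setLIntegral_comp_preimage_emb (MeasurableEquiv.measurableEmbedding _)]
  congr 1
  · congr 1; ext x
    simp [MeasurableEquiv.finTwoArrow, Fin.forall_fin_two]
  · ext x; congr 1; ext i; fin_cases i <;> simp [MeasurableEquiv.finTwoArrow]

lemma torus_int2 (f : TT → ℂ) (a b : ℝ) : ∫ x, f x ∂muT =
    ∫ z in (Ioc a (a + 1) ×ˢ Ioc b (b + 1) : Set (R2)), f ![(z.1 : UnitAddCircle), (z.2 : UnitAddCircle)] := by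
  rw [torus_int f ![a, b]]
  rw [← (volume_preserving_finTwoArrow ℝ).setIntegral_preimage_emb (MeasurableEquiv.measurableEmbedding _)]
  congr 1
  · congr 1; ext x
    simp [MeasurableEquiv.finTwoArrow, Fin.forall_fin_two]
  · ext x; congr 1; ext i; fin_cases i <;> simp [MeasurableEquiv.finTwoArrow]

def perd (a b : ℝ) (g : R2 → ℂ) (x : TT) : ℂ :=
  g ((AddCircle.equivIoc 1 a (x 0) : ℝ), (AddCircle.equivIoc 1 b (x 1) : ℝ))

lemma perd_meas (a b : ℝ) (g : R2 → ℂ) (hg : Measurable g) : Measurable (perd a b g) := by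
  unfold perd
  refine hg.comp (Measurable.prodMk ?_ ?_)
  · exact measurable_subtype_coe.comp ((AddCircle.measurableEquivIoc 1 a).measurable.comp (measurable_pi_apply 0))
  · exact measurable_subtype_coe.comp ((AddCircle.measurableEquivIoc 1 b).measurable.comp (measurable_pi_apply 1))

lemma perd_coe (a b : ℝ) (g : R2 → ℂ) (z : R2) (hz : z ∈ (Ioc a (a + 1) ×ˢ Ioc b (b + 1) : Set (R2))) :
    perd a b g ![(z.1 : UnitAddCircle), (z.2 : UnitAddCircle)] = g z := by
  have h1 : ((AddCircle.equivIoc 1 a (z.1 : UnitAddCircle) : Ioc a (a+1)) : ℝ) = z.1 := by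
    have : (AddCircle.equivIoc 1 a (z.1 : UnitAddCircle)) = ⟨z.1, hz.1⟩ := by
      rw [← Equiv.eq_symm_apply]; rfl
    rw [this]
  have h2 : ((AddCircle.equivIoc 1 b (z.2 : UnitAddCircle) : Ioc b (b+1)) : ℝ) = z.2 := by
    have : (AddCircle.equivIoc 1 b (z.2 : UnitAddCircle)) = ⟨z.2, hz.2⟩ := by
      rw [← Equiv.eq_symm_apply]; rfl
    rw [this]
  simp [perd, h1, h2]

lemma perd_lint (a b p : ℝ) (hp : 0 < p) (g : R2 → ℂ) (hs : ∀ z ∉ (Ioc a (a + 1) ×ˢ Ioc b (b + 1) : Set (R2)), g z = 0) :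
    ∫⁻ x, ‖perd a b g x‖ₑ ^ p ∂muT = ∫⁻ z, ‖g z‖ₑ ^ p := by
  rw [torus_lint2 _ a b, setLIntegral_congr_fun (g := fun z => ‖g z‖ₑ ^ p) (measurableSet_Ioc.prod measurableSet_Ioc)
    (fun z hz => by simp only [perd_coe a b g z hz])]
  rw [setLIntegral_eq_of_support_subset]
  intro z hz
  by_contra h
  simp [hs z h, hp] at hz

lemma perd_int (a b : ℝ) (g : R2 → ℂ) (hs : ∀ z ∉ (Ioc a (a + 1) ×ˢ Ioc b (b + 1) : Set (R2)), g z = 0) (n : Fin 2 → ℤ) :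
    ∫ x, perd a b g x * UnitAddTorus.mFourier n x ∂muT = ∫ z, g z * cE (2 * π * cI * (n 0 * z.1 + n 1 * z.2)) := by
  rw [torus_int2 _ a b, setIntegral_congr_fun (g := fun z => g z * cE (2 * π * cI * (n 0 * z.1 + n 1 * z.2))) (measurableSet_Ioc.prod measurableSet_Ioc)
    (fun z hz => by simp only [perd_coe a b g z hz, mFourier_coe])]
  rw [setIntegral_eq_integral_of_forall_compl_eq_zero]
  intro z hz
  rw [hs z hz, zero_mul]

def dS (h : R2 → ℂ) (z : R2) : ℂ := fderiv ℝ h z (1, 0)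
def dT (h : R2 → ℂ) (z : R2) : ℂ := fderiv ℝ h z (0, 1)
def Dd (h : R2 → ℂ) (z : R2) : ℂ := dS h z - cI * dT h z
def Db (h : R2 → ℂ) (z : R2) : ℂ := dS h z + cI * dT h z

lemma ibp_exp (h : R2 → ℂ) (hh : ContDiff ℝ 1 h) (hc : HasCompactSupport h) (α β : ℂ) (v : R2) :
    ∫ z : R2, fderiv ℝ h z v * cE (α * z.1 + β * z.2) =
      -(α * v.1 + β * v.2) * ∫ z : R2, h z * cE (α * z.1 + β * z.2) := by
  let E : R2 → ℂ := fun z => cE (α * z.1 + β * z.2)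
  have hE' : ∀ z, HasFDerivAt E ((cE (α * z.1 + β * z.2)) • (α • (Complex.ofRealCLM.comp (ContinuousLinearMap.fst ℝ ℝ ℝ)) + β • (Complex.ofRealCLM.comp (ContinuousLinearMap.snd ℝ ℝ ℝ)))) z := by
    intro z
    refine HasFDerivAt.cexp ?_
    exact ((Complex.ofRealCLM.comp (ContinuousLinearMap.fst ℝ ℝ ℝ)).hasFDerivAt.const_mul α).add
      ((Complex.ofRealCLM.comp (ContinuousLinearMap.snd ℝ ℝ ℝ)).hasFDerivAt.const_mul β)
  have hEc : Continuous E := by fun_prop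
  have hfd : ∀ z, fderiv ℝ E z v = (α * v.1 + β * v.2) * E z := by
    intro z; rw [(hE' z).fderiv]; simp [E]; ring
  have c1 : Continuous (fun z => fderiv ℝ h z v) := (hh.continuous_fderiv bn).clm_apply continuous_const
  have s1 : HasCompactSupport (fun z => fderiv ℝ h z v) := hc.fderiv_apply (𝕜 := ℝ) v
  have key := integral_mul_fderiv_eq_neg_fderiv_mul_of_integrable (μ := (volume : Measure (R2))) (f := E) (g := h) (v := v)
    (by simp only [hfd]
        refine Continuous.integrable_of_hasCompactSupport ?_ hc.mul_left
        exact (hEc.const_mul _).mul hh.continuous)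
    ((hEc.mul c1).integrable_of_hasCompactSupport s1.mul_left)
    ((hEc.mul hh.continuous).integrable_of_hasCompactSupport hc.mul_left)
    (fun z _ => (hE' z).differentiableAt) (fun z _ => hh.differentiable bn z)
  simp only [hfd] at key
  rw [neg_mul, ← integral_const_mul]
  simp only [mul_comm (fderiv ℝ h _ v)]
  rw [key]; congr 2; ext z; simp only [E]; ring

lemma Mm_eq (n : Fin 2 → ℤ) : starRingEnd ℂ (npl n) = Mm n * npl n := by
  by_cases h : npl n = 0
  · simp [h]
  have h2 : (‖npl n‖ : ℂ) ≠ 0 := by simpa using h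
  unfold Mm Rm
  have := Complex.mul_conj (npl n)
  rw [Complex.normSq_eq_norm_sq] at this
  push_cast at this
  field_simp
  linear_combination (-(starRingEnd ℂ) (npl n)) * this

lemma fourier_D (h : R2 → ℂ) (hh : ContDiff ℝ 1 h) (hc : HasCompactSupport h) (n : Fin 2 → ℤ) :
    ∫ z : R2, Dd h z * cE (2 * π * cI * (n 0 * z.1 + n 1 * z.2)) =
     Mm n * ∫ z : R2, Db h z * cE (2 * π * cI * (n 0 * z.1 + n 1 * z.2)) := by
  have i1 := ibp_exp h hh hc (2 * π * cI * n 0) (2 * π * cI * n 1) (1, 0)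
  have i2 := ibp_exp h hh hc (2 * π * cI * n 0) (2 * π * cI * n 1) (0, 1)
  have he : ∀ z : R2, (2 * π * cI * (n 0 * z.1 + n 1 * z.2) : ℂ) = 2 * π * cI * n 0 * z.1 + 2 * π * cI * n 1 * z.2 := by
    intro z; ring
  simp only [he]
  have int : ∀ v : R2, Integrable (fun z : R2 => fderiv ℝ h z v * cE (2 * π * cI * n 0 * z.1 + 2 * π * cI * n 1 * z.2)) := by
    intro v
    have c1 : Continuous (fun z => fderiv ℝ h z v) := (hh.continuous_fderiv bn).clm_apply continuous_const
    have s1 : HasCompactSupport (fun z => fderiv ℝ h z v) := hc.fderiv_apply (𝕜 := ℝ) v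
    exact (c1.mul (by fun_prop)).integrable_of_hasCompactSupport s1.mul_right
  simp only [Dd, Db, dS, dT, sub_mul, add_mul, mul_assoc cI (fderiv ℝ h _ _)]
  rw [integral_sub (int _) ((int _).const_mul _), integral_add (int _) ((int _).const_mul _), integral_const_mul, i1, i2]
  have hM := Mm_eq n
  have hcj : starRingEnd ℂ (npl n) = n 0 - n 1 * cI := by simp [npl]; ring
  rw [hcj] at hM
  unfold npl at hM
  simp only [Complex.ofReal_one, Complex.ofReal_zero, mul_one, mul_zero, add_zero, zero_add]
  linear_combination (-(2 * π * cI) * ∫ z : R2, h z * cE (2 * π * cI * n 0 * z.1 + 2 * π * cI * n 1 * z.2)) * hM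

theorem beurling (p : ℝ) (hp : 1 < p) : ∃ C : ℝ≥0∞, C ≠ ⊤ ∧ ∀ (a b : ℝ) (h : R2 → ℂ), ContDiff ℝ 1 h →
    HasCompactSupport h → (tsupport h ⊆ Ioc a (a + 1) ×ˢ Ioc b (b + 1)) →
    ∫⁻ z, ‖Dd h z‖ₑ ^ p ≤ C * ∫⁻ z, ‖Db h z‖ₑ ^ p := by
  have hpq := Real.HolderConjugate.conjExponent hp
  set q := Real.conjExponent p
  obtain ⟨C, hC, hM⟩ := tp_M_all q hpq.symm.lt
  refine ⟨C ^ p, ENNReal.rpow_ne_top_of_nonneg bl hC, fun a b h hh hc hs => ?_⟩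
  have hsv : ∀ v : R2, ∀ z ∉ (Ioc a (a + 1) ×ˢ Ioc b (b + 1) : Set (R2)), fderiv ℝ h z v = 0 := by
    intro v z hz
    have : z ∉ tsupport h := fun h' => hz (hs h')
    have : fderiv ℝ h z = 0 := by
      have h2 := support_fderiv_subset ℝ (f := h)
      by_contra h3
      exact this (h2 h3)
    simp [this]
  have c1 : ∀ v, Continuous (fun z => fderiv ℝ h z v) := fun v => (hh.continuous_fderiv bn).clm_apply continuous_const
  have s1 : ∀ v, HasCompactSupport (fun z => fderiv ℝ h z v) := fun v => hc.fderiv_apply (𝕜 := ℝ) v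
  have cD : Continuous (Dd h) := by unfold Dd dS dT; exact (c1 _).sub ((c1 _).const_mul _)
  have cB : Continuous (Db h) := by unfold Db dS dT; exact (c1 _).add ((c1 _).const_mul _)
  have sD : HasCompactSupport (Dd h) := (s1 _).sub (s1 _).mul_left
  have sB : HasCompactSupport (Db h) := (s1 _).add (s1 _).mul_left
  have zD : ∀ z ∉ (Ioc a (a + 1) ×ˢ Ioc b (b + 1) : Set (R2)), Dd h z = 0 := fun z hz => by
    simp [Dd, dS, dT, hsv _ z hz]
  have zB : ∀ z ∉ (Ioc a (a + 1) ×ˢ Ioc b (b + 1) : Set (R2)), Db h z = 0 := fun z hz => by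
    simp [Db, dS, dT, hsv _ z hz]
  obtain ⟨BD, hBD⟩ := sD.exists_bound_of_continuous cD
  obtain ⟨BB, hBB⟩ := sB.exists_bound_of_continuous cB
  have mD := perd_meas a b _ cD.measurable
  have mB := perd_meas a b _ cB.measurable
  have key := dual_lp p q hpq (perd a b (Dd h)) mD BD (fun x => hBD _)
    (C * (∫⁻ x, ‖perd a b (Db h) x‖ₑ ^ p ∂muT) ^ (1 / p)) ?_ ?_
  · have k2 := ENNReal.rpow_le_rpow key (show 0 ≤ p by linarith)
    rwa [ENNReal.mul_rpow_of_nonneg _ _ bl, ← ENNReal.rpow_mul, ← ENNReal.rpow_mul, one_div_mul_cancel bl,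
      ENNReal.rpow_one, ENNReal.rpow_one, perd_lint a b p bl _ zD, perd_lint a b p bl _ zB] at k2
  · refine ENNReal.mul_ne_top hC (ENNReal.rpow_ne_top_of_nonneg bp
      (ne_top_of_le_ne_top (b := ∫⁻ x, oR BB ^ p ∂muT) ?_ ?_))
    · rw [lintegral_const, measure_univ, mul_one]; exact ENNReal.rpow_ne_top_of_nonneg bl ENNReal.ofReal_ne_top
    · refine lintegral_mono fun x => ?_
      refine ENNReal.rpow_le_rpow ?_ bl
      rw [← ofReal_norm]; exact ENNReal.ofReal_le_ofReal (hBB _)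
  · intro S c
    have e : ∫ x, perd a b (Dd h) x * tp S c x ∂muT = ∫ x, perd a b (Db h) x * tp S (fun n => Mm n * c n) x ∂muT := by
      rw [int_tp_mul S c _ mD BD (fun x => hBD _), int_tp_mul S _ _ mB BB (fun x => hBB _)]
      refine Finset.sum_congr rfl fun n _ => ?_
      rw [perd_int a b _ zD, perd_int a b _ zB, fourier_D h hh hc]; ring
    rw [e]
    refine (enorm_int_mul_le p q hpq _ _ mB (tp_cont _ _).measurable).trans ?_
    calc _ ≤ (∫⁻ x, ‖perd a b (Db h) x‖ₑ ^ p ∂muT) ^ (1 / p) * (C * (∫⁻ x, ‖tp S c x‖ₑ ^ q ∂muT) ^ (1 / q)) := by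
          gcongr; exact hM S c
      _ = _ := by ring

def cx (z : R2) : ℂ := (z.1 : ℂ) + (z.2 : ℂ) * cI

lemma fd_lin (h : R2 → ℂ) (z : R2) (a b : ℝ) : fderiv ℝ h z (a, b) = a * dS h z + b * dT h z := by
  have : ((a, b) : R2) = a • (1, 0) + b • (0, 1) := by simp
  rw [this, map_add, map_smul, map_smul]; simp [dS, dT]

lemma polar_int {G : R2 → ℂ} (hG : Continuous G) (R : ℝ) (hR : ∀ z : R2, R < z.1 → G z = 0) :
    IntegrableOn G (Ioi (0:ℝ) ×ˢ Ioo (-π) π) := by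
  have h1 : IntegrableOn G (Icc (0:ℝ) R ×ˢ Icc (-π) π) :=
    hG.continuousOn.integrableOn_compact (isCompact_Icc.prod isCompact_Icc)
  refine IntegrableOn.of_forall_sdiff_eq_zero h1 (measurableSet_Ioi.prod measurableSet_Ioo) ?_
  rintro ⟨r, a⟩ ⟨⟨h2, h3⟩, h4⟩
  apply hR
  by_contra hc
  exact h4 ⟨⟨le_of_lt h2, not_lt.1 hc⟩, ⟨h3.1.le, h3.2.le⟩⟩

lemma cauchy_polar (φ : R2 → ℂ) (hφ : ContDiff ℝ 1 φ) (hc : HasCompactSupport φ) :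
    ∫ z, Db φ z / cx z = -(2 * π) * φ 0 := by
  obtain ⟨R, hR0, hR⟩ : ∃ R : ℝ, 0 < R ∧ ∀ r a : ℝ, R < r → φ =ᶠ[nhds (r * cos a, r * sin a)] 0 := by
    obtain ⟨R, hR⟩ := hc.isBounded.subset_ball (0 : R2)
    refine ⟨max 1 (2 * R), by positivity, fun r a hr => ?_⟩
    have : (r * cos a, r * sin a) ∉ tsupport φ := by
      intro h
      have h1 := hR h
      rw [mem_ball_zero_iff, Prod.norm_def, max_lt_iff] at h1
      simp only [Real.norm_eq_abs] at h1
      have h2 : |r * cos a| ^ 2 + |r * sin a| ^ 2 = r ^ 2 := by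
        rw [sq_abs, sq_abs]; nlinarith [cos_sq_add_sin_sq a]
      have hr1 : 1 < r := lt_of_le_of_lt (le_max_left _ _) hr
      have hr2 : 2 * R < r := lt_of_le_of_lt (le_max_right _ _) hr
      nlinarith [abs_nonneg (r * cos a), abs_nonneg (r * sin a)]
    exact notMem_tsupport_iff_eventuallyEq.1 this
  have hfd : Continuous (fderiv ℝ φ) := hφ.continuous_fderiv bn
  have hz : ∀ r a : ℝ, R < r → fderiv ℝ φ (r * cos a, r * sin a) = 0 := fun r a h => by
    rw [(hR r a h).fderiv_eq]; simp
  rw [← integral_comp_polarCoord_symm]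
  let G : R2 → ℂ := fun x => fderiv ℝ φ (x.1 * cos x.2, x.1 * sin x.2) (cos x.2, sin x.2)
  let H : R2 → ℂ := fun x => cI * fderiv ℝ φ (x.1 * cos x.2, x.1 * sin x.2) (-sin x.2, cos x.2)
  have hGc : Continuous G := by
    apply Continuous.clm_apply
    · exact hfd.comp (by fun_prop)
    · fun_prop
  have hHc : Continuous H := by
    apply continuous_const.mul
    apply Continuous.clm_apply
    · exact hfd.comp (by fun_prop)
    · fun_prop
  have hGi := polar_int hGc R (fun z h => by simp [G, hz _ _ h])
  have hHi := polar_int hHc R (fun z h => by simp [H, hz _ _ h])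
  have e1 : ∫ p in polarCoord.target, p.1 • (Db φ (polarCoord.symm p) / cx (polarCoord.symm p))
      = ∫ p in Ioi (0:ℝ) ×ˢ Ioo (-π) π, (G p + H p) := by
    refine setIntegral_congr_fun (measurableSet_Ioi.prod measurableSet_Ioo) ?_
    rintro ⟨r, a⟩ ⟨hr, -⟩
    have hr' : (r : ℂ) ≠ 0 := by exact_mod_cast (ne_of_gt hr : r ≠ 0)
    simp only [G, H, polarCoord_symm_apply, fd_lin, cx, Db]
    have hcs : ((cos a : ℝ) : ℂ) ^ 2 + ((sin a : ℝ) : ℂ) ^ 2 = 1 := by exact_mod_cast cos_sq_add_sin_sq a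
    have hne : ((cos a : ℝ) : ℂ) + ((sin a : ℝ) : ℂ) * cI ≠ 0 := by
      intro h
      have : (((cos a : ℝ) : ℂ) + ((sin a : ℝ) : ℂ) * cI) * (((cos a : ℝ) : ℂ) - ((sin a : ℝ) : ℂ) * cI) = 1 := by
        linear_combination hcs - ((sin a : ℝ) : ℂ) ^ 2 * Complex.I_sq
      rw [h, zero_mul] at this; exact zero_ne_one this
    have e : ((r * cos a : ℝ) : ℂ) + ((r * sin a : ℝ) : ℂ) * cI = r * (((cos a : ℝ) : ℂ) + ((sin a : ℝ) : ℂ) * cI) := by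
      push_cast; ring
    rw [e, Complex.real_smul]
    set A := dS φ (r * cos a, r * sin a)
    set B := dT φ (r * cos a, r * sin a)
    set c := ((cos a : ℝ) : ℂ)
    set s := ((sin a : ℝ) : ℂ)
    rw [mul_div_assoc', mul_div_mul_left _ _ hr', div_eq_iff hne]
    have hI := Complex.I_sq
    rw [Complex.ofReal_neg]
    linear_combination (-A - B * cI) * hcs + (s ^ 2 * A - s * c * B) * hI
  rw [e1, integral_add hGi hHi]
  have e2 : ∫ p in Ioi (0:ℝ) ×ˢ Ioo (-π) π, G p = -(2 * π) * φ 0 := by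
    rw [Measure.volume_eq_prod, ← Measure.prod_restrict, integral_prod_symm]
    · have : ∀ a : ℝ, ∫ r in Ioi (0:ℝ), G (r, a) = - φ 0 := by
        intro a
        have hd : ∀ r : ℝ, HasDerivAt (fun r : ℝ => φ (r * cos a, r * sin a)) (G (r, a)) r := by
          intro r
          have h1 : HasDerivAt (fun r : ℝ => ((r * cos a, r * sin a) : R2)) (cos a, sin a) r := by
            refine HasDerivAt.prodMk ?_ ?_
            · simpa using (hasDerivAt_id r).mul_const (cos a)
            · simpa using (hasDerivAt_id r).mul_const (sin a)
          exact ((hφ.differentiable bn) _).hasFDerivAt.comp_hasDerivAt r h1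
        have hi : IntegrableOn (fun r => G (r, a)) (Ioi 0) := by
          have h1 : IntegrableOn (fun r => G (r, a)) (Icc (0:ℝ) R) :=
            (by fun_prop : Continuous fun r => G (r, a)).continuousOn.integrableOn_compact isCompact_Icc
          refine IntegrableOn.of_forall_sdiff_eq_zero h1 measurableSet_Ioi ?_
          rintro r ⟨h2, h3⟩
          have : R < r := by
            by_contra hc; exact h3 ⟨le_of_lt h2, not_lt.1 hc⟩
          simp [G, hz _ _ this]
        have := integral_Ioi_of_hasDerivAt_of_tendsto (m := 0) (hd 0).continuousAt.continuousWithinAt (fun r _ => hd r) hi ?_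
        · rw [this]; simp [Prod.zero_eq_mk]
        · refine tendsto_const_nhds.congr' ?_
          filter_upwards [Filter.eventually_gt_atTop R] with r hr
          simpa using (hR r a hr).eq_of_nhds.symm
      simp_rw [this]
      rw [setIntegral_const, Measure.real, Real.volume_Ioo, ENNReal.toReal_ofReal (by linarith [pi_pos]), Complex.real_smul]
      push_cast; ring
    · rwa [Measure.prod_restrict, ← Measure.volume_eq_prod]
  have e3 : ∫ p in Ioi (0:ℝ) ×ˢ Ioo (-π) π, H p = 0 := by
    rw [Measure.volume_eq_prod, ← Measure.prod_restrict, integral_prod]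
    · rw [← integral_zero ℝ ℂ (μ := volume.restrict (Ioi (0:ℝ)))]
      refine setIntegral_congr_fun measurableSet_Ioi ?_
      intro r hr
      have hr' : (r : ℂ) ≠ 0 := by exact_mod_cast (ne_of_gt hr : r ≠ 0)
      have hd : ∀ a : ℝ, HasDerivAt (fun a : ℝ => cI / r * φ (r * cos a, r * sin a)) (H (r, a)) a := by
        intro a
        have h1 : HasDerivAt (fun a : ℝ => ((r * cos a, r * sin a) : R2)) (r * -sin a, r * cos a) a :=
          ((hasDerivAt_cos a).const_mul r).prodMk ((hasDerivAt_sin a).const_mul r)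
        refine ((((hφ.differentiable bn) _).hasFDerivAt.comp_hasDerivAt a h1).const_mul (cI / r)).congr_deriv ?_
        simp only [H, fd_lin]
        push_cast; field_simp
      have h2 := intervalIntegral.integral_eq_sub_of_hasDerivAt (a := -π) (b := π) (fun a _ => hd a)
        ((by fun_prop : Continuous fun a => H (r, a)).intervalIntegrable _ _)
      show ∫ a in Ioo (-π) π, H (r, a) = 0
      rw [← integral_Ioc_eq_integral_Ioo, ← intervalIntegral.integral_of_le (by linarith [pi_pos]), h2]
      simp
    · rwa [Measure.prod_restrict, ← Measure.volume_eq_prod]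
  rw [e2, e3, add_zero]

lemma lint_rpow_Ioc {c R : ℝ} (hc : -1 < c) (hR : 0 ≤ R) :
    ∫⁻ t in Ioc 0 R, oR (t ^ c) = oR (R ^ (c + 1) / (c + 1)) := by
  rw [← ofReal_integral_eq_lintegral_ofReal]
  · rw [← intervalIntegral.integral_of_le hR, integral_rpow (Or.inl hc), zero_rpow bl, sub_zero]
  · exact (intervalIntegral.intervalIntegrable_rpow' hc (a := 0) (b := R)).1
  · filter_upwards [ae_restrict_mem measurableSet_Ioc] with t ht
    exact rpow_nonneg ht.1.le _

lemma lint_rpow_Ioi {c R : ℝ} (hc : c < -1) (hR : 0 < R) :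
    ∫⁻ t in Ioi R, oR (t ^ c) = oR (-R ^ (c + 1) / (c + 1)) := by
  rw [← ofReal_integral_eq_lintegral_ofReal]
  · rw [integral_Ioi_rpow_of_lt hc hR]
  · exact integrableOn_Ioi_rpow_of_lt hc hR
  · filter_upwards [ae_restrict_mem measurableSet_Ioi] with t ht
    exact rpow_nonneg (hR.le.trans (le_of_lt ht)) _

lemma lint_even {f : ℝ → ℝ≥0∞} (hf : ∀ x, f (-x) = f x) : ∫⁻ x, f x = 2 * ∫⁻ x in Ioi 0, f x := by
  have h1 : ∫⁻ x in Iio 0, f x = ∫⁻ x in Ioi 0, f x := by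
    rw [← lintegral_indicator measurableSet_Iio, ← lintegral_indicator measurableSet_Ioi, ← lintegral_neg_eq_self]
    refine lintegral_congr fun x => ?_
    simp only [indicator, mem_Iio, mem_Ioi, hf, Left.neg_neg_iff]
  rw [← lintegral_add_compl f (measurableSet_Iio : MeasurableSet (Iio (0:ℝ))), h1, compl_Iio, setLIntegral_congr Ioi_ae_eq_Ici.symm, two_mul]

lemma near_lint0 (R : ℝ) (hR : 0 ≤ R) :
    ∫⁻ z in cBall (0 : R2) R, oR (‖z‖⁻¹) ≤ oR (16 * R) := by
  have h1 : ∀ z : R2, oR (‖z‖⁻¹) ≤ (oR |z.1|) ^ (-(1/2) : ℝ) * (oR |z.2|) ^ (-(1/2) : ℝ) := by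
    intro z
    have hz1 : |z.1| ≤ ‖z‖ := norm_fst_le z
    have hz2 : |z.2| ≤ ‖z‖ := norm_snd_le z
    rcases eq_or_lt_of_le (norm_nonneg z) with h | h
    · rw [← h]; simp
    calc oR (‖z‖⁻¹) = (oR ‖z‖) ^ (-(1/2) : ℝ) * (oR ‖z‖) ^ (-(1/2) : ℝ) := by
          rw [← ENNReal.rpow_add _ _ (by simpa using h) (by simp), ENNReal.ofReal_inv_of_pos h]
          norm_num [ENNReal.rpow_neg_one]
      _ ≤ _ := by
          gcongr ?_ * ?_
          · rw [ENNReal.rpow_neg, ENNReal.rpow_neg]; exact ENNReal.inv_le_inv.2 (ENNReal.rpow_le_rpow (ENNReal.ofReal_le_ofReal hz1) bn)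
          · rw [ENNReal.rpow_neg, ENNReal.rpow_neg]; exact ENNReal.inv_le_inv.2 (ENNReal.rpow_le_rpow (ENNReal.ofReal_le_ofReal hz2) bn)
  have h2 : ∫⁻ a in Icc (-R) R, (oR |a|) ^ (-(1/2) : ℝ) = oR (4 * R ^ (1/2 : ℝ)) := by
    rw [← lintegral_indicator measurableSet_Icc, lint_even, ← lintegral_indicator measurableSet_Ioi]
    · have : ∫⁻ a, (Ioi (0:ℝ)).indicator (fun a => (Icc (-R) R).indicator (fun a => (oR |a|) ^ (-(1/2) : ℝ)) a) a
          = ∫⁻ t in Ioc 0 R, oR (t ^ (-(1/2) : ℝ)) := by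
        rw [← lintegral_indicator measurableSet_Ioc]
        refine lintegral_congr fun x => ?_
        by_cases hx : 0 < x
        · by_cases hx2 : x ≤ R
          · rw [indicator_of_mem (show x ∈ Ioi 0 from hx), indicator_of_mem (show x ∈ Icc (-R) R from ⟨by linarith, hx2⟩),
              indicator_of_mem (show x ∈ Ioc 0 R from ⟨hx, hx2⟩), abs_of_pos hx, ENNReal.ofReal_rpow_of_pos hx]
          · rw [indicator_of_mem (show x ∈ Ioi 0 from hx), indicator_of_notMem (fun h => hx2 h.2), indicator_of_notMem (fun h => hx2 h.2)]
        · rw [indicator_of_notMem (show x ∉ Ioi 0 from hx), indicator_of_notMem (fun h => hx h.1)]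
      rw [this, lint_rpow_Ioc bn hR, show (2 : ℝ≥0∞) = oR 2 by simp, ← ENNReal.ofReal_mul bn]
      congr 1; norm_num; ring
    · intro x
      simp only [indicator, mem_Icc, abs_neg]
      congr 1
      simp only [eq_iff_iff]; constructor <;> rintro ⟨h, h'⟩ <;> constructor <;> linarith
  calc _ ≤ ∫⁻ z in cBall (0 : R2) R, (oR |z.1|) ^ (-(1/2) : ℝ) * (oR |z.2|) ^ (-(1/2) : ℝ) := by
        exact lintegral_mono h1
    _ = oR (4 * R ^ (1/2 : ℝ)) * oR (4 * R ^ (1/2 : ℝ)) := by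
        rw [show (0 : R2) = (0, 0) from rfl, ← closedBall_prod_same, Real.closedBall_eq_Icc, zero_sub, zero_add,
          Measure.volume_eq_prod, ← Measure.prod_restrict,
          lintegral_prod_mul (f := fun a : ℝ => (oR |a|) ^ (-(1/2) : ℝ)) (g := fun a : ℝ => (oR |a|) ^ (-(1/2) : ℝ))
          (by fun_prop) (by fun_prop), h2]
    _ ≤ _ := by
        rw [← ENNReal.ofReal_mul bp]
        apply le_of_eq; congr 1
        have : R ^ (1/2 : ℝ) * R ^ (1/2 : ℝ) = R := by rw [← Real.sqrt_eq_rpow, mul_self_sqrt hR]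
        linear_combination 16 * this

lemma near_lint (w : R2) (R : ℝ) (hR : 0 ≤ R) :
    ∫⁻ z in cBall w R, oR (‖w - z‖⁻¹) ≤ oR (16 * R) := by
  refine le_trans (le_of_eq ?_) (near_lint0 R hR)
  rw [← lintegral_indicator Metric.isClosed_closedBall.measurableSet, ← lintegral_indicator Metric.isClosed_closedBall.measurableSet,
    ← lintegral_sub_left_eq_self _ w]
  refine lintegral_congr fun z => ?_
  simp only [indicator, Metric.mem_closedBall, dist_zero_right, sub_sub_cancel, sub_zero]
  congr 1
  simp [dist_eq_norm]

def St : Set (R2) := univ ×ˢ Ioo 0 π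

lemma St_meas : MeasurableSet St := MeasurableSet.univ.prod measurableSet_Ioo
lemma St_open : IsOpen St := isOpen_univ.prod isOpen_Ioo

lemma div_strip (H : R2 → ℂ) (M : ℝ) (hM : 0 < M) (hH : ∀ z : R2, 0 ≤ z.2 → z.2 ≤ π → ContDiffAt ℝ 1 H z)
    (h0 : ∀ z : R2, M < |z.1| → H z = 0) (ε : ℂ) :
    IntegrableOn (fun z => dS H z + ε * dT H z) St ∧
    ∫ z in St, (dS H z + ε * dT H z) = ε * ((∫ s in -(M+1)..(M+1), H (s, π)) - ∫ s in -(M+1)..(M+1), H (s, 0)) := by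
  have hπ := pi_pos
  have hz : ∀ z : R2, M < |z.1| → fderiv ℝ H z = 0 := by
    intro z hz
    have : H =ᶠ[nhds z] 0 := by
      filter_upwards [(isOpen_lt continuous_const (continuous_abs.comp continuous_fst) : IsOpen {z : R2 | M < |z.1|}).mem_nhds hz] with y hy
      exact h0 y hy
    rw [this.fderiv_eq]; simp
  have hm : ∀ z : R2, z ∈ Icc ((-(M+1), 0) : R2) (M+1, π) → 0 ≤ z.2 ∧ z.2 ≤ π := fun z h => ⟨h.1.2, h.2.2⟩
  have hcH : ContinuousOn H (Icc ((-(M+1), 0) : R2) (M+1, π)) := fun z hz' =>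
    (hH z (hm z hz').1 (hm z hz').2).continuousAt.continuousWithinAt
  have hcF : ContinuousOn (fun z => dS H z + ε * dT H z) (Icc ((-(M+1), 0) : R2) (M+1, π)) := by
    intro z hz'
    have h1 : ContinuousAt (fderiv ℝ H) z := ((hH z (hm z hz').1 (hm z hz').2).fderiv_right (m := 0) bn).continuousAt
    have h2 : ∀ v, ContinuousAt (fun z => fderiv ℝ H z v) z := fun v => h1.clm_apply continuousAt_const
    exact ((h2 _).add (continuousAt_const.mul (h2 _))).continuousWithinAt
  have hI := hcF.integrableOn_compact (μ := volume) (isCompact_Icc)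
  have hae : (Icc ((-(M+1), 0) : R2) (M+1, π)) =ᵐ[volume] (Icc (-(M+1)) (M+1) ×ˢ Ioo 0 π : Set (R2)) := by
    rw [← Icc_prod_Icc]
    exact Measure.set_prod_ae_eq (Filter.EventuallyEq.refl _ _) Ioo_ae_eq_Icc.symm
  have hsub : (Icc (-(M+1)) (M+1) ×ˢ Ioo 0 π : Set (R2)) ⊆ St := prod_mono_left (subset_univ _)
  have hzero : ∀ z ∈ St \ (Icc (-(M+1)) (M+1) ×ˢ Ioo 0 π : Set (R2)), dS H z + ε * dT H z = 0 := by
    rintro z ⟨⟨-, h2⟩, h3⟩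
    have : M < |z.1| := by
      by_contra hc
      rw [not_lt, abs_le] at hc
      exact h3 ⟨⟨by linarith, by linarith⟩, h2⟩
    simp [dS, dT, hz z this]
  refine ⟨?_, ?_⟩
  · exact IntegrableOn.of_forall_sdiff_eq_zero (hI.congr_set_ae hae.symm) St_meas hzero
  · rw [setIntegral_eq_of_subset_of_forall_sdiff_eq_zero St_meas hsub hzero, ← setIntegral_congr_set hae]
    have hd : ∀ x ∈ Ioo (-(M+1), (0:ℝ)).1 (M+1, π).1 ×ˢ Ioo (-(M+1), (0:ℝ)).2 (M+1, π).2, HasFDerivAt H (fderiv ℝ H x) x := fun x hx =>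
      ((hH x hx.2.1.le hx.2.2.le).differentiableAt bn).hasFDerivAt
    have := integral_divergence_prod_Icc_of_hasFDerivAt_of_le H (fun z => ε * H z) (fderiv ℝ H) (fun z => ε • fderiv ℝ H z) (-(M+1), 0) (M+1, π)
      ⟨by simp; linarith, hπ.le⟩ hcH (continuousOn_const.mul hcH) hd
      (fun x hx => (hd x hx).const_mul ε) hI
    refine Eq.trans this ?_
    have e1 : ∀ y : ℝ, H (M+1, y) = 0 := fun y => h0 _ (by simp only; rw [abs_of_pos bl]; linarith)
    have e2 : ∀ y : ℝ, H (-(M+1), y) = 0 := fun y => h0 _ (by simp only; rw [abs_neg, abs_of_pos bl]; linarith)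
    simp only [e1, e2, intervalIntegral.integral_zero, intervalIntegral.integral_const_mul]
    ring

open scoped ComplexConjugate

def cxL : R2 →L[ℝ] ℂ := Complex.ofRealCLM.comp (ContinuousLinearMap.fst ℝ ℝ ℝ) + (cI) • Complex.ofRealCLM.comp (ContinuousLinearMap.snd ℝ ℝ ℝ)
lemma cxL_eq (z : R2) : cxL z = cx z := by simp [cxL, cx, mul_comm]
lemma cx_hasF (z : R2) : HasFDerivAt cx cxL z := by
  have := cxL.hasFDerivAt (x := z)
  rwa [show (cxL : R2 → ℂ) = cx from funext cxL_eq] at this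
lemma cx_cd {n : WithTop ℕ∞} : ContDiff ℝ n cx := by
  have := cxL.contDiff (n := n)
  rwa [show (cxL : R2 → ℂ) = cx from funext cxL_eq] at this
def ccL : R2 →L[ℝ] ℂ := Complex.conjCLE.toContinuousLinearMap.comp cxL
lemma cc_hasF (z : R2) : HasFDerivAt (fun z => conj (cx z)) ccL z :=
  Complex.conjCLE.toContinuousLinearMap.hasFDerivAt.comp z (cx_hasF z)
lemma cc_cd {n : WithTop ℕ∞} : ContDiff ℝ n (fun z => conj (cx z)) :=
  Complex.conjCLE.toContinuousLinearMap.contDiff.comp cx_cd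

lemma Db_mul_hol {h : ℂ → ℂ} {c : ℂ} {f : R2 → ℂ} {z : R2} (hh : DifferentiableAt ℂ h (c - cx z))
    (hf : DifferentiableAt ℝ f z) : Db (fun z => h (c - cx z) * f z) z = h (c - cx z) * Db f z := by
  have h1 : HasFDerivAt (fun z => h (c - cx z)) _ z := (hh.hasDerivAt.hasFDerivAt.restrictScalars ℝ).comp z ((cx_hasF z).const_sub c)
  have h2 := (h1.mul hf.hasFDerivAt).fderiv
  simp only [Db, dS, dT]
  change fderiv ℝ (fun z => h (c - cx z) * f z) z = _ at h2
  rw [h2]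
  simp [cxL_eq, cx]
  linear_combination -(deriv h (c - (↑z.1 + ↑z.2 * cI)) * f z) * Complex.I_sq

lemma Dd_mul_ahol {h : ℂ → ℂ} {c : ℂ} {f : R2 → ℂ} {z : R2} (hh : DifferentiableAt ℂ h (c - conj (cx z)))
    (hf : DifferentiableAt ℝ f z) : Dd (fun z => h (c - conj (cx z)) * f z) z = h (c - conj (cx z)) * Dd f z := by
  have h1 : HasFDerivAt (fun z => h (c - conj (cx z))) _ z := (hh.hasDerivAt.hasFDerivAt.restrictScalars ℝ).comp z ((cc_hasF z).const_sub c)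
  have h2 := (h1.mul hf.hasFDerivAt).fderiv
  simp only [Dd, dS, dT]
  change fderiv ℝ (fun z => h (c - conj (cx z)) * f z) z = _ at h2
  rw [h2]
  simp [cxL_eq, ccL, cx]
  linear_combination -(deriv h (c - (↑z.1 - ↑z.2 * cI)) * f z) * Complex.I_sq

def kC (k : ℤ) (ζ : ℂ) : ℂ := cE (k * ζ) / (cE ζ - 1)

lemma exp_ne_one {ζ : ℂ} (h : ζ ≠ 0) (h2 : |ζ.im| < 2 * π) : cE ζ - 1 ≠ 0 := by
  rw [sub_ne_zero]
  intro he
  obtain ⟨n, hn⟩ := Complex.exp_eq_one_iff.1 he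
  have hi : ζ.im = n * (2 * π) := by rw [hn]; simp
  have hn0 : n = 0 := by
    by_contra hne
    have h1 : (1:ℝ) ≤ |(n:ℝ)| := by exact_mod_cast Int.one_le_abs hne
    rw [hi, abs_mul, abs_of_pos (by positivity : (0:ℝ) < 2 * π)] at h2
    nlinarith [pi_pos]
  apply h; rw [hn, hn0]; simp

lemma kC_diff {k : ℤ} {ζ : ℂ} (h : cE ζ - 1 ≠ 0) : DifferentiableAt ℂ (kC k) ζ := by
  unfold kC
  exact DifferentiableAt.div (by fun_prop) (by fun_prop) h

lemma kC_cd {k : ℤ} {ζ : ℂ} (h : cE ζ - 1 ≠ 0) : ContDiffAt ℝ 1 (kC k) ζ := by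
  unfold kC
  refine ContDiffAt.restrict_scalars ℝ (𝕜' := ℂ) ?_
  refine ContDiffAt.div (f := fun ζ => cE (k * ζ)) (g := fun ζ => cE ζ - 1) ?_ ?_ h
  · exact (Complex.contDiff_exp.comp (contDiff_const.mul contDiff_id)).contDiffAt
  · exact (Complex.contDiff_exp.sub contDiff_const).contDiffAt

@[simp] lemma cx_re (z : R2) : (cx z).re = z.1 := by simp [cx]
@[simp] lemma cx_im (z : R2) : (cx z).im = z.2 := by simp [cx]
lemma cx_inj {z w : R2} (h : cx z = cx w) : z = w := by
  apply Prod.ext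
  · simpa using congrArg Complex.re h
  · simpa using congrArg Complex.im h

lemma ne1 {w z : R2} (hw : w ∈ St) (hz : 0 ≤ z.2) (hz' : z.2 ≤ π) (hne : z ≠ w) : cE (cx w - cx z) - 1 ≠ 0 := by
  obtain ⟨-, h1, h2⟩ := hw
  refine exp_ne_one ?_ ?_
  · rw [sub_ne_zero]; exact fun h => hne (cx_inj h.symm)
  · simp only [Complex.sub_im, cx_im, abs_lt]; constructor <;> linarith [pi_pos]

lemma ne2 {w z : R2} (hw : w ∈ St) (hz : 0 ≤ z.2) (hz' : z.2 ≤ π) : cE (cx w - conj (cx z)) - 1 ≠ 0 := by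
  obtain ⟨-, h1, h2⟩ := hw
  refine exp_ne_one ?_ ?_
  · intro h
    have := congrArg Complex.im h
    simp at this; linarith
  · simp only [Complex.sub_im, Complex.conj_im, cx_im, abs_lt]; constructor <;> linarith [pi_pos]

lemma cauchy2 (k : ℤ) (f : R2 → ℂ) (hf : ContDiff ℝ 1 f) (M : ℝ) (hM : 0 < M)
    (h0 : ∀ z : R2, M < |z.1| → f z = 0) (w : R2) (hw : w ∈ St) :
    IntegrableOn (fun z => kC k (cx w - conj (cx z)) * Dd f z) St ∧
    ∫ z in St, kC k (cx w - conj (cx z)) * Dd f z = -cI * ((∫ s in -(M+1)..(M+1), kC k (cx w - conj (cx (s, π))) * f (s, π))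
      - ∫ s in -(M+1)..(M+1), kC k (cx w - conj (cx (s, 0))) * f (s, 0)) := by
  have h := div_strip (fun z => kC k (cx w - conj (cx z)) * f z) M hM ?_ ?_ (-cI)
  · have hc : EqOn (fun z => dS (fun z => kC k (cx w - conj (cx z)) * f z) z + -cI * dT (fun z => kC k (cx w - conj (cx z)) * f z) z)
        (fun z => kC k (cx w - conj (cx z)) * Dd f z) St := by
      rintro z ⟨-, hz⟩
      simp only
      rw [← Dd_mul_ahol (kC_diff (ne2 hw hz.1.le hz.2.le)) (hf.differentiable bn z), Dd]
      ring
    rw [setIntegral_congr_fun St_meas hc] at h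
    exact ⟨(integrableOn_congr_fun hc St_meas).1 h.1, h.2⟩
  · intro z hz hz'
    exact ((kC_cd (ne2 hw hz hz')).comp z (contDiff_const.sub cc_cd).contDiffAt).mul hf.contDiffAt
  · intro z hz; simp [h0 z hz]

lemma cauchy_shift (φ : R2 → ℂ) (hφ : ContDiff ℝ 1 φ) (hc : HasCompactSupport φ) (w : R2) :
    ∫ z, Db φ z / (cx w - cx z) = 2 * π * φ w := by
  have h := cauchy_polar (fun z => φ (z + w)) (hφ.comp (contDiff_id.add contDiff_const)) (hc.comp_homeomorph (Homeomorph.addRight w))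
  have e : ∀ z, Db (fun z => φ (z + w)) z / cx z = (fun z => -(Db φ z / (cx w - cx z))) (z + w) := by
    intro z
    simp only [Db, dS, dT, fderiv_comp_add_right]
    rw [← div_neg]; congr 1; simp [cx]; ring
  simp_rw [e] at h
  rw [integral_add_right_eq_self (fun z => -(Db φ z / (cx w - cx z))), integral_neg, zero_add] at h
  linear_combination -h

def eC (k : ℤ) (ζ : ℂ) : ℂ := cE (k * ζ) / dslope cE 0 ζ

lemma dslope_exp_ne {ζ : ℂ} (h2 : |ζ.im| < 2 * π) : dslope cE 0 ζ ≠ 0 := by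
  by_cases h : ζ = 0
  · rw [h, dslope_same]; simp
  · rw [dslope_of_ne _ h, slope]
    have := exp_ne_one h h2
    simp [h, this]

lemma kC_eC {k : ℤ} (ζ : ℂ) : kC k ζ = eC k ζ / ζ := by
  by_cases h : ζ = 0
  · simp [h, kC]
  · rw [kC, eC, dslope_of_ne _ h, slope]
    simp only [sub_zero, Complex.exp_zero, vsub_eq_sub, smul_eq_mul]
    field_simp

lemma eC_diff {k : ℤ} {ζ : ℂ} (h : |ζ.im| < 2 * π) : DifferentiableAt ℂ (eC k) ζ := by
  unfold eC
  refine DifferentiableAt.div (by fun_prop) ?_ (dslope_exp_ne h)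
  have := (Complex.differentiableOn_dslope (s := univ) (c := 0) (f := cE) Filter.univ_mem).2 Complex.differentiable_exp.differentiableOn
  exact (this ζ (mem_univ _)).differentiableAt Filter.univ_mem

lemma eC_cd {k : ℤ} {ζ : ℂ} (h : |ζ.im| < 2 * π) : ContDiffAt ℝ 1 (eC k) ζ := by
  have ho : IsOpen {ζ : ℂ | |ζ.im| < 2 * π} := isOpen_lt (continuous_abs.comp Complex.continuous_im) continuous_const
  have h1 : DifferentiableOn ℂ (eC k) {ζ : ℂ | |ζ.im| < 2 * π} := fun ζ hζ => (eC_diff hζ).differentiableWithinAt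
  exact ((h1.contDiffOn (n := 1) ho).contDiffAt (ho.mem_nhds h)).restrict_scalars ℝ

lemma norm_le_cx (z w : R2) : ‖w - z‖ ≤ ‖cx w - cx z‖ := by
  rw [Prod.norm_def]
  refine max_le ?_ ?_
  · simpa using Complex.abs_re_le_norm (cx w - cx z)
  · simpa using Complex.abs_im_le_norm (cx w - cx z)

lemma Db_cont {f : R2 → ℂ} (hf : ContDiff ℝ 1 f) : Continuous (Db f) := by
  have := hf.continuous_fderiv bn
  unfold Db dS dT; fun_prop

lemma Db_add {f g : R2 → ℂ} {z : R2} (hf : DifferentiableAt ℝ f z) (hg : DifferentiableAt ℝ g z) :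
    Db (fun z => f z + g z) z = Db f z + Db g z := by
  simp only [Db, dS, dT, fderiv_fun_add hf hg, add_apply]; ring

lemma cauchy_sing (w : R2) (φ : R2 → ℂ) (hφ : ContDiff ℝ 1 φ) (hc : HasCompactSupport φ) :
    Integrable (fun z => Db φ z / (cx w - cx z)) := by
  obtain ⟨R, hR⟩ := hc.isBounded.subset_closedBall w
  have hR' : tsupport φ ⊆ cBall w (max R 0) := hR.trans (Metric.closedBall_subset_closedBall (le_max_left _ _))
  obtain ⟨B, hB⟩ := (hc.fderiv (𝕜 := ℝ)).exists_bound_of_continuous (hφ.continuous_fderiv bn)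
  have hzero : ∀ z ∉ cBall w (max R 0), Db φ z = 0 := by
    intro z hz
    have : fderiv ℝ φ z = 0 := by
      by_contra h
      exact hz (hR' (support_fderiv_subset ℝ h))
    simp [Db, dS, dT, this]
  have hb : ∀ z, ‖Db φ z‖ ≤ 2 * B := by
    intro z
    have h1 : ∀ v : R2, ‖v‖ ≤ 1 → ‖fderiv ℝ φ z v‖ ≤ B := fun v hv =>
      ((fderiv ℝ φ z).le_of_opNorm_le_of_le (hB z) hv).trans (by rw [mul_one])
    calc ‖Db φ z‖ ≤ ‖dS φ z‖ + ‖cI * dT φ z‖ := norm_add_le _ _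
      _ ≤ B + B := by
        rw [norm_mul, Complex.norm_I, one_mul]
        exact add_le_add (h1 _ (by simp)) (h1 _ (by simp))
      _ = _ := by ring
  have hm : Measurable fun z => Db φ z / (cx w - cx z) :=
    (Db_cont hφ).measurable.div (measurable_const.sub (cx_cd (n := 1)).continuous.measurable)
  refine ⟨hm.aestronglyMeasurable, ?_⟩
  unfold HasFiniteIntegral
  calc ∫⁻ z, ‖Db φ z / (cx w - cx z)‖ₑ ≤ ∫⁻ z, (cBall w (max R 0)).indicator (fun z => oR (2 * B) * oR (‖w - z‖⁻¹)) z := by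
        refine lintegral_mono fun z => ?_
        by_cases hz : z ∈ cBall w (max R 0)
        · rw [indicator_of_mem hz, ← ENNReal.ofReal_mul ((norm_nonneg _).trans (hb z)), ← ofReal_norm]
          apply ENNReal.ofReal_le_ofReal
          rw [norm_div, div_eq_mul_inv]
          by_cases hzw : z = w
          · simp [hzw]
          · gcongr
            · exact (norm_nonneg _).trans (hb z)
            · exact hb z
            · rw [norm_pos_iff, sub_ne_zero]; exact fun h => hzw h.symm
            · exact norm_le_cx z w
        · simp [hzero z hz]
    _ = oR (2 * B) * ∫⁻ z in cBall w (max R 0), oR (‖w - z‖⁻¹) := by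
        rw [lintegral_indicator Metric.isClosed_closedBall.measurableSet, lintegral_const_mul' _ _ ENNReal.ofReal_ne_top]
    _ < ⊤ := ENNReal.mul_lt_top ENNReal.ofReal_lt_top ((near_lint w _ (le_max_right _ _)).trans_lt ENNReal.ofReal_lt_top)

lemma cauchy1 (k : ℤ) (f : R2 → ℂ) (hf : ContDiff ℝ 1 f) (M : ℝ) (hM : 0 < M)
    (h0 : ∀ z : R2, M < |z.1| → f z = 0) (w : R2) (hw : w ∈ St) :
    IntegrableOn (fun z => kC k (cx w - cx z) * Db f z) St ∧
    ∫ z in St, kC k (cx w - cx z) * Db f z = 2 * π * f w + cI * ((∫ s in -(M+1)..(M+1), kC k (cx w - cx (s, π)) * f (s, π))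
      - ∫ s in -(M+1)..(M+1), kC k (cx w - cx (s, 0)) * f (s, 0)) := by
  obtain ⟨-, hw1, hw2⟩ := id hw
  obtain ⟨d, hd0, hd⟩ : ∃ d > 0, cBall w d ⊆ St :=
    (Metric.nhds_basis_closedBall.mem_iff).1 (St_open.mem_nhds hw)
  let χ : ContDiffBump w := ⟨d / 2, d, by positivity, by linarith⟩
  have hχ : ContDiff ℝ 1 (fun z => (χ z : ℂ)) := Complex.ofRealCLM.contDiff.comp χ.contDiff
  have hts : tsupport (fun z => (χ z : ℂ)) ⊆ cBall w d := by
    rw [← χ.tsupport_eq]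
    exact closure_mono (fun z hz hz' => hz (by simp [hz']))
  have hz_of : ∀ z ∉ cBall w d, (fun z => (χ z : ℂ)) =ᶠ[nhds z] 0 := fun z hz =>
    notMem_tsupport_iff_eventuallyEq.1 (fun h => hz (hts h))
  have him : ∀ z ∈ St, |(cx w - cx z).im| < 2 * π := by
    rintro z ⟨-, hz1, hz2⟩
    simp only [Complex.sub_im, cx_im, abs_lt]; constructor <;> linarith [pi_pos]
  let φ : R2 → ℂ := fun z => eC k (cx w - cx z) * ((χ z : ℂ) * f z)
  have hφts : tsupport φ ⊆ cBall w d := by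
    refine (closure_mono ?_).trans hts
    intro z hz hz'; apply hz; simp only at hz'; simp [φ, hz']
  have hφ : ContDiff ℝ 1 φ := by
    refine contDiff_iff_contDiffAt.2 fun z => ?_
    by_cases hz : z ∈ cBall w d
    · exact ((eC_cd (him z (hd hz))).comp z (contDiff_const.sub cx_cd).contDiffAt).mul (hχ.mul hf).contDiffAt
    · have : φ =ᶠ[nhds z] 0 := notMem_tsupport_iff_eventuallyEq.1 (fun h => hz (hφts h))
      exact contDiffAt_const.congr_of_eventuallyEq this
  have hφc : HasCompactSupport φ := HasCompactSupport.of_support_subset_isCompact (isCompact_closedBall w d) (subset_closure.trans hφts)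
  have hA : ∀ z, kC k (cx w - cx z) * Db (fun z => (χ z : ℂ) * f z) z = Db φ z / (cx w - cx z) := by
    intro z
    by_cases hz : z ∈ cBall w d
    · rw [Db_mul_hol (eC_diff (him z (hd hz))) ((hχ.mul hf).differentiable bn z), kC_eC]; ring
    · have h1 : φ =ᶠ[nhds z] 0 := notMem_tsupport_iff_eventuallyEq.1 (fun h => hz (hφts h))
      have h2 : (fun z => (χ z : ℂ) * f z) =ᶠ[nhds z] 0 := by
        filter_upwards [hz_of z hz] with y hy
        have hy' : (χ y : ℂ) = 0 := hy
        simp [hy']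
      simp only [Db, dS, dT, h1.fderiv_eq, h2.fderiv_eq]; simp
  have hAi : IntegrableOn (fun z => kC k (cx w - cx z) * Db (fun z => (χ z : ℂ) * f z) z) St := by
    simp_rw [hA]; exact (cauchy_sing w φ hφ hφc).integrableOn
  have hAe : ∫ z in St, kC k (cx w - cx z) * Db (fun z => (χ z : ℂ) * f z) z = 2 * π * f w := by
    simp_rw [hA]
    rw [setIntegral_eq_integral_of_forall_compl_eq_zero, cauchy_shift φ hφ hφc]
    · have : χ w = 1 := χ.one_of_mem_closedBall (Metric.mem_closedBall_self (by simp only [χ]; positivity))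
      simp [φ, this, eC]
    · intro z hz
      have h1 : φ =ᶠ[nhds z] 0 := notMem_tsupport_iff_eventuallyEq.1 (fun h => hz (hd (hφts h)))
      simp only [Db, dS, dT, h1.fderiv_eq]; simp
  let f2 : R2 → ℂ := fun z => (1 - (χ z : ℂ)) * f z
  have hf2 : ContDiff ℝ 1 f2 := (contDiff_const.sub hχ).mul hf
  have hf2w : f2 =ᶠ[nhds w] 0 := by
    filter_upwards [Metric.ball_mem_nhds w (show 0 < d / 2 by positivity)] with z hz
    have : χ z = 1 := χ.one_of_mem_closedBall (Metric.ball_subset_closedBall hz)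
    simp [f2, this]
  have h := div_strip (fun z => kC k (cx w - cx z) * f2 z) M hM ?_ ?_ cI
  · have hc : EqOn (fun z => dS (fun z => kC k (cx w - cx z) * f2 z) z + cI * dT (fun z => kC k (cx w - cx z) * f2 z) z)
        (fun z => kC k (cx w - cx z) * Db f2 z) St := by
      rintro z ⟨-, hz⟩
      simp only
      by_cases hzw : z = w
      · have e : (fun z => kC k (cx w - cx z) * f2 z) =ᶠ[nhds z] 0 := by
          rw [hzw]; filter_upwards [hf2w] with y hy; simp [hy]
        rw [hzw] at e ⊢
        simp only [Db, dS, dT, e.fderiv_eq, hf2w.fderiv_eq]; simp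
      · rw [← Db_mul_hol (kC_diff (ne1 hw hz.1.le hz.2.le hzw)) (hf2.differentiable bn z), Db]
    rw [setIntegral_congr_fun St_meas hc] at h
    have hBi := (integrableOn_congr_fun hc St_meas).1 h.1
    have hsum : (fun z => kC k (cx w - cx z) * Db f z) = fun z => kC k (cx w - cx z) * Db (fun z => (χ z : ℂ) * f z) z + kC k (cx w - cx z) * Db f2 z := by
      funext z
      rw [← mul_add, ← Db_add ((hχ.mul hf).differentiable bn z) (hf2.differentiable bn z)]
      congr 2; funext z; simp only [f2]; ring
    rw [hsum]
    refine ⟨hAi.add hBi, ?_⟩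
    rw [integral_add hAi hBi, hAe, h.2]
    have hb : ∀ s t : ℝ, t = 0 ∨ t = π → f2 (s, t) = f (s, t) := by
      intro s t ht
      have : (s, t) ∉ cBall w d := by
        intro h; have := (hd h).2
        rcases ht with rfl | rfl <;> simp at this
      have := (hz_of _ this).eq_of_nhds
      simp only [Pi.zero_apply] at this
      simp [f2, this]
    simp_rw [hb _ _ (Or.inl rfl), hb _ _ (Or.inr rfl)]
  · intro z hz hz'
    by_cases hzw : z = w
    · have e : (fun z => kC k (cx w - cx z) * f2 z) =ᶠ[nhds z] 0 := by
        rw [hzw]; filter_upwards [hf2w] with y hy; simp [hy]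
      exact contDiffAt_const.congr_of_eventuallyEq e
    · exact ((kC_cd (ne1 hw hz hz' hzw)).comp z (contDiff_const.sub cx_cd).contDiffAt).mul hf2.contDiffAt
  · intro z hz; simp [f2, h0 z hz]

lemma fd_cd {n : WithTop ℕ∞} {v : R2 → ℂ} (hv : ContDiff ℝ (n+1) v) (e : R2) : ContDiff ℝ n (fun z => fderiv ℝ v z e) :=
  (hv.fderiv_right le_rfl).clm_apply contDiff_const
lemma dS_cd {n : WithTop ℕ∞} {v : R2 → ℂ} (hv : ContDiff ℝ (n+1) v) : ContDiff ℝ n (dS v) := fd_cd hv _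
lemma dT_cd {n : WithTop ℕ∞} {v : R2 → ℂ} (hv : ContDiff ℝ (n+1) v) : ContDiff ℝ n (dT v) := fd_cd hv _
lemma Dd_cd {n : WithTop ℕ∞} {v : R2 → ℂ} (hv : ContDiff ℝ (n+1) v) : ContDiff ℝ n (Dd v) :=
  (dS_cd hv).sub (contDiff_const.mul (dT_cd hv))
lemma Db_cd {n : WithTop ℕ∞} {v : R2 → ℂ} (hv : ContDiff ℝ (n+1) v) : ContDiff ℝ n (Db v) :=
  (dS_cd hv).add (contDiff_const.mul (dT_cd hv))

lemma dTdS {v : R2 → ℂ} (hv : ContDiff ℝ 2 v) (z : R2) : dT (dS v) z = dS (dT v) z := by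
  have hs : IsSymmSndFDerivAt ℝ v z := hv.contDiffAt.isSymmSndFDerivAt (by simp)
  have hd : DifferentiableAt ℝ (fderiv ℝ v) z := (hv.fderiv_right (m := 1) bn).differentiable bn z
  have h1 : ∀ e e', fderiv ℝ (fun z => fderiv ℝ v z e) z e' = fderiv ℝ (fderiv ℝ v) z e' e := by
    intro e e'
    rw [fderiv_clm_apply hd (differentiableAt_const _)]; simp
  unfold dT dS
  rw [h1, h1]
  exact hs _ _

lemma dlin {f g : R2 → ℂ} {z : R2} (hf : DifferentiableAt ℝ f z) (hg : DifferentiableAt ℝ g z) (c : ℂ) (e : R2) :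
    fderiv ℝ (fun z => f z + c * g z) z e = fderiv ℝ f z e + c * fderiv ℝ g z e := by
  rw [fderiv_fun_add hf (hg.const_mul c), fderiv_const_mul hg]; simp

lemma second {v : R2 → ℂ} (hv : ContDiff ℝ 2 v) (z : R2) :
    Db (Dd v) z = dS (dS v) z + dT (dT v) z ∧ Dd (Db v) z = dS (dS v) z + dT (dT v) z ∧
    Dd (Dd v) z = dS (dS v) z - dT (dT v) z - 2 * cI * dS (dT v) z ∧
    Db (Db v) z = dS (dS v) z - dT (dT v) z + 2 * cI * dS (dT v) z := by
  have hS : DifferentiableAt ℝ (dS v) z := (dS_cd (n := 1) hv).differentiable bn z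
  have hT : DifferentiableAt ℝ (dT v) z := (dT_cd (n := 1) hv).differentiable bn z
  have e1 : Dd v = fun z => dS v z + (-cI) * dT v z := by funext z; simp [Dd]; ring
  have e2 : Db v = fun z => dS v z + cI * dT v z := rfl
  have hsy := dTdS hv z
  have hI := Complex.I_sq
  have k1 : dS (Dd v) z = dS (dS v) z - cI * dS (dT v) z := by
    rw [e1]; refine (dlin hS hT _ _).trans ?_; simp [dS]; ring
  have k2 : dT (Dd v) z = dS (dT v) z - cI * dT (dT v) z := by
    rw [e1, ← hsy]; refine (dlin hS hT _ _).trans ?_; simp [dT]; ring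
  have k3 : dS (Db v) z = dS (dS v) z + cI * dS (dT v) z := by
    rw [e2]; exact dlin hS hT _ _
  have k4 : dT (Db v) z = dS (dT v) z + cI * dT (dT v) z := by
    rw [e2, ← hsy]; exact dlin hS hT _ _
  have u1 : ∀ h, Dd h z = dS h z - cI * dT h z := fun h => rfl
  have u2 : ∀ h, Db h z = dS h z + cI * dT h z := fun h => rfl
  refine ⟨?_, ?_, ?_, ?_⟩ <;> simp only [u1 (Dd v), u2 (Dd v), u1 (Db v), u2 (Db v), k1, k2, k3, k4]
  · linear_combination -dT (dT v) z * hI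
  · linear_combination -dT (dT v) z * hI
  · linear_combination dT (dT v) z * hI
  · linear_combination dT (dT v) z * hI

def Gam (k : ℤ) (w z : R2) : ℂ := (kC k (cx w - cx z) - kC k (cx w - conj (cx z))) / (2 * π)

lemma kC_per (k : ℤ) (ζ : ℂ) : kC k (ζ + 2 * π * cI) = kC k ζ := by
  unfold kC
  have h2 : cE (k * (ζ + 2 * π * cI)) = cE (k * ζ) := by
    rw [mul_add, Complex.exp_add, Complex.exp_int_mul_two_pi_mul_I, mul_one]
  rw [h2, Complex.exp_add, Complex.exp_two_pi_mul_I, mul_one]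

lemma dS_bdry {v : R2 → ℂ} (hv : ContDiff ℝ 2 v) (t : ℝ) (h : ∀ s, v (s, t) = 0) (s : ℝ) : dS v (s, t) = 0 := by
  have h1 : HasDerivAt (fun s : ℝ => ((s, t) : R2)) (1, 0) s := (hasDerivAt_id s).prodMk (hasDerivAt_const s t)
  have h2 := (hv.differentiable bn (s, t)).hasFDerivAt.comp_hasDerivAt s h1
  have h3 : (v ∘ fun s : ℝ => ((s, t) : R2)) = fun _ => 0 := funext h
  rw [h3] at h2
  exact h2.unique (hasDerivAt_const s 0)

lemma fd_zero {v : R2 → ℂ} (M : ℝ) (h0 : ∀ z : R2, M < |z.1| → v z = 0) (z : R2) (hz : M < |z.1|) : fderiv ℝ v z = 0 := by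
  have : v =ᶠ[nhds z] 0 := by
    filter_upwards [(isOpen_lt continuous_const (continuous_abs.comp continuous_fst) : IsOpen {z : R2 | M < |z.1|}).mem_nhds hz] with y hy
    exact h0 y hy
  rw [this.fderiv_eq]; simp

theorem rep (k : ℤ) (v : R2 → ℂ) (hv : ContDiff ℝ 2 v) (M : ℝ) (hM : 0 < M)
    (h0 : ∀ z : R2, M < |z.1| → v z = 0) (hb0 : ∀ s, v (s, 0) = 0) (hbπ : ∀ s, v (s, π) = 0) (w : R2) (hw : w ∈ St) :
    IntegrableOn (fun z => Gam k w z * Db (Dd v) z) St ∧ Dd v w = ∫ z in St, Gam k w z * Db (Dd v) z := by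
  have z1 : ∀ z : R2, M < |z.1| → Dd v z = 0 := fun z hz => by simp [Dd, dS, dT, fd_zero M h0 z hz]
  have z2 : ∀ z : R2, M < |z.1| → Db v z = 0 := fun z hz => by simp [Db, dS, dT, fd_zero M h0 z hz]
  obtain ⟨i1, e1⟩ := cauchy1 k (Dd v) (Dd_cd (n := 1) hv) M hM z1 w hw
  obtain ⟨i2, e2⟩ := cauchy2 k (Db v) (Db_cd (n := 1) hv) M hM z2 w hw
  have hsw : ∀ z, Dd (Db v) z = Db (Dd v) z := fun z => (second hv z).2.1.trans (second hv z).1.symm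
  simp_rw [hsw] at i2 e2
  have he : (fun z => Gam k w z * Db (Dd v) z) = fun z =>
      (kC k (cx w - cx z) * Db (Dd v) z - kC k (cx w - conj (cx z)) * Db (Dd v) z) / (2 * π) := by
    funext z; simp only [Gam]; ring
  rw [he]
  refine ⟨(i1.sub i2).div_const _, ?_⟩
  rw [integral_div, integral_sub i1 i2, e1, e2]
  have b1 : ∀ s t : ℝ, t = 0 ∨ t = π → Db v (s, t) = -Dd v (s, t) := by
    intro s t ht
    have : dS v (s, t) = 0 := by
      rcases ht with rfl | rfl
      · exact dS_bdry hv _ hb0 s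
      · exact dS_bdry hv _ hbπ s
    simp [Db, Dd, this]
  have b2 : ∀ s : ℝ, kC k (cx w - conj (cx (s, π))) = kC k (cx w - cx (s, π)) := by
    intro s
    rw [← kC_per k (cx w - cx (s, π))]
    congr 1; simp [cx]; ring
  have b3 : ∀ s : ℝ, conj (cx (s, 0)) = cx (s, 0) := by intro s; simp [cx]
  simp_rw [b1 _ _ (Or.inl rfl), b1 _ _ (Or.inr rfl), b2, b3, mul_neg, intervalIntegral.integral_neg]
  have : (π : ℂ) ≠ 0 := by exact_mod_cast pi_ne_zero
  field_simp
  ring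

def rh (t : ℝ) : ℝ := min t (π - t)
def DD (w z : R2) : ℝ := |w.1 - z.1| + rh w.2 + rh z.2

lemma rh_pos {z : R2} (hz : z ∈ St) : 0 < rh z.2 := lt_min hz.2.1 (by linarith [hz.2.2])
lemma rh_le (t : ℝ) : rh t ≤ π / 2 := by
  unfold rh; rcases le_total t (π / 2) with h | h
  · exact (min_le_left _ _).trans h
  · exact (min_le_right _ _).trans bl
lemma rh_lip (s t : ℝ) : rh s ≤ rh t + |s - t| := by
  unfold rh
  rw [← sub_le_iff_le_add, le_min_iff]
  constructor
  · linarith [min_le_left s (π - s), le_abs_self (s - t)]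
  · linarith [min_le_right s (π - s), neg_abs_le (s - t)]
lemma DD_pos {w z : R2} (hw : w ∈ St) (hz : z ∈ St) : 0 < DD w z := by
  unfold DD; linarith [abs_nonneg (w.1 - z.1), rh_pos hw, rh_pos hz]

lemma expm1_aux (ζ : ℂ) (e : ℝ) (he : 0 ≤ e) (h1 : e ≤ |ζ.im|) (h2 : e ≤ 2 * π - |ζ.im|) :
    (1/5) * min 1 (|ζ.re| + e) ≤ ‖cE ζ - 1‖ := by
  set σ := ζ.re
  set τ := ζ.im
  have hsq : ‖cE ζ - 1‖ ^ 2 = (rexp σ - 1) ^ 2 + 2 * rexp σ * (1 - cos τ) := by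
    rw [← Complex.normSq_eq_norm_sq, Complex.normSq_apply]
    simp only [Complex.sub_re, Complex.sub_im, Complex.exp_re, Complex.exp_im, Complex.one_re, Complex.one_im]
    linear_combination (rexp ζ.re) ^ 2 * sin_sq_add_cos_sq τ
  have hcos : cos τ ≤ 1 := cos_le_one τ
  have hN := norm_nonneg (cE ζ - 1)
  have hE := exp_pos σ
  have hA : |rexp σ - 1| ≤ ‖cE ζ - 1‖ := by
    rw [← sq_le_sq₀ (abs_nonneg _) hN, hsq, sq_abs]
    nlinarith [mul_nonneg hE.le (sub_nonneg.2 hcos)]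
  have hB : min 1 |σ| / 2 ≤ |rexp σ - 1| := by
    rcases le_total 0 σ with h | h
    · rw [abs_of_nonneg h, abs_of_nonneg (by linarith [one_le_exp h])]
      linarith [add_one_le_exp σ, min_le_right 1 σ]
    · rw [abs_of_nonpos h, abs_of_nonpos (by linarith [exp_le_one_iff.2 h])]
      have h3 : rexp σ * (1 - σ) ≤ 1 := by
        have := add_one_le_exp (-σ)
        calc rexp σ * (1 - σ) ≤ rexp σ * rexp (-σ) := by gcongr; linarith
          _ = 1 := by rw [← exp_add]; simp
      rcases le_total 1 (-σ) with h4 | h4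
      · rw [min_eq_left h4]; nlinarith
      · rw [min_eq_right h4]; nlinarith
  rcases le_total |σ| 1 with h | h
  · rw [min_eq_right h] at hB
    have hs : e / π ≤ |sin (τ / 2)| := by
      have hab : |sin (τ / 2)| = |sin (|τ| / 2)| := by
        rcases abs_cases τ with ⟨h, -⟩ | ⟨h, -⟩ <;> rw [h]
        rw [neg_div, sin_neg, abs_neg]
      rw [hab]
      refine le_trans ?_ (le_abs_self _)
      rcases le_total |τ| π with h5 | h5
      · refine le_trans ?_ (mul_le_sin (x := |τ| / 2) bp bl)
        rw [div_le_iff₀ pi_pos]; field_simp; linarith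
      · rw [← sin_pi_sub]
        refine le_trans ?_ (mul_le_sin (x := π - |τ| / 2) bl bl)
        rw [div_le_iff₀ pi_pos]; field_simp; linarith
    have hc2 : 1 - cos τ = 2 * |sin (τ / 2)| ^ 2 := by
      rw [sq_abs, sin_sq_eq_half_sub]; ring_nf
    have hexp : 1 / 3 ≤ rexp σ := by
      have h6 : rexp (-1) ≤ rexp σ := exp_le_exp.2 (by linarith [neg_abs_le σ])
      rw [exp_neg] at h6
      refine le_trans ?_ h6
      rw [one_div]; exact inv_anti₀ (exp_pos 1) (by linarith [exp_one_lt_d9])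
    have h7 : e / 3 ≤ ‖cE ζ - 1‖ := by
      rw [← sq_le_sq₀ bp hN, hsq, hc2]
      have h8 : (e / π) ^ 2 ≤ |sin (τ / 2)| ^ 2 := by gcongr
      have h9 : (e / 3) ^ 2 ≤ 4 / 3 * (e / π) ^ 2 := by
        rw [div_pow, div_pow, mul_div_assoc', div_le_div_iff₀ bn bp]
        have : π ^ 2 ≤ 12 := by nlinarith [pi_lt_d2, pi_pos]
        nlinarith [sq_nonneg e]
      nlinarith [sq_nonneg (rexp σ - 1), sq_nonneg |sin (τ / 2)|]
    linarith [min_le_right 1 (|σ| + e)]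
  · rw [min_eq_left h] at hB
    linarith [min_le_left 1 (|σ| + e)]

lemma expm1_lower (ζ : ℂ) (e : ℝ) (he : 0 ≤ e) (h1 : e ≤ |ζ.im|) (h2 : e ≤ 2 * π - |ζ.im|) :
    (1/5) * max 1 (rexp ζ.re) * min 1 (|ζ.re| + e) ≤ ‖cE ζ - 1‖ := by
  have k1 := expm1_aux ζ e he h1 h2
  have k2 := expm1_aux (-ζ) e he (by simpa using h1) (by simpa using h2)
  have k3 : ‖cE ζ - 1‖ = rexp ζ.re * ‖cE (-ζ) - 1‖ := by
    rw [← Complex.norm_exp, ← norm_mul, mul_sub, ← Complex.exp_add]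
    rw [show ζ + -ζ = 0 by ring, Complex.exp_zero, mul_one, norm_sub_rev]
  rw [Complex.neg_re, abs_neg] at k2
  rcases le_total 1 (rexp ζ.re) with h | h
  · rw [max_eq_right h, k3]; nlinarith [exp_pos ζ.re]
  · rw [max_eq_left h]; linarith

def GQ (k : ℤ) (t : ℝ) (X : ℂ) : ℂ := (kC k (X - t * cI) - kC k (X + t * cI)) / (2 * π)

lemma Gam_GQ (k : ℤ) (w z : R2) : Gam k w z = GQ k z.2 (cx w - z.1) := by
  unfold Gam GQ
  congr 3
  · simp [cx]; ring
  · congr 1; simp [cx]; ring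

lemma sin_int_le (n : ℤ) (t : ℝ) (h0 : 0 ≤ t) (h1 : t ≤ π) : |sin (n * t)| ≤ |(n:ℝ)| * rh t := by
  unfold rh
  rw [mul_min_of_nonneg _ _ (abs_nonneg _), le_min_iff]
  constructor
  · refine (abs_sin_le_abs).trans ?_
    rw [abs_mul, abs_of_nonneg h0]
  · have : |sin (n * t)| = |sin (n * (π - t))| := by
      rw [mul_sub, sin_int_mul_pi_sub, abs_neg, abs_mul, abs_zpow]; simp
    rw [this]
    refine (abs_sin_le_abs).trans ?_
    rw [abs_mul, abs_of_nonneg (by linarith : 0 ≤ π - t)]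

lemma GQ_deriv (k : ℤ) (t : ℝ) (X : ℂ) (ht0 : 0 ≤ t) (ht1 : t ≤ π) (mm c : ℝ) (hc : 0 < c) (hc1 : c ≤ 1) (hm : 0 < mm) (hm1 : mm ≤ 1)
    (hA : c * max 1 (rexp X.re) * mm ≤ ‖cE (X - t * cI) - 1‖)
    (hB : c * max 1 (rexp X.re) * mm ≤ ‖cE (X + t * cI) - 1‖) :
    ∃ Q', HasDerivAt (GQ k t) Q' X ∧ max ‖GQ k t X‖ ‖Q'‖ ≤
      4 * (|(k:ℝ)| + 1) * (rh t * (|(k:ℝ) - 1| * rexp ((k + 1) * X.re) + |(k:ℝ)| * rexp (k * X.re))) / (c ^ 3 * mm ^ 3 * max 1 (rexp X.re) ^ 2) := by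
  set σ := X.re with hσ
  set A := cE (X - t * cI) - 1 with hAdef
  set B := cE (X + t * cI) - 1 with hBdef
  set m1 := max 1 (rexp σ) with hm1def
  have hm1p : 0 < m1 := lt_max_of_lt_left one_pos
  have hd : 0 < c * m1 * mm := by positivity
  have hA0 : A ≠ 0 := norm_pos_iff.1 (hd.trans_le hA)
  have hB0 : B ≠ 0 := norm_pos_iff.1 (hd.trans_le hB)
  let n0 := rh t * (|(k:ℝ) - 1| * rexp ((k + 1) * σ) + |(k:ℝ)| * rexp (k * σ))
  have hrh : 0 ≤ rh t := le_min ht0 bl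
  have hn0 : 0 ≤ n0 := by positivity
  let N : ℂ → ℂ := fun X => cE ((k+1) * X) * (-2 * cI * sin ((k - 1 : ℤ) * t)) + cE (k * X) * (2 * cI * sin (k * t))
  let N' : ℂ → ℂ := fun X => (k+1) * (cE ((k+1) * X) * (-2 * cI * sin ((k - 1 : ℤ) * t))) + k * (cE (k * X) * (2 * cI * sin (k * t)))
  have hform : ∀ Y : ℂ, cE (Y - t * cI) - 1 ≠ 0 → cE (Y + t * cI) - 1 ≠ 0 →
      GQ k t Y = N Y / ((cE (Y - t * cI) - 1) * (cE (Y + t * cI) - 1)) / (2 * π) := by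
    intro Y h1 h2
    unfold GQ kC
    congr 1
    rw [div_sub_div _ _ h1 h2]
    congr 1
    simp only [N]
    have es : ∀ r : ℝ, 2 * cI * (sin r : ℂ) = cE (r * cI) - cE (-r * cI) := by
      intro r
      push_cast
      rw [Complex.sin]
      linear_combination (cE (-r * cI) - cE (r * cI)) * Complex.I_sq
    have e1 := es ((k - 1 : ℤ) * t)
    have e2 := es (k * t)
    rw [e2, show (-2 * cI * (sin ((k - 1 : ℤ) * t) : ℂ)) = -(2 * cI * (sin ((k - 1 : ℤ) * t) : ℂ)) by ring, e1]
    push_cast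
    simp only [mul_sub, mul_neg, sub_mul, mul_one, ← Complex.exp_add]
    ring_nf
  have hfX := hform X hA0 hB0
  have hNX : ‖N X‖ ≤ 2 * n0 ∧ ‖N' X‖ ≤ 2 * ((|(k:ℝ)| + 1) * n0) := by
    have s1 := sin_int_le (k - 1) t ht0 ht1
    have s2 := sin_int_le k t ht0 ht1
    rw [Int.cast_sub, Int.cast_one] at s1
    have t1 : ‖cE ((k+1) * X) * (-2 * cI * sin ((k - 1 : ℤ) * t))‖ ≤ 2 * (rh t * (|(k:ℝ) - 1| * rexp ((k + 1) * σ))) := by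
      rw [norm_mul, Complex.norm_exp]
      simp only [norm_mul, norm_neg, Complex.norm_I, Complex.norm_real, Real.norm_eq_abs, Complex.norm_two]
      have : ((k + 1 : ℂ) * X).re = (k + 1) * σ := by simp [hσ]
      rw [this]
      push_cast
      nlinarith [exp_pos (((k:ℝ) + 1) * σ)]
    have t2 : ‖cE (k * X) * (2 * cI * sin (k * t))‖ ≤ 2 * (rh t * (|(k:ℝ)| * rexp (k * σ))) := by
      rw [norm_mul, Complex.norm_exp]
      simp only [norm_mul, Complex.norm_I, Complex.norm_real, Real.norm_eq_abs, Complex.norm_two]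
      have : ((k : ℂ) * X).re = k * σ := by simp [hσ]
      rw [this]
      nlinarith [exp_pos ((k:ℝ) * σ)]
    have hk1 : ‖(k : ℂ) + 1‖ ≤ |(k:ℝ)| + 1 := (norm_add_le _ _).trans (by simp)
    have hk2 : ‖(k : ℂ)‖ ≤ |(k:ℝ)| + 1 := by simp
    constructor
    · refine (norm_add_le _ _).trans ((add_le_add t1 t2).trans (le_of_eq ?_)); simp only [n0]; ring
    · refine (norm_add_le _ _).trans ?_
      rw [norm_mul, norm_mul (k : ℂ)]
      refine (add_le_add (mul_le_mul hk1 t1 (norm_nonneg _) bp) (mul_le_mul hk2 t2 (norm_nonneg _) bp)).trans (le_of_eq ?_)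
      simp only [n0]; ring
  have hdN : HasDerivAt N (N' X) X := by
    have q : ∀ a C : ℂ, HasDerivAt (fun X => cE (a * X) * C) (a * (cE (a * X) * C)) X := by
      intro a C
      have h := (((hasDerivAt_id X).const_mul a).cexp.mul_const C)
      refine h.congr_deriv ?_; simp; ring
    exact (q _ _).add (q _ _)
  have hdA : HasDerivAt (fun X => cE (X - t * cI) - 1) (A + 1) X := by
    have h := ((hasDerivAt_id X).sub_const (t * cI)).cexp.sub_const 1
    refine h.congr_deriv ?_; simp [A]
  have hdB : HasDerivAt (fun X => cE (X + t * cI) - 1) (B + 1) X := by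
    have h := ((hasDerivAt_id X).add_const (t * cI)).cexp.sub_const 1
    refine h.congr_deriv ?_; simp [B]
  have hdQ := ((hdN.div (hdA.mul hdB) (mul_ne_zero hA0 hB0)).div_const (2 * π : ℂ))
  have hev : GQ k t =ᶠ[nhds X] fun Y => N Y / ((cE (Y - t * cI) - 1) * (cE (Y + t * cI) - 1)) / (2 * π) := by
    filter_upwards [hdA.continuousAt.eventually_ne hA0, hdB.continuousAt.eventually_ne hB0] with Y h1 h2
    exact hform Y h1 h2
  refine ⟨_, hdQ.congr_of_eventuallyEq hev, ?_⟩
  have hAB : c ^ 2 * m1 ^ 2 * mm ^ 2 ≤ ‖A‖ * ‖B‖ := by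
    calc _ = (c * m1 * mm) * (c * m1 * mm) := by ring
      _ ≤ _ := by gcongr
  have hABp : 0 < c ^ 2 * m1 ^ 2 * mm ^ 2 := by positivity
  have h2π : 2 ≤ ‖(2 * π : ℂ)‖ := by
    simp [abs_of_pos pi_pos]; linarith [pi_gt_three]
  have hcm : c * mm ≤ 1 := by nlinarith
  have hfrac : ∀ (Z : ℂ), cE X * Z ≠ 0 → ‖Z‖ = 1 → c * m1 * mm ≤ ‖cE X * Z - 1‖ → ‖(cE X * Z) / (cE X * Z - 1)‖ ≤ 1 / (c * mm) := by
    intro Z _ hZ h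
    rw [norm_div, norm_mul, hZ, mul_one, Complex.norm_exp, div_le_div_iff₀ (hd.trans_le h) bp, one_mul]
    refine le_trans ?_ h
    calc rexp X.re * (c * mm) ≤ m1 * (c * mm) := by gcongr; exact le_max_right _ _
      _ = _ := by ring
  have hfA : ‖(A + 1) / A‖ ≤ 1 / (c * mm) := by
    have e : A + 1 = cE X * cE (-(t * cI)) := by rw [← Complex.exp_add, hAdef]; ring_nf
    have e' : A = cE X * cE (-(t * cI)) - 1 := by rw [← e]; ring
    have h := hfrac (cE (-(t * cI))) (by simp [Complex.exp_ne_zero]) (by simp [Complex.norm_exp]) (by rw [← e']; exact hA)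
    rwa [← e', ← e] at h
  have hfB : ‖(B + 1) / B‖ ≤ 1 / (c * mm) := by
    have e : B + 1 = cE X * cE (t * cI) := by rw [← Complex.exp_add, hBdef]; ring_nf
    have e' : B = cE X * cE (t * cI) - 1 := by rw [← e]; ring
    have h := hfrac (cE (t * cI)) (by simp [Complex.exp_ne_zero]) (by simp [Complex.norm_exp]) (by rw [← e']; exact hB)
    rwa [← e', ← e] at h
  have hbig : ∀ x : ℂ, ‖x‖ ≤ 2 * (4 * (|(k:ℝ)| + 1) * n0 / (c * mm)) → ‖x / (A * B) / (2 * π)‖ ≤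
      4 * (|(k:ℝ)| + 1) * n0 / (c ^ 3 * mm ^ 3 * m1 ^ 2) := by
    intro x hx
    rw [norm_div, norm_div, norm_mul]
    calc ‖x‖ / (‖A‖ * ‖B‖) / ‖(2 * π : ℂ)‖ ≤ (2 * (4 * (|(k:ℝ)| + 1) * n0 / (c * mm))) / (c ^ 2 * m1 ^ 2 * mm ^ 2) / 2 := by gcongr
      _ = _ := by field_simp
  have hK1 : 1 ≤ |(k:ℝ)| + 1 := by linarith [abs_nonneg (k:ℝ)]
  have hinv : 1 ≤ 1 / (c * mm) := by rw [le_div_iff₀ bp]; linarith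
  refine max_le ?_ ?_
  · rw [hfX]
    refine hbig _ (hNX.1.trans ?_)
    have : n0 ≤ (|(k:ℝ)| + 1) * n0 * (1 / (c * mm)) := by
      calc n0 = 1 * n0 * 1 := by ring
        _ ≤ _ := by gcongr
    calc 2 * n0 ≤ 2 * (4 * ((|(k:ℝ)| + 1) * n0 * (1 / (c * mm)))) := by linarith
      _ = _ := by ring
  · have e : (N' X * (A * B) - N X * ((A + 1) * B + A * (B + 1))) / (A * B) ^ 2 / (2 * π) =
        (N' X - N X * ((A + 1) / A + (B + 1) / B)) / (A * B) / (2 * π) := by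
      congr 1; field_simp
    refine le_trans (le_of_eq (congrArg norm (Eq.trans ?_ e))) (hbig _ ?_)
    · simp only [Pi.mul_apply]; rfl
    · calc ‖N' X - N X * ((A + 1) / A + (B + 1) / B)‖ ≤ ‖N' X‖ + ‖N X‖ * (‖(A + 1) / A‖ + ‖(B + 1) / B‖) := by
            refine (norm_sub_le _ _).trans ?_
            rw [norm_mul]; gcongr; exact norm_add_le _ _
        _ ≤ 2 * ((|(k:ℝ)| + 1) * n0) * (1 / (c * mm)) + 2 * ((|(k:ℝ)| + 1) * n0) * (1 / (c * mm) + 1 / (c * mm)) := by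
            have hh : 2 * n0 ≤ 2 * ((|(k:ℝ)| + 1) * n0) := by nlinarith
            gcongr
            · refine hNX.2.trans ?_
              exact le_mul_of_one_le_right bp hinv
            · exact hNX.1.trans hh
        _ ≤ _ := by
            have : 0 ≤ ((|(k:ℝ)| + 1) * n0) * (1 / (c * mm)) := by positivity
            calc _ = 6 * (((|(k:ℝ)| + 1) * n0) * (1 / (c * mm))) := by ring
              _ ≤ 8 * (((|(k:ℝ)| + 1) * n0) * (1 / (c * mm))) := by linarith
              _ = _ := by ring

lemma expo_aux (δ a σ : ℝ) (h1 : δ ≤ a) (h2 : a ≤ 2 - δ) :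
    rexp (a * σ) ≤ max 1 (rexp σ) ^ 2 * rexp (-δ * |σ|) := by
  rcases le_total 0 σ with h | h
  · rw [max_eq_right (one_le_exp h), abs_of_nonneg h, ← exp_nat_mul, ← exp_add, exp_le_exp]
    push_cast; nlinarith
  · rw [max_eq_left (exp_le_one_iff.2 h), abs_of_nonpos h, one_pow, one_mul, exp_le_exp]
    nlinarith

lemma expo (b : ℝ) (hb : ∀ n : ℤ, n ≠ 0 → b ≠ n) (k : ℤ) (hk : k = ⌊b⌋ + 1) : ∃ δ : ℝ, 0 < δ ∧ δ ≤ 1 ∧ ∀ σ : ℝ,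
    |(k:ℝ) - 1| * rexp ((k + 1) * σ) + |(k:ℝ)| * rexp (k * σ) ≤
      (|(k:ℝ) - 1| + |(k:ℝ)|) * rexp (b * σ) * (max 1 (rexp σ) ^ 2 * rexp (-δ * |σ|)) := by
  have hf1 := Int.floor_le b
  have hf2 := Int.lt_floor_add_one b
  have hkr : (k:ℝ) = ⌊b⌋ + 1 := by rw [hk]; push_cast; ring
  have es : ∀ a σ : ℝ, rexp (a * σ) = rexp (b * σ) * rexp ((a - b) * σ) := by
    intro a σ; rw [← exp_add]; ring_nf
  by_cases h0 : ⌊b⌋ = 0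
  · have hk1 : (k:ℝ) = 1 := by rw [hkr, h0]; simp
    rw [h0] at hf1 hf2
    simp at hf1 hf2
    refine ⟨1 - b, by linarith, by linarith, fun σ => ?_⟩
    rw [hk1]; simp only [sub_self, abs_zero, zero_mul, zero_add, abs_one, one_mul]
    have := es 1 σ
    rw [one_mul] at this
    refine this.le.trans ?_
    gcongr
    exact expo_aux _ _ _ bl bl
  · have h1 : (⌊b⌋ : ℝ) < b := lt_of_le_of_ne hf1 (hb _ h0).symm
    refine ⟨min (k - b) (b - k + 1), lt_min bl bl, (min_le_right _ _).trans bl, fun σ => ?_⟩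
    have m1 := min_le_left ((k:ℝ) - b) (b - k + 1)
    have m2 := min_le_right ((k:ℝ) - b) (b - k + 1)
    rw [es (k+1), es k, add_mul, add_mul, mul_assoc, mul_assoc]
    gcongr
    · exact expo_aux _ _ _ bl bl
    · exact expo_aux _ _ _ bl bl

lemma exp_cube (δ x D : ℝ) (hδ : 0 < δ) (hδ1 : δ ≤ 1) (hx : 0 ≤ x) (hD : 0 < D) (hDx : D ≤ x + π) :
    rexp (-δ * x) / min 1 D ^ 3 ≤ 64 / δ ^ 3 / D ^ 3 := by
  have h64 : 1 ≤ 64 / δ ^ 3 := by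
    rw [one_le_div bp]; have := pow_le_one₀ hδ.le hδ1 (n := 3); linarith
  rcases le_total D 1 with h | h
  · rw [min_eq_right h]
    gcongr
    refine le_trans ?_ h64
    rw [exp_le_one_iff]; nlinarith
  · rw [min_eq_left h, one_pow, div_one, le_div_iff₀ bp]
    have h1 : x + π ≤ 4 / δ * rexp (δ * x / 3) := by
      have := add_one_le_exp (δ * x / 3)
      rw [div_mul_eq_mul_div, le_div_iff₀ hδ]
      nlinarith [pi_lt_d2, mul_nonneg hδ.le hx]
    have h2 : D ^ 3 ≤ (4 / δ * rexp (δ * x / 3)) ^ 3 := by gcongr; linarith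
    calc rexp (-δ * x) * D ^ 3 ≤ rexp (-δ * x) * (4 / δ * rexp (δ * x / 3)) ^ 3 := by gcongr
      _ = 64 / δ ^ 3 * (rexp (-δ * x) * rexp (δ * x / 3) ^ 3) := by ring
      _ = 64 / δ ^ 3 := by rw [← exp_nat_mul, ← exp_add]; push_cast; ring_nf; simp

lemma low1 (y z : R2) (hy : y ∈ St) (hz : z ∈ St) :
    (1/5) * max 1 (rexp (y.1 - z.1)) * min 1 (|y.1 - z.1| + |y.2 - z.2|) ≤
      ‖cE ((cx y - z.1) - z.2 * cI) - 1‖ := by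
  have h := expm1_lower ((cx y - z.1) - z.2 * cI) |y.2 - z.2| (abs_nonneg _) (by simp) (by
    have h1 := hy.2.1; have h2 := hy.2.2; have h3 := hz.2.1; have h4 := hz.2.2
    have : |y.2 - z.2| < π := by rw [abs_lt]; constructor <;> linarith
    simp; linarith)
  simpa using h

lemma low2 (y z : R2) (hy : y ∈ St) (hz : z ∈ St) :
    (1/5) * max 1 (rexp (y.1 - z.1)) * min 1 (DD y z) ≤
      ‖cE ((cx y - z.1) + z.2 * cI) - 1‖ := by
  have h1 := hy.2.1; have h2 := hy.2.2; have h3 := hz.2.1; have h4 := hz.2.2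
  have a1 := rh_pos hy
  have a2 := rh_pos hz
  have a3 := min_le_left y.2 (π - y.2)
  have a4 := min_le_left z.2 (π - z.2)
  have a5 := min_le_right y.2 (π - y.2)
  have a6 := min_le_right z.2 (π - z.2)
  have h := expm1_lower ((cx y - z.1) + z.2 * cI) (rh y.2 + rh z.2) bl
    (by simp [rh]; refine le_trans ?_ (le_abs_self _); linarith)
    (by simp; rw [abs_of_pos bl]; unfold rh; linarith)
  have e : |y.1 - z.1| + (rh y.2 + rh z.2) = DD y z := by unfold DD; ring
  simpa [e] using h

lemma gq_far (b : ℝ) (hb : ∀ n : ℤ, n ≠ 0 → b ≠ n) (k : ℤ) (hk : k = ⌊b⌋ + 1) (L : ℝ) (hL : 1 ≤ L) :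
    ∃ A : ℝ, 0 ≤ A ∧ ∀ y z, y ∈ St → z ∈ St → DD y z ≤ L * (|y.1 - z.1| + |y.2 - z.2|) →
      ∃ Q', HasDerivAt (GQ k z.2) Q' (cx y - z.1) ∧
        max ‖GQ k z.2 (cx y - z.1)‖ ‖Q'‖ ≤ A * (rexp (b * (y.1 - z.1)) * rh z.2 / DD y z ^ 3) := by
  obtain ⟨δ, hδ, hδ1, hδ2⟩ := expo b hb k hk
  refine ⟨4 * (|(k:ℝ)| + 1) * (|(k:ℝ) - 1| + |(k:ℝ)|) * (125 * L ^ 3) * (64 / δ ^ 3), by positivity, ?_⟩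
  intro y z hy hz hD
  have hre : (cx y - z.1).re = y.1 - z.1 := by simp
  have hDp := DD_pos hy hz
  have hL0 : 0 < L := by linarith
  have hmmp : 0 < min 1 (DD y z) := lt_min one_pos hDp
  obtain ⟨Q', h1, h2⟩ := GQ_deriv k z.2 (cx y - z.1) hz.2.1.le hz.2.2.le (min 1 (DD y z)) (1 / (5 * L)) bp
    (by rw [div_le_one bp]; linarith) hmmp (min_le_left _ _) (by
      rw [hre]
      refine le_trans ?_ (low1 y z hy hz)
      have : min 1 (DD y z) / L ≤ min 1 (|y.1 - z.1| + |y.2 - z.2|) := by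
        rw [div_le_iff₀ hL0, min_mul_of_nonneg _ _ hL0.le]
        refine min_le_min bl bl
      calc _ = (1/5) * max 1 (rexp (y.1 - z.1)) * (min 1 (DD y z) / L) := by field_simp
        _ ≤ _ := by gcongr) (by
      rw [hre]
      refine le_trans ?_ (low2 y z hy hz)
      have : 1 / (5 * L) ≤ 1 / 5 := by gcongr; linarith
      gcongr)
  refine ⟨Q', h1, h2.trans ?_⟩
  rw [hre]
  have hm1p : 0 < max 1 (rexp (y.1 - z.1)) := lt_max_of_lt_left one_pos
  have hrz := rh_pos hz
  have hec := exp_cube δ |y.1 - z.1| (DD y z) hδ hδ1 (abs_nonneg _) hDp (by unfold DD; linarith [rh_le y.2, rh_le z.2])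
  calc _ ≤ 4 * (|(k:ℝ)| + 1) * (rh z.2 * ((|(k:ℝ) - 1| + |(k:ℝ)|) * rexp (b * (y.1 - z.1)) * (max 1 (rexp (y.1 - z.1)) ^ 2 * rexp (-δ * |y.1 - z.1|)))) / ((1 / (5 * L)) ^ 3 * min 1 (DD y z) ^ 3 * max 1 (rexp (y.1 - z.1)) ^ 2) := by
        gcongr; exact hδ2 _
    _ = 4 * (|(k:ℝ)| + 1) * (|(k:ℝ) - 1| + |(k:ℝ)|) * (125 * L ^ 3) * rexp (b * (y.1 - z.1)) * rh z.2 * (rexp (-δ * |y.1 - z.1|) / min 1 (DD y z) ^ 3) := by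
        field_simp; norm_num
    _ ≤ 4 * (|(k:ℝ)| + 1) * (|(k:ℝ) - 1| + |(k:ℝ)|) * (125 * L ^ 3) * rexp (b * (y.1 - z.1)) * rh z.2 * (64 / δ ^ 3 / DD y z ^ 3) := by
        gcongr
    _ = _ := by ring

lemma ball_St {ω y : R2} (hω : ω ∈ St) (hy : y ∈ cBall ω (3 * (rh ω.2 / 16))) :
    y ∈ St ∧ |y.1 - ω.1| ≤ ‖y - ω‖ ∧ |y.2 - ω.2| ≤ ‖y - ω‖ ∧ 13 * (rh ω.2 / 16) ≤ rh y.2 ∧ rh y.2 ≤ 19 * (rh ω.2 / 16) := by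
  rw [Metric.mem_closedBall, dist_eq_norm] at hy
  have h1 : |y.1 - ω.1| ≤ ‖y - ω‖ := le_max_left _ _
  have h2 : |y.2 - ω.2| ≤ ‖y - ω‖ := le_max_right _ _
  have h3 := rh_lip y.2 ω.2
  have h4 := rh_lip ω.2 y.2
  rw [abs_sub_comm] at h4
  have h5 := rh_pos hω
  refine ⟨⟨mem_univ _, ?_, ?_⟩, h1, h2, by linarith, by linarith⟩
  · linarith [min_le_left y.2 (π - y.2), show rh y.2 = min y.2 (π - y.2) from rfl]
  · linarith [min_le_right y.2 (π - y.2), show rh y.2 = min y.2 (π - y.2) from rfl]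

lemma gam_far (b : ℝ) (hb : ∀ n : ℤ, n ≠ 0 → b ≠ n) (k : ℤ) (hk : k = ⌊b⌋ + 1) :
    ∃ A : ℝ, 0 ≤ A ∧ ∀ ω ∈ St, ∀ y ∈ cBall ω (2 * (rh ω.2 / 16)), ∀ z ∈ St,
      z ∉ cBall ω (3 * (rh ω.2 / 16)) →
      ‖Gam k y z‖ ≤ A * (rexp (b * (ω.1 - z.1)) * rh z.2 / DD ω z ^ 3) ∧
      ‖Gam k y z - Gam k ω z‖ ≤ A * (rh ω.2 * (rexp (b * (ω.1 - z.1)) * rh z.2 / DD ω z ^ 3)) := by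
  obtain ⟨A, hA, hA2⟩ := gq_far b hb k hk 37 bn
  refine ⟨8 * rexp |b| * A, by positivity, ?_⟩
  intro ω hω y hy z hz hzb
  have hr := rh_pos hω
  have key : ∀ y ∈ cBall ω (2 * (rh ω.2 / 16)), ∃ Q', HasDerivAt (GQ k z.2) Q' (cx y - z.1) ∧
        max ‖GQ k z.2 (cx y - z.1)‖ ‖Q'‖ ≤ 8 * rexp |b| * A * (rexp (b * (ω.1 - z.1)) * rh z.2 / DD ω z ^ 3) := by
    intro y hy
    obtain ⟨hyS, y1, y2, y3, y4⟩ := ball_St hω (Metric.closedBall_subset_closedBall bl hy)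
    rw [Metric.mem_closedBall, dist_eq_norm] at hy
    rw [Metric.mem_closedBall, dist_comm, dist_eq_norm, not_le] at hzb
    have hyz : rh ω.2 / 16 < ‖y - z‖ := by
      have : ‖ω - z‖ ≤ ‖y - z‖ + ‖y - ω‖ := by
        have := norm_sub_le (y - z) (y - ω); simpa using this
      linarith
    have hyz2 : ‖y - z‖ ≤ |y.1 - z.1| + |y.2 - z.2| :=
      max_le (le_add_of_nonneg_right (abs_nonneg _)) (le_add_of_nonneg_left (abs_nonneg _))
    have hl := rh_lip z.2 y.2
    rw [abs_sub_comm] at hl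
    have hrz := rh_pos hz
    obtain ⟨Q', h1, h2⟩ := hA2 y z hyS hz (by
      unfold DD; linarith [rh_lip y.2 ω.2, abs_nonneg (y.1 - z.1), abs_nonneg (y.2 - z.2)])
    refine ⟨Q', h1, h2.trans ?_⟩
    have hD1 : DD ω z ≤ 2 * DD y z := by
      unfold DD
      have e1 := abs_sub_le ω.1 y.1 z.1
      rw [abs_sub_comm ω.1 y.1] at e1
      have e2 := rh_lip ω.2 y.2
      rw [abs_sub_comm] at e2
      linarith [abs_nonneg (y.1 - z.1)]
    have hDp := DD_pos hω hz
    have hDp2 := DD_pos hyS hz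
    have hE : rexp (b * (y.1 - z.1)) ≤ rexp |b| * rexp (b * (ω.1 - z.1)) := by
      rw [← exp_add, exp_le_exp]
      have : b * (y.1 - ω.1) ≤ |b| := by
        refine (le_abs_self _).trans ?_
        rw [abs_mul]
        refine mul_le_of_le_one_right (abs_nonneg _) ?_
        linarith [rh_le ω.2, pi_lt_d2]
      linarith
    calc A * (rexp (b * (y.1 - z.1)) * rh z.2 / DD y z ^ 3) ≤ A * (rexp |b| * rexp (b * (ω.1 - z.1)) * rh z.2 / (DD ω z / 2) ^ 3) := by
          gcongr; linarith
      _ = _ := by field_simp; norm_num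
  have hωb : ω ∈ cBall ω (2 * (rh ω.2 / 16)) := Metric.mem_closedBall_self bl
  simp only [Gam_GQ]
  obtain ⟨_, -, hy2⟩ := key y hy
  refine ⟨(le_max_left _ _).trans hy2, ?_⟩
  set r := 2 * (rh ω.2 / 16)
  let s : Set ℂ := Icc (ω.1 - z.1 - r) (ω.1 - z.1 + r) ×ℂ Icc (ω.2 - r) (ω.2 + r)
  have hs : Convex ℝ s :=
    ((convex_Icc _ _).linear_preimage Complex.reLm).inter ((convex_Icc _ _).linear_preimage Complex.imLm)
  have hsy : ∀ y : R2, y ∈ cBall ω r ↔ (cx y - z.1) ∈ s := by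
    intro y
    rw [Metric.mem_closedBall, dist_eq_norm]
    simp only [s, Complex.mem_reProdIm, Prod.norm_def, max_le_iff, Real.norm_eq_abs, abs_le, Prod.fst_sub, Prod.snd_sub, mem_Icc, cx_re, cx_im, Complex.sub_re, Complex.sub_im, Complex.ofReal_re, Complex.ofReal_im]
    constructor
    · rintro ⟨⟨_, _⟩, _, _⟩; refine ⟨⟨?_, ?_⟩, ?_, ?_⟩ <;> linarith
    · rintro ⟨⟨_, _⟩, _, _⟩; refine ⟨⟨?_, ?_⟩, ?_, ?_⟩ <;> linarith
  have hsX : ∀ X ∈ s, ∃ y, y ∈ cBall ω r ∧ X = cx y - z.1 := by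
    intro X hX
    have : X = cx (X.re + z.1, X.im) - z.1 := by apply Complex.ext <;> simp
    exact ⟨_, (hsy _).2 (by rw [← this]; exact hX), this⟩
  have hm := hs.norm_image_sub_le_of_norm_deriv_le (𝕜 := ℂ) (f := GQ k z.2) (C := 8 * rexp |b| * A * (rexp (b * (ω.1 - z.1)) * rh z.2 / DD ω z ^ 3))
    (x := cx ω - z.1) (y := cx y - z.1) (fun X hX => by
      obtain ⟨y, hy, rfl⟩ := hsX X hX
      obtain ⟨Q', h1, _⟩ := key y hy
      exact h1.differentiableAt) (fun X hX => by
      obtain ⟨y, hy, rfl⟩ := hsX X hX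
      obtain ⟨Q', h1, h2⟩ := key y hy
      rw [h1.deriv]; exact (le_max_right _ _).trans h2) ((hsy _).1 hωb) ((hsy _).1 hy)
  refine hm.trans ?_
  have hn : ‖cx y - z.1 - (cx ω - z.1)‖ ≤ rh ω.2 := by
    rw [sub_sub_sub_cancel_right]
    refine (Complex.norm_le_abs_re_add_abs_im _).trans ?_
    rw [Metric.mem_closedBall, dist_eq_norm] at hy
    have h1 : |y.1 - ω.1| ≤ ‖y - ω‖ := le_max_left _ _
    have h2 : |y.2 - ω.2| ≤ ‖y - ω‖ := le_max_right _ _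
    simp only [Complex.sub_re, Complex.sub_im, cx_re, cx_im]
    simp only [r] at hy
    linarith
  have := rh_pos hz
  have := DD_pos hω hz
  calc _ ≤ 8 * rexp |b| * A * (rexp (b * (ω.1 - z.1)) * rh z.2 / DD ω z ^ 3) * rh ω.2 := by gcongr
    _ = _ := by ring

lemma gam_near (k : ℤ) : ∃ A : ℝ, 0 ≤ A ∧ ∀ w ∈ St, ∀ z ∈ St, ‖w - z‖ ≤ 1 → ‖w - z‖ ≤ DD w z → w ≠ z →
    ‖Gam k w z‖ ≤ A * ‖w - z‖⁻¹ := by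
  refine ⟨10 * rexp |(k:ℝ)|, by positivity, ?_⟩
  intro w hw z hz h1 hD hne
  have hp : 0 < ‖w - z‖ := norm_pos_iff.2 (sub_ne_zero.2 hne)
  rw [Gam_GQ]
  have hyz2 : ‖w - z‖ ≤ |w.1 - z.1| + |w.2 - z.2| :=
      max_le (le_add_of_nonneg_right (abs_nonneg _)) (le_add_of_nonneg_left (abs_nonneg _))
  have hσ : |w.1 - z.1| ≤ 1 := (le_max_left _ _).trans h1
  have hk : ∀ ζ : ℂ, ζ.re = w.1 - z.1 → ‖w - z‖ / 5 ≤ ‖cE ζ - 1‖ → ‖kC k ζ‖ ≤ 5 * rexp |(k:ℝ)| * ‖w - z‖⁻¹ := by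
    intro ζ hζ h
    unfold kC
    rw [norm_div, Complex.norm_exp]
    have : ((k:ℂ) * ζ).re ≤ |(k:ℝ)| := by
      simp only [Complex.mul_re, Complex.intCast_re, Complex.intCast_im, zero_mul, sub_zero, hζ]
      refine (le_abs_self _).trans ?_
      rw [abs_mul]; exact mul_le_of_le_one_right (abs_nonneg _) hσ
    calc _ ≤ rexp |(k:ℝ)| / (‖w - z‖ / 5) := by gcongr
      _ = _ := by field_simp
  have a1 := hk ((cx w - z.1) - z.2 * cI) (by simp) (by
    refine le_trans ?_ (low1 w z hw hz)
    have := le_max_left 1 (rexp (w.1 - z.1))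
    calc _ = 1 / 5 * 1 * ‖w - z‖ := by ring
      _ ≤ _ := by gcongr; exact le_min h1 hyz2)
  have a2 := hk ((cx w - z.1) + z.2 * cI) (by simp) (by
    refine le_trans ?_ (low2 w z hw hz)
    have := le_max_left 1 (rexp (w.1 - z.1))
    calc _ = 1 / 5 * 1 * ‖w - z‖ := by ring
      _ ≤ _ := by gcongr; exact le_min h1 hD)
  unfold GQ
  rw [norm_div]
  have h2π : 1 ≤ ‖(2 * π : ℂ)‖ := by
    simp [abs_of_pos pi_pos]; linarith [pi_gt_three]
  refine (div_le_self (norm_nonneg _) h2π).trans ((norm_sub_le _ _).trans ?_)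
  linarith

lemma vol_cb (ω : R2) (r : ℝ) : volume (cBall ω r) = oR (2 * r) * oR (2 * r) := by
  rw [show ω = (ω.1, ω.2) from rfl, ← closedBall_prod_same, Measure.volume_eq_prod, Measure.prod_prod, Real.volume_closedBall, Real.volume_closedBall]

lemma near_Lp (p : ℝ) (hp : 1 < p) (g : R2 → ℝ≥0∞) (hg : Measurable g) (ω : R2) (r : ℝ) (hr : 0 ≤ r) :
    ∫⁻ w in cBall ω (2 * r), (∫⁻ z in cBall ω (3 * r), oR (‖w - z‖⁻¹) * g z) ^ p ≤
      oR (80 * r) ^ p * ∫⁻ z in cBall ω (3 * r), g z ^ p := by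
  have mker : Measurable (fun q : (R2) × (R2) => oR (‖q.1 - q.2‖⁻¹)) := by fun_prop
  have mk1 : ∀ w : R2, Measurable (fun z => oR (‖w - z‖⁻¹)) := fun w => by fun_prop
  have hb : ∀ w ∈ cBall ω (2 * r), ∫⁻ z in cBall ω (3 * r), oR (‖w - z‖⁻¹) ≤ oR (80 * r) := by
    intro w hw
    have hs : cBall ω (3 * r) ⊆ cBall w (5 * r) := by
      apply Metric.closedBall_subset_closedBall'
      rw [dist_comm]; rw [Metric.mem_closedBall] at hw; linarith
    refine (lintegral_mono_set hs).trans ((near_lint w (5 * r) bl).trans (le_of_eq ?_))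
    congr 1; ring
  have hb2 : ∀ z ∈ cBall ω (3 * r), ∫⁻ w in cBall ω (2 * r), oR (‖w - z‖⁻¹) ≤ oR (80 * r) := by
    intro z hz
    have hs : cBall ω (2 * r) ⊆ cBall z (5 * r) := by
      apply Metric.closedBall_subset_closedBall'
      rw [dist_comm]; rw [Metric.mem_closedBall] at hz; linarith
    simp_rw [norm_sub_rev _ z]
    refine (lintegral_mono_set hs).trans ((near_lint z (5 * r) bl).trans (le_of_eq ?_))
    congr 1; ring
  calc _ ≤ ∫⁻ w in cBall ω (2 * r), oR (80 * r) ^ (p - 1) * ∫⁻ z in cBall ω (3 * r), oR (‖w - z‖⁻¹) * g z ^ p := by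
        refine setLIntegral_mono' Metric.isClosed_closedBall.measurableSet fun w hw => ?_
        have h := lint_jensen ((volume.restrict (cBall ω (3 * r))).withDensity (fun z => oR (‖w - z‖⁻¹))) g hg.aemeasurable p hp
        rw [lintegral_withDensity_eq_lintegral_mul _ (mk1 w) hg, lintegral_withDensity_eq_lintegral_mul _ (mk1 w) (hg.pow_const p), withDensity_apply _ MeasurableSet.univ,
          Measure.restrict_univ] at h
        refine h.trans ?_
        exact mul_le_mul' (ENNReal.rpow_le_rpow (hb w hw) bl) le_rfl
    _ = oR (80 * r) ^ (p - 1) * ∫⁻ z in cBall ω (3 * r), (∫⁻ w in cBall ω (2 * r), oR (‖w - z‖⁻¹)) * g z ^ p := by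
        rw [lintegral_const_mul, lintegral_lintegral_swap]
        · congr 1
          refine lintegral_congr fun z => ?_
          rw [lintegral_mul_const]; fun_prop
        · exact (mker.mul ((hg.pow_const p).comp measurable_snd)).aemeasurable
        · exact (mker.mul ((hg.pow_const p).comp measurable_snd)).lintegral_prod_right'
    _ ≤ oR (80 * r) ^ (p - 1) * ∫⁻ z in cBall ω (3 * r), oR (80 * r) * g z ^ p := by
        gcongr _ * ?_
        refine setLIntegral_mono' Metric.isClosed_closedBall.measurableSet fun z hz => ?_
        gcongr; exact hb2 z hz
    _ = _ := by
        rw [lintegral_const_mul _ (hg.pow_const p), ← mul_assoc]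
        congr 1
        rcases eq_or_ne (oR (80 * r)) 0 with h | h
        · rw [h, mul_zero, ENNReal.zero_rpow_of_pos bl]
        · nth_rewrite 2 [← ENNReal.rpow_one (oR (80 * r))]
          rw [← ENNReal.rpow_add _ _ h ENNReal.ofReal_ne_top]; simp

def RR (b : ℝ) (g : R2 → ℝ≥0∞) (ω : R2) : ℝ≥0∞ :=
  ∫⁻ z in St, oR (rexp (-b * z.1) * rh z.2 / DD ω z ^ 3) * g z

lemma loc1 (b : ℝ) (hb : ∀ n : ℤ, n ≠ 0 → b ≠ n) (p : ℝ) (hp : 1 < p) :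
    ∃ C : ℝ≥0∞, C ≠ ⊤ ∧ ∀ v : R2 → ℂ, ContDiff ℝ 3 v → (∃ M : ℝ, 0 < M ∧ ∀ z : R2, M < |z.1| → v z = 0) →
      (∀ s, v (s, 0) = 0) → (∀ s, v (s, π) = 0) → ∀ ω ∈ St, ∀ r, r = rh ω.2 / 16 →
      ∃ c0 : ℂ, ‖c0‖ₑ ≤ C * (oR (rexp (b * ω.1)) * RR b (fun z => ‖Db (Dd v) z‖ₑ) ω) ∧
        ∫⁻ w in cBall ω (2 * r), ‖Dd v w - c0‖ₑ ^ p ≤ C * (oR r ^ p *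
          ((∫⁻ w in cBall ω (3 * r), ‖Db (Dd v) w‖ₑ ^ p) +
            oR r ^ 2 * (oR (rexp (b * ω.1)) * RR b (fun z => ‖Db (Dd v) z‖ₑ) ω) ^ p)) := by
  obtain ⟨A, hA, hfar⟩ := gam_far b hb _ rfl
  obtain ⟨A', hA', hnear⟩ := gam_near (⌊b⌋ + 1)
  set k := ⌊b⌋ + 1
  let a := oR (max A A')
  have ha : a ≠ ⊤ := ENNReal.ofReal_ne_top
  have h2 : (2 : ℝ≥0∞) ^ (p - 1) ≠ ⊤ := ENNReal.rpow_ne_top_of_nonneg bl bn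
  have hap : a ^ p ≠ ⊤ := ENNReal.rpow_ne_top_of_nonneg bl ha
  have h80 : (80 : ℝ≥0∞) ^ p ≠ ⊤ := ENNReal.rpow_ne_top_of_nonneg bl bn
  have h16 : (16 : ℝ≥0∞) ^ p * 16 ≠ ⊤ := ENNReal.mul_ne_top (ENNReal.rpow_ne_top_of_nonneg bl bn) bn
  refine ⟨a + 2 ^ (p - 1) * a ^ p * (80 ^ p + 16 ^ p * 16), ?_, ?_⟩
  · exact ENNReal.add_ne_top.2 ⟨ha, ENNReal.mul_ne_top (ENNReal.mul_ne_top h2 hap) (ENNReal.add_ne_top.2 ⟨h80, h16⟩)⟩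
  rintro v hv ⟨M, hM, h0⟩ hb0 hbπ ω hω r rfl
  set r := rh ω.2 / 16 with hrdef
  have hrp : 0 < r := by have := rh_pos hω; positivity
  have hv2 : ContDiff ℝ 2 v := hv.of_le bn
  set g := Db (Dd v) with hg
  have hgc : Continuous g := by
    have h1 : ContDiff ℝ 2 (Dd v) := Dd_cd (by norm_num; exact hv)
    have h2 : ContDiff ℝ 1 g := Db_cd (by norm_num; exact h1)
    exact h2.continuous
  set G : R2 → ℝ≥0∞ := fun z => ‖g z‖ₑ with hG
  have hGm : Measurable G := hgc.enorm.measurable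
  set E := oR (rexp (b * ω.1)) * RR b G ω with hE
  have hB3 : ∀ y ∈ cBall ω (3 * r), y ∈ St := fun y hy => (ball_St hω hy).1
  have hB23 : cBall ω (2 * r) ⊆ cBall ω (3 * r) := Metric.closedBall_subset_closedBall bl
  have mB : ∀ R, MeasurableSet (cBall ω R) := fun R => Metric.isClosed_closedBall.measurableSet
  have hrep := fun w hw => rep k v hv2 M hM h0 hb0 hbπ w hw
  have hωb : ω ∈ cBall ω (2 * r) := Metric.mem_closedBall_self bl
  have hker : ∀ z ∈ St, oR (rexp (b * (ω.1 - z.1)) * rh z.2 / DD ω z ^ 3) = oR (rexp (b * ω.1)) * oR (rexp (-b * z.1) * rh z.2 / DD ω z ^ 3) := by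
    intro z _
    rw [← ENNReal.ofReal_mul (exp_pos _).le]
    congr 1
    rw [mul_div_assoc, mul_div_assoc, ← mul_assoc, ← exp_add]; ring_nf
  have hRR : ∫⁻ z in St \ cBall ω (3 * r), oR (rexp (b * (ω.1 - z.1)) * rh z.2 / DD ω z ^ 3) * G z ≤ E := by
    refine (lintegral_mono_set sdiff_subset).trans (le_of_eq ?_)
    rw [hE, RR, ← lintegral_const_mul' _ _ ENNReal.ofReal_ne_top]
    refine setLIntegral_congr_fun St_meas fun z hz => ?_
    simp only [hker z hz, mul_assoc]
  refine ⟨∫ z in St \ cBall ω (3 * r), Gam k ω z * g z, ?_, ?_⟩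
  · refine (enorm_integral_le_lintegral_enorm _).trans ?_
    calc _ ≤ ∫⁻ z in St \ cBall ω (3 * r), a * (oR (rexp (b * (ω.1 - z.1)) * rh z.2 / DD ω z ^ 3) * G z) := by
          refine setLIntegral_mono' (St_meas.diff (mB _)) fun z hz => ?_
          rw [enorm_mul, ← mul_assoc]
          gcongr
          have h := (hfar ω hω ω hωb z hz.1 hz.2).1
          rw [← ofReal_norm, ← ENNReal.ofReal_mul (le_max_of_le_left hA)]
          apply ENNReal.ofReal_le_ofReal
          refine h.trans ?_
          have := rh_pos hz.1; have := DD_pos hω hz.1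
          gcongr; exact le_max_left _ _
      _ ≤ a * E := by rw [lintegral_const_mul' _ _ ha]; gcongr
      _ ≤ _ := by gcongr; exact le_self_add
  · have hpt : ∀ w ∈ cBall ω (2 * r), ‖Dd v w - ∫ z in St \ cBall ω (3 * r), Gam k ω z * g z‖ₑ ≤
        a * (∫⁻ z in cBall ω (3 * r), oR (‖w - z‖⁻¹) * G z) + a * (16 * oR r * E) := by
      intro w hw
      obtain ⟨hwS, w1, w2, w3, w4⟩ := ball_St hω (hB23 hw)
      obtain ⟨hi, hr⟩ := hrep w hwS
      obtain ⟨hiω, -⟩ := hrep ω hω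
      have hSt : St = cBall ω (3 * r) ∪ (St \ cBall ω (3 * r)) := by
        rw [union_sdiff_self, union_eq_self_of_subset_left hB3]
      have e1 : Dd v w - ∫ z in St \ cBall ω (3 * r), Gam k ω z * g z =
          (∫ z in cBall ω (3 * r), Gam k w z * g z) + ∫ z in St \ cBall ω (3 * r), (Gam k w z - Gam k ω z) * g z := by
        have : (∫ z in St, Gam k w z * g z) = (∫ z in cBall ω (3 * r), Gam k w z * g z) + ∫ z in St \ cBall ω (3 * r), Gam k w z * g z := by
          conv_lhs => rw [hSt]
          exact setIntegral_union disjoint_sdiff_right (St_meas.diff (mB _)) (hi.mono_set hB3) (hi.mono_set sdiff_subset)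
        rw [hr, this, add_sub_assoc, ← integral_sub (hi.mono_set sdiff_subset) (hiω.mono_set sdiff_subset)]
        simp only [sub_mul]; rfl
      rw [e1]
      refine (enorm_add_le _ _).trans (add_le_add ?_ ?_)
      · refine (enorm_integral_le_lintegral_enorm _).trans ?_
        rw [← lintegral_const_mul' _ _ ha]
        refine lintegral_mono_ae ?_
        have hne : ∀ᵐ z ∂(volume.restrict (cBall ω (3 * r))), z ≠ w :=
          ae_restrict_of_ae (compl_mem_ae_iff.2 (measure_singleton w))
        filter_upwards [hne, ae_restrict_mem (mB _)] with z hz hzb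
        obtain ⟨hzS, z1, z2, z3, z4⟩ := ball_St hω hzb
        rw [enorm_mul, ← mul_assoc]
        gcongr
        rw [← ofReal_norm, ← ENNReal.ofReal_mul (le_max_of_le_left hA)]
        apply ENNReal.ofReal_le_ofReal
        have hwz : ‖w - z‖ ≤ 5 * r := by
          rw [← dist_eq_norm]; rw [Metric.mem_closedBall] at hw hzb
          linarith [dist_triangle_right w z ω]
        have hr1 : 5 * r ≤ 1 := by simp only [hrdef]; linarith [rh_le ω.2, pi_lt_d2]
        refine (hnear w hwS z hzS bl (by unfold DD; linarith [abs_nonneg (w.1 - z.1)]) (Ne.symm hz)).trans ?_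
        gcongr; exact le_max_right _ _
      · refine (enorm_integral_le_lintegral_enorm _).trans ?_
        calc _ ≤ ∫⁻ z in St \ cBall ω (3 * r), (a * (16 * oR r)) * (oR (rexp (b * (ω.1 - z.1)) * rh z.2 / DD ω z ^ 3) * G z) := by
              refine setLIntegral_mono' (St_meas.diff (mB _)) fun z hz => ?_
              rw [enorm_mul, ← mul_assoc]
              gcongr
              have h := (hfar ω hω w hw z hz.1 hz.2).2
              have e16 : 16 * oR r = oR (rh ω.2) := by
                rw [show (16:ℝ≥0∞) = oR 16 by norm_num, ← ENNReal.ofReal_mul bn]; congr 1; simp only [hrdef]; ring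
              rw [e16, ← ofReal_norm, ← ENNReal.ofReal_mul (le_max_of_le_left hA), ← ENNReal.ofReal_mul (mul_nonneg (le_max_of_le_left hA) (rh_pos hω).le)]
              apply ENNReal.ofReal_le_ofReal
              refine h.trans ?_
              have := rh_pos hz.1; have := DD_pos hω hz.1; have := rh_pos hω
              rw [mul_assoc (max A A')]
              gcongr; exact le_max_left _ _
          _ ≤ (a * (16 * oR r)) * E := by
              rw [lintegral_const_mul' _ _ (ENNReal.mul_ne_top ha (ENNReal.mul_ne_top bn ENNReal.ofReal_ne_top))]; gcongr
          _ = _ := by ring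
    have hp0 : 0 ≤ p := by linarith
    calc _ ≤ ∫⁻ w in cBall ω (2 * r), 2 ^ (p - 1) * a ^ p * ((∫⁻ z in cBall ω (3 * r), oR (‖w - z‖⁻¹) * G z) ^ p + (16 * oR r * E) ^ p) := by
          refine setLIntegral_mono' (mB _) fun w hw => ?_
          refine (ENNReal.rpow_le_rpow (hpt w hw) hp0).trans ((ENNReal.rpow_add_le_mul_rpow_add_rpow _ _ hp.le).trans (le_of_eq ?_))
          rw [ENNReal.mul_rpow_of_nonneg _ _ hp0, ENNReal.mul_rpow_of_nonneg a _ hp0]; ring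
      _ = 2 ^ (p - 1) * a ^ p * ((∫⁻ w in cBall ω (2 * r), (∫⁻ z in cBall ω (3 * r), oR (‖w - z‖⁻¹) * G z) ^ p) + (16 * oR r * E) ^ p * volume (cBall ω (2 * r))) := by
          rw [lintegral_const_mul' _ _ (ENNReal.mul_ne_top h2 hap), lintegral_add_right _ measurable_const, setLIntegral_const]
      _ ≤ 2 ^ (p - 1) * a ^ p * (oR (80 * r) ^ p * (∫⁻ z in cBall ω (3 * r), G z ^ p) + (16 * oR r * E) ^ p * (16 * oR r ^ 2)) := by
          gcongr
          · exact near_Lp p hp G hGm ω r hrp.le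
          · rw [vol_cb, ← ENNReal.ofReal_mul bp, show 2 * (2 * r) * (2 * (2 * r)) = 16 * r ^ 2 by ring, ENNReal.ofReal_mul bn, ENNReal.ofReal_pow hrp.le]
            norm_num
      _ = 2 ^ (p - 1) * a ^ p * (80 ^ p * (oR r ^ p * ∫⁻ z in cBall ω (3 * r), G z ^ p) + (16 ^ p * 16) * (oR r ^ p * (oR r ^ 2 * E ^ p))) := by
          rw [ENNReal.ofReal_mul bn, ENNReal.mul_rpow_of_nonneg _ _ hp0, ENNReal.mul_rpow_of_nonneg _ _ hp0, ENNReal.mul_rpow_of_nonneg _ _ hp0,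
            show oR 80 = 80 by norm_num]
          ring
      _ ≤ 2 ^ (p - 1) * a ^ p * ((80 ^ p + 16 ^ p * 16) * (oR r ^ p * ∫⁻ z in cBall ω (3 * r), G z ^ p) + (80 ^ p + 16 ^ p * 16) * (oR r ^ p * (oR r ^ 2 * E ^ p))) := by
          gcongr
          · exact le_self_add
          · exact le_add_self
      _ = 2 ^ (p - 1) * a ^ p * (80 ^ p + 16 ^ p * 16) * (oR r ^ p * ((∫⁻ z in cBall ω (3 * r), G z ^ p) + oR r ^ 2 * E ^ p)) := by ring
      _ ≤ _ := by gcongr; exact le_add_self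

lemma cutoff : ∃ K : ℝ, 0 ≤ K ∧ ∀ (ω : R2) (r : ℝ), 0 < r → ∃ η : R2 → ℂ, ContDiff ℝ 2 η ∧
    (∀ z ∈ Metric.ball ω (3/2 * r), η z = 1) ∧ tsupport η ⊆ cBall ω (2 * r) ∧ HasCompactSupport η ∧ (∀ z, ‖η z‖ ≤ 1) ∧
    ∀ z, ‖Db η z‖ ≤ K / r := by
  let χ : ContDiffBump (0 : R2) := ⟨3/2, 2, by norm_num, by norm_num⟩
  let χc : R2 → ℂ := fun z => (χ z : ℂ)
  have hχ : ContDiff ℝ 2 χc := Complex.ofRealCLM.contDiff.comp (χ.contDiff)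
  have hχs : HasCompactSupport χc := χ.hasCompactSupport.comp_left (g := fun x : ℝ => (x : ℂ)) (by simp)
  obtain ⟨K, hK⟩ := (hχs.fderiv ℝ).exists_bound_of_continuous (hχ.continuous_fderiv bn)
  have hK0 : 0 ≤ K := (norm_nonneg _).trans (hK 0)
  refine ⟨2 * K, by linarith, fun ω r hr => ?_⟩
  let η : R2 → ℂ := fun z => χc (r⁻¹ • (z - ω))
  have hη : ContDiff ℝ 2 η := hχ.comp (by fun_prop)
  have hn : ∀ z : R2, ‖r⁻¹ • (z - ω)‖ = ‖z - ω‖ / r := by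
    intro z; rw [norm_smul, norm_inv, Real.norm_of_nonneg hr.le]; ring
  have hts : tsupport η ⊆ cBall ω (2 * r) := by
    refine closure_minimal ?_ Metric.isClosed_closedBall
    intro z hz
    by_contra h
    apply hz
    rw [Metric.mem_closedBall, dist_eq_norm, not_le] at h
    have : χ (r⁻¹ • (z - ω)) = 0 := χ.zero_of_le_dist (by rw [dist_zero_right, hn, le_div_iff₀ hr]; exact h.le)
    simp [η, χc, this]
  refine ⟨η, hη, ?_, hts, HasCompactSupport.of_support_subset_isCompact (isCompact_closedBall _ _) (subset_closure.trans hts), ?_, ?_⟩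
  · intro z hz
    have : χ (r⁻¹ • (z - ω)) = 1 := χ.one_of_mem_closedBall (by
      rw [mem_closedBall_zero_iff, hn, div_le_iff₀ hr]; rw [Metric.mem_ball, dist_eq_norm] at hz; exact hz.le)
    simp [η, χc, this]
  · intro z
    simp only [η, χc, Complex.norm_real, Real.norm_of_nonneg χ.nonneg]
    exact χ.le_one
  · intro z
    have h1 : HasFDerivAt η _ z := ((hχ.differentiable bn _).hasFDerivAt).comp z (((hasFDerivAt_id z).sub_const ω).const_smul r⁻¹)
    have hb : ‖fderiv ℝ η z‖ ≤ K / r := by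
      rw [h1.fderiv]
      refine (ContinuousLinearMap.opNorm_comp_le _ _).trans ?_
      have : ‖r⁻¹ • ContinuousLinearMap.id ℝ (R2)‖ ≤ r⁻¹ := by
        rw [norm_smul, norm_inv, Real.norm_of_nonneg hr.le]
        exact mul_le_of_le_one_right bp ContinuousLinearMap.norm_id_le
      rw [div_eq_mul_inv]
      exact mul_le_mul (hK _) this (norm_nonneg _) hK0
    unfold Db dS dT
    refine (norm_add_le _ _).trans ?_
    rw [norm_mul, Complex.norm_I, one_mul]
    have e1 : ‖fderiv ℝ η z (1, 0)‖ ≤ K / r := by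
      refine (ContinuousLinearMap.le_opNorm _ _).trans ?_
      rw [Prod.norm_def]; simpa using hb
    have e2 : ‖fderiv ℝ η z (0, 1)‖ ≤ K / r := by
      refine (ContinuousLinearMap.le_opNorm _ _).trans ?_
      rw [Prod.norm_def]; simpa using hb
    rw [mul_div_assoc]; linarith

lemma Db_mul {a b : R2 → ℂ} {z : R2} (ha : DifferentiableAt ℝ a z) (hb : DifferentiableAt ℝ b z) :
    Db (fun z => a z * b z) z = a z * Db b z + Db a z * b z := by
  have h2 := (ha.hasFDerivAt.mul hb.hasFDerivAt).fderiv
  simp only [Db, dS, dT]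
  change fderiv ℝ (fun z => a z * b z) z = _ at h2
  rw [h2]
  simp; ring

lemma loc2 (b : ℝ) (hb : ∀ n : ℤ, n ≠ 0 → b ≠ n) (p : ℝ) (hp : 1 < p) :
    ∃ C : ℝ≥0∞, C ≠ ⊤ ∧ ∀ v : R2 → ℂ, ContDiff ℝ 3 v → (∃ M : ℝ, 0 < M ∧ ∀ z : R2, M < |z.1| → v z = 0) →
      (∀ s, v (s, 0) = 0) → (∀ s, v (s, π) = 0) → ∀ ω ∈ St, ∀ r, r = rh ω.2 / 16 →
        ∫⁻ w in cBall ω r, (‖Dd (Dd v) w‖ₑ ^ p + ‖Dd v w‖ₑ ^ p) ≤ C *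
          ((∫⁻ w in cBall ω (3 * r), ‖Db (Dd v) w‖ₑ ^ p) +
            oR r ^ 2 * (oR (rexp (b * ω.1)) * RR b (fun z => ‖Db (Dd v) z‖ₑ) ω) ^ p) := by
  obtain ⟨C1, hC1, h1⟩ := loc1 b hb p hp
  obtain ⟨C2, hC2, hB⟩ := beurling p hp
  obtain ⟨K, hK, hcut⟩ := cutoff
  have hp0 : 0 ≤ p := by linarith
  have h2 : (2 : ℝ≥0∞) ^ (p - 1) ≠ ⊤ := ENNReal.rpow_ne_top_of_nonneg bl bn
  have hKp : oR K ^ p * C1 ≠ ⊤ := ENNReal.mul_ne_top (ENNReal.rpow_ne_top_of_nonneg hp0 ENNReal.ofReal_ne_top) hC1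
  have hCp : C1 + 16 * C1 ^ p ≠ ⊤ := ENNReal.add_ne_top.2 ⟨hC1, ENNReal.mul_ne_top bn (ENNReal.rpow_ne_top_of_nonneg hp0 hC1)⟩
  refine ⟨C2 * (2 ^ (p - 1) * (1 + oR K ^ p * C1)) + 2 ^ (p - 1) * (C1 + 16 * C1 ^ p), ?_, ?_⟩
  · exact ENNReal.add_ne_top.2 ⟨ENNReal.mul_ne_top hC2 (ENNReal.mul_ne_top h2 (ENNReal.add_ne_top.2 ⟨by norm_num, hKp⟩)), ENNReal.mul_ne_top h2 hCp⟩
  intro v hv hM hb0 hbπ ω hω r hr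
  obtain ⟨c0, hc0, hh⟩ := h1 v hv hM hb0 hbπ ω hω r hr
  have hrp : 0 < r := by have := rh_pos hω; rw [hr]; positivity
  have hr1 : r ≤ 1 / 8 := by rw [hr]; linarith [rh_le ω.2, pi_lt_d2]
  obtain ⟨η, hη, hη1, hηs, hηc, hηn, hηD⟩ := hcut ω r hrp
  have hf : ContDiff ℝ 2 (Dd v) := Dd_cd (by norm_num; exact hv)
  have hgc : Continuous (Db (Dd v)) := Db_cont (hf.of_le bn)
  have hDc : Continuous (Dd (Dd v)) := (Dd_cd (n := 1) (by norm_num; exact hf)).continuous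
  set f := Dd v with hfdef
  set E := oR (rexp (b * ω.1)) * RR b (fun z => ‖Db f z‖ₑ) ω
  set I := ∫⁻ w in cBall ω (3 * r), ‖Db f w‖ₑ ^ p
  set J := oR r ^ 2 * E ^ p
  have mB : ∀ R, MeasurableSet (cBall ω R) := fun R => Metric.isClosed_closedBall.measurableSet
  have hB12 : cBall ω r ⊆ cBall ω (2 * r) := Metric.closedBall_subset_closedBall bl
  have hB23 : cBall ω (2 * r) ⊆ cBall ω (3 * r) := Metric.closedBall_subset_closedBall bl
  let h : R2 → ℂ := fun z => η z * (f z - c0)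
  have hfc : ContDiff ℝ 2 (fun z => f z - c0) := hf.sub contDiff_const
  have hhc : ContDiff ℝ 1 h := (hη.mul hfc).of_le bn
  have hhs : tsupport h ⊆ tsupport η := tsupport_mul_subset_left
  have hfd : ∀ z, fderiv ℝ (fun z => f z - c0) z = fderiv ℝ f z := fun z => fderiv_sub_const _
  have hDb : ∀ z, Db h z = η z * Db f z + Db η z * (f z - c0) := by
    intro z
    rw [Db_mul (hη.differentiable bn z) (hfc.differentiable bn z)]
    congr 2
    simp only [Db, dS, dT, hfd]
  have hbe := hB (ω.1 - 1/2) (ω.2 - 1/2) h hhc (hηc.mul_right) (hhs.trans (hηs.trans (by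
    intro z hz
    rw [Metric.mem_closedBall, dist_eq_norm] at hz
    have h1 : |z.1 - ω.1| ≤ ‖z - ω‖ := le_max_left _ _
    have h2 : |z.2 - ω.2| ≤ ‖z - ω‖ := le_max_right _ _
    have h1 := abs_le.1 (h1.trans hz)
    have h2 := abs_le.1 (h2.trans hz)
    refine ⟨⟨?_, ?_⟩, ?_, ?_⟩ <;> linarith)))
  have hleft : ∫⁻ w in cBall ω r, ‖Dd f w‖ₑ ^ p ≤ ∫⁻ z, ‖Dd h z‖ₑ ^ p := by
    refine le_trans ?_ (setLIntegral_le_lintegral (cBall ω r) _)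
    refine setLIntegral_mono' (mB _) fun w hw => ?_
    have hev : h =ᶠ[nhds w] fun z => f z - c0 := by
      filter_upwards [Metric.isOpen_ball.mem_nhds (show w ∈ Metric.ball ω (3/2 * r) from by
        rw [Metric.mem_ball]; rw [Metric.mem_closedBall] at hw; linarith)] with z hz
      simp only [h, hη1 z hz, one_mul]
    have : Dd h w = Dd f w := by
      simp only [Dd, dS, dT, hev.fderiv_eq, hfd]
    rw [this]
  have hright : ∫⁻ z, ‖Db h z‖ₑ ^ p ≤ 2 ^ (p - 1) * (1 + oR K ^ p * C1) * (I + J) := by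
    have e1 : ∫⁻ z, ‖Db h z‖ₑ ^ p = ∫⁻ z in cBall ω (2 * r), ‖Db h z‖ₑ ^ p := by
      rw [← lintegral_indicator (mB _)]
      refine lintegral_congr fun z => ?_
      by_cases hz : z ∈ cBall ω (2 * r)
      · rw [indicator_of_mem hz]
      · rw [indicator_of_notMem hz]
        have h0 : h =ᶠ[nhds z] 0 := notMem_tsupport_iff_eventuallyEq.1 (fun hh => hz (hηs (hhs hh)))
        have : Db h z = 0 := by simp only [Db, dS, dT, h0.fderiv_eq]; simp
        rw [this, enorm_zero, ENNReal.zero_rpow_of_pos bl]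
    rw [e1]
    have hKr : oR (K / r) ^ p * oR r ^ p = oR K ^ p := by
      rw [← ENNReal.mul_rpow_of_nonneg _ _ hp0, ← ENNReal.ofReal_mul bp]
      congr 2; field_simp
    calc _ ≤ ∫⁻ z in cBall ω (2 * r), 2 ^ (p - 1) * (‖Db f z‖ₑ ^ p + oR (K / r) ^ p * ‖f z - c0‖ₑ ^ p) := by
          refine setLIntegral_mono' (mB _) fun z hz => ?_
          have hle : ‖Db h z‖ₑ ≤ ‖Db f z‖ₑ + oR (K / r) * ‖f z - c0‖ₑ := by
            rw [hDb]
            refine (enorm_add_le _ _).trans ?_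
            rw [enorm_mul, enorm_mul]
            gcongr
            · have : ‖η z‖ₑ ≤ 1 := by rw [← ofReal_norm]; exact ENNReal.ofReal_le_one.2 (hηn z)
              exact mul_le_of_le_one_left' this
            · rw [← ofReal_norm]; exact ENNReal.ofReal_le_ofReal (hηD z)
          refine (ENNReal.rpow_le_rpow hle hp0).trans ((ENNReal.rpow_add_le_mul_rpow_add_rpow _ _ hp.le).trans (le_of_eq ?_))
          rw [ENNReal.mul_rpow_of_nonneg _ _ hp0]
      _ = 2 ^ (p - 1) * ((∫⁻ z in cBall ω (2 * r), ‖Db f z‖ₑ ^ p) + oR (K / r) ^ p * ∫⁻ z in cBall ω (2 * r), ‖f z - c0‖ₑ ^ p) := by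
          rw [lintegral_const_mul' _ _ h2, lintegral_add_left (hgc.enorm.measurable.pow_const p), lintegral_const_mul' _ _ (ENNReal.rpow_ne_top_of_nonneg hp0 ENNReal.ofReal_ne_top)]
      _ ≤ 2 ^ (p - 1) * (I + oR (K / r) ^ p * (C1 * (oR r ^ p * (I + J)))) := by
          gcongr
          exact lintegral_mono_set hB23
      _ = 2 ^ (p - 1) * (I + (oR (K / r) ^ p * oR r ^ p) * C1 * (I + J)) := by ring
      _ ≤ 2 ^ (p - 1) * ((I + J) + oR K ^ p * C1 * (I + J)) := by rw [hKr]; gcongr; exact le_self_add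
      _ = _ := by ring
  have hsec : ∫⁻ w in cBall ω r, ‖f w‖ₑ ^ p ≤ 2 ^ (p - 1) * (C1 + 16 * C1 ^ p) * (I + J) := by
    have hro : oR r ^ p ≤ 1 := by
      rw [← ENNReal.one_rpow p]; exact ENNReal.rpow_le_rpow (ENNReal.ofReal_le_one.2 bl) hp0
    calc _ ≤ ∫⁻ w in cBall ω (2 * r), ‖f w‖ₑ ^ p := lintegral_mono_set hB12
      _ ≤ ∫⁻ w in cBall ω (2 * r), 2 ^ (p - 1) * (‖f w - c0‖ₑ ^ p + ‖c0‖ₑ ^ p) := by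
          refine lintegral_mono fun w => ?_
          have hle : ‖f w‖ₑ ≤ ‖f w - c0‖ₑ + ‖c0‖ₑ := by
            have := enorm_add_le (f w - c0) c0; simpa using this
          exact (ENNReal.rpow_le_rpow hle hp0).trans (ENNReal.rpow_add_le_mul_rpow_add_rpow _ _ hp.le)
      _ = 2 ^ (p - 1) * ((∫⁻ w in cBall ω (2 * r), ‖f w - c0‖ₑ ^ p) + ‖c0‖ₑ ^ p * volume (cBall ω (2 * r))) := by
          rw [lintegral_const_mul' _ _ h2, lintegral_add_right _ measurable_const, setLIntegral_const]
      _ ≤ 2 ^ (p - 1) * (C1 * (1 * (I + J)) + (C1 * E) ^ p * (16 * oR r ^ 2)) := by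
          gcongr
          · exact hh.trans (by gcongr)
          · rw [vol_cb, ← ENNReal.ofReal_mul bp, show 2 * (2 * r) * (2 * (2 * r)) = 16 * r ^ 2 by ring, ENNReal.ofReal_mul bn, ENNReal.ofReal_pow hrp.le]
            norm_num
      _ = 2 ^ (p - 1) * (C1 * (I + J) + 16 * C1 ^ p * J) := by
          rw [ENNReal.mul_rpow_of_nonneg _ _ hp0]; simp only [J]; ring
      _ ≤ 2 ^ (p - 1) * (C1 * (I + J) + 16 * C1 ^ p * (I + J)) := by gcongr; exact le_add_self
      _ = _ := by ring
  rw [lintegral_add_left (hDc.enorm.measurable.pow_const p)]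
  calc _ ≤ C2 * (2 ^ (p - 1) * (1 + oR K ^ p * C1) * (I + J)) + 2 ^ (p - 1) * (C1 + 16 * C1 ^ p) * (I + J) := by
        gcongr
        exact hleft.trans (hbe.trans (by gcongr))
    _ = _ := by ring

def Wr (b p γ : ℝ) (z : R2) : ℝ := rexp (-(b * p) * z.1) * rh z.2 ^ γ

lemma rh_cont : Continuous rh := by unfold rh; fun_prop
lemma rh_meas : Measurable rh := rh_cont.measurable
lemma Wr_meas (b p γ : ℝ) : Measurable (Wr b p γ) := by
  unfold Wr
  have := rh_meas
  fun_prop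

lemma rpow_comp (γ s t : ℝ) (ht : 0 < t) (h1 : t / 2 ≤ s) (h2 : s ≤ 2 * t) : s ^ γ ≤ 2 ^ |γ| * t ^ γ := by
  have hs : 0 < s := by linarith
  rcases le_total 0 γ with h | h
  · rw [abs_of_nonneg h, ← Real.mul_rpow bn ht.le]
    exact Real.rpow_le_rpow hs.le h2 h
  · rw [abs_of_nonpos h, ← div_le_iff₀' bp, div_eq_mul_inv, Real.rpow_neg bn, inv_inv, ← Real.mul_rpow hs.le bn]
    exact Real.rpow_le_rpow_of_nonpos ht bl h

lemma Wr_comp (b p γ : ℝ) (z w : R2) (hw : 0 < rh w.2) (h0 : |z.1 - w.1| ≤ 1) (h1 : rh w.2 / 2 ≤ rh z.2) (h2 : rh z.2 ≤ 2 * rh w.2) :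
    Wr b p γ z ≤ rexp |b * p| * 2 ^ |γ| * Wr b p γ w := by
  unfold Wr
  have e1 : rexp (-(b * p) * z.1) ≤ rexp |b * p| * rexp (-(b * p) * w.1) := by
    rw [← exp_add, exp_le_exp]
    have : -(b * p) * (z.1 - w.1) ≤ |b * p| := by
      refine (le_abs_self _).trans ?_
      rw [abs_mul, abs_neg]; exact mul_le_of_le_one_right (abs_nonneg _) h0
    linarith
  have hz : 0 < rh z.2 := by linarith
  calc _ ≤ (rexp |b * p| * rexp (-(b * p) * w.1)) * (2 ^ |γ| * rh w.2 ^ γ) := by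
        gcongr; exact rpow_comp _ _ _ hw h1 h2
    _ = _ := by ring

lemma ball_swap (j : ℝ) (m φ : R2 → ℝ≥0∞) (hm : Measurable m) (hφ : Measurable φ) :
    ∫⁻ ω in St, m ω * ∫⁻ w in cBall ω (j * (rh ω.2 / 16)), φ w =
      ∫⁻ w, φ w * ∫⁻ ω in St ∩ {ω | dist w ω ≤ j * (rh ω.2 / 16)}, m ω := by
  have hr := rh_cont
  have hS : MeasurableSet {q : (R2) × (R2) | dist q.2 q.1 ≤ j * (rh q.1.2 / 16)} :=
    (isClosed_le (by fun_prop) (by fun_prop)).measurableSet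
  let k : (R2) × (R2) → ℝ≥0∞ := indicator {q | dist q.2 q.1 ≤ j * (rh q.1.2 / 16)} 1
  have hk : Measurable k := measurable_one.indicator hS
  have e1 : ∀ ω, m ω * ∫⁻ w in cBall ω (j * (rh ω.2 / 16)), φ w = ∫⁻ w, m ω * (k (ω, w) * φ w) := by
    intro ω
    rw [← lintegral_indicator Metric.isClosed_closedBall.measurableSet, ← lintegral_const_mul _ (hφ.indicator Metric.isClosed_closedBall.measurableSet)]
    refine lintegral_congr fun w => ?_
    congr 1
    by_cases h : dist w ω ≤ j * (rh ω.2 / 16)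
    · rw [indicator_of_mem (by exact h)]; simp only [k]; rw [indicator_of_mem (by exact h)]; simp
    · rw [indicator_of_notMem (by exact h)]; simp only [k]; rw [indicator_of_notMem (by exact h)]; simp
  have e2 : ∀ w, φ w * ∫⁻ ω in St ∩ {ω | dist w ω ≤ j * (rh ω.2 / 16)}, m ω = ∫⁻ ω in St, m ω * (k (ω, w) * φ w) := by
    intro w
    have hS' : MeasurableSet {ω | dist w ω ≤ j * (rh ω.2 / 16)} := (isClosed_le (by fun_prop) (by fun_prop)).measurableSet
    rw [inter_comm, ← Measure.restrict_restrict hS', ← lintegral_indicator hS', ← lintegral_const_mul _ (hm.indicator hS')]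
    refine lintegral_congr fun ω => ?_
    by_cases h : dist w ω ≤ j * (rh ω.2 / 16)
    · rw [indicator_of_mem (by exact h)]; simp only [k]; rw [indicator_of_mem (by exact h)]; simp [mul_comm]
    · rw [indicator_of_notMem (by exact h)]; simp only [k]; rw [indicator_of_notMem (by exact h)]; simp
  simp_rw [e1, e2]
  rw [lintegral_lintegral_swap]
  exact ((hm.comp measurable_fst).mul (hk.mul (hφ.comp measurable_snd))).aemeasurable

def mW (b p γ : ℝ) (z : R2) : ℝ≥0∞ := oR (Wr b p γ z / rh z.2 ^ 2)

lemma mW_meas (b p γ : ℝ) : Measurable (mW b p γ) := by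
  have := rh_meas; have := Wr_meas b p γ; unfold mW; fun_prop

lemma Wr_nonneg (b p γ : ℝ) {z : R2} (hz : z ∈ St) : 0 ≤ Wr b p γ z := by
  have := rh_pos hz; unfold Wr; positivity

lemma ball_St' {w ω : R2} (hw : w ∈ St) (h : dist w ω ≤ rh w.2 / 4) : ω ∈ St ∧ |ω.1 - w.1| ≤ 1 ∧ rh w.2 * (3/4) ≤ rh ω.2 ∧ rh ω.2 ≤ rh w.2 * (5/4)
    ∧ |rh ω.2 - rh w.2| ≤ dist w ω := by
  rw [dist_comm, dist_eq_norm] at h ⊢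
  have h1 : |ω.1 - w.1| ≤ ‖ω - w‖ := le_max_left _ _
  have h2 : |ω.2 - w.2| ≤ ‖ω - w‖ := le_max_right _ _
  have h3 := rh_lip ω.2 w.2
  have h4 := rh_lip w.2 ω.2
  rw [abs_sub_comm] at h4
  have h5 := rh_pos hw
  have h6 := rh_le w.2
  refine ⟨⟨mem_univ _, ?_, ?_⟩, by linarith [pi_lt_d2], by linarith, by linarith, abs_le.2 ⟨by linarith, by linarith⟩⟩
  · linarith [min_le_left ω.2 (π - ω.2), show rh ω.2 = min ω.2 (π - ω.2) from rfl]
  · linarith [min_le_right ω.2 (π - ω.2), show rh ω.2 = min ω.2 (π - ω.2) from rfl]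

lemma inner_up (b p γ : ℝ) : ∃ C : ℝ≥0∞, C ≠ ⊤ ∧ ∀ w, (w ∉ St → ∫⁻ ω in St ∩ {ω | dist w ω ≤ 3 * (rh ω.2 / 16)}, mW b p γ ω = 0) ∧
    (w ∈ St → ∫⁻ ω in St ∩ {ω | dist w ω ≤ 3 * (rh ω.2 / 16)}, mW b p γ ω ≤ C * oR (Wr b p γ w)) := by
  refine ⟨oR (rexp |b * p| * 2 ^ |γ|), ENNReal.ofReal_ne_top, fun w => ⟨fun hw => ?_, fun hw => ?_⟩⟩
  · have : St ∩ {ω | dist w ω ≤ 3 * (rh ω.2 / 16)} = ∅ := by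
      refine eq_empty_of_forall_notMem fun ω hω => hw ?_
      exact (ball_St hω.1 hω.2).1
    rw [this]; simp
  · have hwp := rh_pos hw
    have hsub : St ∩ {ω | dist w ω ≤ 3 * (rh ω.2 / 16)} ⊆ cBall w (rh w.2 / 4) := by
      intro ω hω
      have h1 := (ball_St hω.1 hω.2).2.2.2.1
      have h2 : dist w ω ≤ 3 * (rh ω.2 / 16) := hω.2
      rw [Metric.mem_closedBall, dist_comm]; linarith
    refine (lintegral_mono_set hsub).trans ?_
    calc _ ≤ ∫⁻ ω in cBall w (rh w.2 / 4), oR (rexp |b * p| * 2 ^ |γ| * Wr b p γ w / (rh w.2 * (3/4)) ^ 2) := by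
          refine setLIntegral_mono' Metric.isClosed_closedBall.measurableSet fun ω hω => ?_
          rw [Metric.mem_closedBall, dist_comm] at hω
          obtain ⟨h1, h2, h3, h4, -⟩ := ball_St' hw hω
          apply ENNReal.ofReal_le_ofReal
          have := Wr_nonneg b p γ hw
          gcongr
          exact Wr_comp b p γ ω w hwp h2 bl bl
      _ ≤ _ := by
          have := Wr_nonneg b p γ hw
          rw [setLIntegral_const, vol_cb, ← ENNReal.ofReal_mul bp, ← ENNReal.ofReal_mul bp, ← ENNReal.ofReal_mul bp]
          apply ENNReal.ofReal_le_ofReal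
          have e : rexp |b * p| * 2 ^ |γ| * Wr b p γ w / (rh w.2 * (3/4)) ^ 2 * (2 * (rh w.2 / 4) * (2 * (rh w.2 / 4))) = (4 / 9) * (rexp |b * p| * 2 ^ |γ| * Wr b p γ w) := by
            field_simp; ring
          rw [e]
          have : 0 ≤ rexp |b * p| * 2 ^ |γ| * Wr b p γ w := by positivity
          linarith

lemma inner_low (b p γ : ℝ) : ∃ C : ℝ≥0∞, C ≠ ⊤ ∧ ∀ w ∈ St,
    oR (Wr b p γ w) ≤ C * ∫⁻ ω in St ∩ {ω | dist w ω ≤ 1 * (rh ω.2 / 16)}, mW b p γ ω := by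
  refine ⟨oR (512 * (rexp |b * p| * 2 ^ |γ|)), ENNReal.ofReal_ne_top, fun w hw => ?_⟩
  have hwp := rh_pos hw
  have hWn := Wr_nonneg b p γ hw
  have hsub : cBall w (rh w.2 / 32) ⊆ St ∩ {ω | dist w ω ≤ 1 * (rh ω.2 / 16)} := by
    intro ω hω
    rw [Metric.mem_closedBall, dist_comm] at hω
    obtain ⟨h1, h2, h3, h4, h5⟩ := ball_St' hw (hω.trans bl)
    refine ⟨h1, ?_⟩
    change dist w ω ≤ 1 * (rh ω.2 / 16)
    linarith
  refine le_trans ?_ (mul_le_mul' le_rfl (lintegral_mono_set hsub))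
  calc _ ≤ oR (512 * (rexp |b * p| * 2 ^ |γ|)) * ∫⁻ ω in cBall w (rh w.2 / 32), oR (Wr b p γ w / (rexp |b * p| * 2 ^ |γ|) / (rh w.2 * (5/4)) ^ 2) := by
        rw [setLIntegral_const, vol_cb, ← ENNReal.ofReal_mul bp, ← ENNReal.ofReal_mul bp, ← ENNReal.ofReal_mul bp]
        apply ENNReal.ofReal_le_ofReal
        have e : 512 * (rexp |b * p| * 2 ^ |γ|) * (Wr b p γ w / (rexp |b * p| * 2 ^ |γ|) / (rh w.2 * (5/4)) ^ 2 * (2 * (rh w.2 / 32) * (2 * (rh w.2 / 32)))) = (32/25) * Wr b p γ w := by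
          field_simp; ring
        rw [e]; linarith
    _ ≤ _ := by
        gcongr _ * ?_
        refine setLIntegral_mono' Metric.isClosed_closedBall.measurableSet fun ω hω => ?_
        rw [Metric.mem_closedBall, dist_comm] at hω
        obtain ⟨h1, h2, h3, h4, h5⟩ := ball_St' hw (hω.trans bl)
        apply ENNReal.ofReal_le_ofReal
        have := rh_pos h1
        gcongr
        · exact Wr_nonneg b p γ h1
        rw [div_le_iff₀' bp]
        exact Wr_comp b p γ w ω this (by rw [abs_sub_comm]; exact h2) bl bl

lemma glob1 (b : ℝ) (hb : ∀ n : ℤ, n ≠ 0 → b ≠ n) (p : ℝ) (hp : 1 < p) (γ : ℝ) :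
    ∃ C : ℝ≥0∞, C ≠ ⊤ ∧ ∀ v : R2 → ℂ, ContDiff ℝ 3 v → (∃ M : ℝ, 0 < M ∧ ∀ z : R2, M < |z.1| → v z = 0) →
      (∀ s, v (s, 0) = 0) → (∀ s, v (s, π) = 0) →
        ∫⁻ z in St, (‖Dd (Dd v) z‖ₑ ^ p + ‖Dd v z‖ₑ ^ p) * oR (Wr b p γ z) ≤ C *
          ((∫⁻ z in St, ‖Db (Dd v) z‖ₑ ^ p * oR (Wr b p γ z)) +
            ∫⁻ z in St, oR (rh z.2 ^ γ) * RR b (fun z => ‖Db (Dd v) z‖ₑ) z ^ p) := by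
  obtain ⟨C1, hC1, h1⟩ := loc2 b hb p hp
  obtain ⟨C2, hC2, h2⟩ := inner_low b p γ
  obtain ⟨C3, hC3, h3⟩ := inner_up b p γ
  have hp0 : 0 ≤ p := by linarith
  refine ⟨C2 * (C1 * (C3 + 1)), ENNReal.mul_ne_top hC2 (ENNReal.mul_ne_top hC1 (ENNReal.add_ne_top.2 ⟨hC3, by norm_num⟩)), ?_⟩
  intro v hv hM hb0 hbπ
  have hf : ContDiff ℝ 2 (Dd v) := Dd_cd (by norm_num; exact hv)
  have hgm : Measurable fun z => ‖Db (Dd v) z‖ₑ ^ p := (Db_cont (hf.of_le bn)).enorm.measurable.pow_const p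
  have hDc : Continuous (Dd (Dd v)) := (Dd_cd (n := 1) (by norm_num; exact hf)).continuous
  have hφ : Measurable fun z => ‖Dd (Dd v) z‖ₑ ^ p + ‖Dd v z‖ₑ ^ p :=
    (hDc.enorm.measurable.pow_const p).add (hf.continuous.enorm.measurable.pow_const p)
  have hm := mW_meas b p γ
  have hloc := h1 v hv hM hb0 hbπ
  set φ := fun z => ‖Dd (Dd v) z‖ₑ ^ p + ‖Dd v z‖ₑ ^ p
  set G := fun z => ‖Db (Dd v) z‖ₑ
  have s1 := ball_swap 1 (mW b p γ) φ hm hφ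
  have s3 := ball_swap 3 (mW b p γ) (fun z => G z ^ p) hm hgm
  calc _ ≤ C2 * ∫⁻ w, φ w * ∫⁻ ω in St ∩ {ω | dist w ω ≤ 1 * (rh ω.2 / 16)}, mW b p γ ω := by
        rw [← lintegral_const_mul' _ _ hC2]
        refine le_trans ?_ (setLIntegral_le_lintegral St _)
        refine setLIntegral_mono' St_meas fun w hw => ?_
        calc φ w * oR (Wr b p γ w) ≤ φ w * (C2 * ∫⁻ ω in St ∩ {ω | dist w ω ≤ 1 * (rh ω.2 / 16)}, mW b p γ ω) := by
              gcongr; exact h2 w hw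
          _ = _ := by ring
    _ = C2 * ∫⁻ ω in St, mW b p γ ω * ∫⁻ w in cBall ω (1 * (rh ω.2 / 16)), φ w := by rw [s1]
    _ ≤ C2 * ∫⁻ ω in St, C1 * (mW b p γ ω * (∫⁻ w in cBall ω (3 * (rh ω.2 / 16)), G w ^ p) + oR (rh ω.2 ^ γ) * RR b G ω ^ p) := by
        gcongr _ * ?_
        refine setLIntegral_mono' St_meas fun ω hω => ?_
        have hrp := rh_pos hω
        have hh := hloc ω hω _ rfl
        rw [one_mul]
        refine (mul_le_mul' le_rfl hh).trans ?_
        rw [mul_left_comm, mul_add]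
        refine mul_le_mul' le_rfl (add_le_add le_rfl ?_)
        rw [ENNReal.mul_rpow_of_nonneg _ _ hp0, ← mul_assoc, ← mul_assoc]
        gcongr
        rw [mW, ENNReal.ofReal_rpow_of_pos (exp_pos _), ← ENNReal.ofReal_pow bp, ← ENNReal.ofReal_mul (div_nonneg (Wr_nonneg b p γ hω) bp), ← ENNReal.ofReal_mul (mul_nonneg (div_nonneg (Wr_nonneg b p γ hω) bp) bp)]
        apply ENNReal.ofReal_le_ofReal
        have e : Wr b p γ ω * rexp (b * ω.1) ^ p = rh ω.2 ^ γ := by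
          unfold Wr
          rw [← exp_mul, mul_right_comm, ← exp_add, show -(b * p) * ω.1 + b * ω.1 * p = 0 by ring, exp_zero, one_mul]
        calc _ = (Wr b p γ ω * rexp (b * ω.1) ^ p) * (1 / 256) := by field_simp; norm_num
          _ ≤ _ := by rw [e]; have : 0 ≤ rh ω.2 ^ γ := by positivity
                      linarith
    _ ≤ C2 * (C1 * (C3 * (∫⁻ z in St, G z ^ p * oR (Wr b p γ z)) + ∫⁻ z in St, oR (rh z.2 ^ γ) * RR b G z ^ p)) := by
        gcongr _ * ?_
        rw [lintegral_const_mul' _ _ hC1]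
        gcongr _ * ?_
        rw [lintegral_add_left', s3]
        · gcongr
          rw [← lintegral_const_mul' _ _ hC3, ← lintegral_indicator St_meas]
          refine lintegral_mono fun w => ?_
          by_cases hw : w ∈ St
          · rw [indicator_of_mem hw]
            calc _ ≤ G w ^ p * (C3 * oR (Wr b p γ w)) := by gcongr; exact (h3 w).2 hw
              _ = _ := by ring
          · rw [indicator_of_notMem hw]; simp only [(h3 w).1 hw, mul_zero, le_refl]
        · refine (hm.mul ?_).aemeasurable
          have hr := rh_cont
          have hS : MeasurableSet {q : (R2) × (R2) | dist q.2 q.1 ≤ 3 * (rh q.1.2 / 16)} :=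
            (isClosed_le (by fun_prop) (by fun_prop)).measurableSet
          have := ((hgm.comp measurable_snd).indicator hS).lintegral_prod_right' (ν := (volume : Measure (R2)))
          convert this using 2 with ω
          rw [← lintegral_indicator Metric.isClosed_closedBall.measurableSet]
          rfl
    _ ≤ C2 * (C1 * ((C3 + 1) * (∫⁻ z in St, G z ^ p * oR (Wr b p γ z)) + (C3 + 1) * ∫⁻ z in St, oR (rh z.2 ^ γ) * RR b G z ^ p)) := by
        gcongr
        · exact le_self_add
        · exact le_mul_of_one_le_left' le_add_self
    _ = _ := by ring

lemma St_lint (f : R2 → ℝ≥0∞) (hf : Measurable f) :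
    ∫⁻ z in St, f z = ∫⁻ t in Ioo 0 π, ∫⁻ s, f (s, t) := by
  rw [St, Measure.volume_eq_prod, ← Measure.prod_restrict, Measure.restrict_univ, lintegral_prod_symm' _ hf]

lemma line_int (s0 A : ℝ) (hA : 0 < A) : ∫⁻ s, oR (1 / (|s0 - s| + A) ^ 3) = oR (1 / A ^ 2) := by
  rw [lintegral_sub_left_eq_self (fun x => oR (1 / (|x| + A) ^ 3)) s0, lint_even (by simp)]
  have e1 : ∫⁻ x in Ioi (0:ℝ), oR (1 / (|x| + A) ^ 3) = ∫⁻ x in Ioi A, oR (x ^ (-3 : ℝ)) := by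
    rw [← lintegral_indicator measurableSet_Ioi, ← lintegral_indicator measurableSet_Ioi, ← lintegral_add_right_eq_self (fun x => indicator (Ioi A) (fun x => oR (x ^ (-3 : ℝ))) x) A]
    refine lintegral_congr fun x => ?_
    by_cases hx : 0 < x
    · rw [indicator_of_mem (by exact hx), indicator_of_mem (by simpa using hx), abs_of_pos hx, Real.rpow_neg bl, one_div]
      norm_cast
    · rw [indicator_of_notMem (by exact hx), indicator_of_notMem (by simpa using hx)]
  rw [e1, lint_rpow_Ioi bn hA, show (2:ℝ≥0∞) = oR 2 by norm_num, ← ENNReal.ofReal_mul bn]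
  congr 1
  rw [show (-3 + 1 : ℝ) = -(2:ℕ) by norm_num, Real.rpow_neg hA.le, Real.rpow_natCast]
  push_cast; ring

lemma half_int (c R : ℝ) (hc : -1 < c) (hc1 : c < 1) (hR : 0 < R) :
    ∫⁻ t in Ioi (0:ℝ), oR (t ^ c / (R + t) ^ 2) ≤ oR ((1 / (c + 1) + 1 / (1 - c)) * R ^ (c - 1)) := by
  rw [← Ioc_union_Ioi_eq_Ioi hR.le]
  refine (lintegral_union_le _ _ _).trans ?_
  have h1 : ∫⁻ t in Ioc (0:ℝ) R, oR (t ^ c / (R + t) ^ 2) ≤ oR (1 / (c + 1) * R ^ (c - 1)) := by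
    calc _ ≤ ∫⁻ t in Ioc (0:ℝ) R, oR (1 / R ^ 2) * oR (t ^ c) := by
          refine setLIntegral_mono' measurableSet_Ioc fun t ht => ?_
          have := ht.1
          rw [← ENNReal.ofReal_mul bp]
          apply ENNReal.ofReal_le_ofReal
          rw [one_div_mul_eq_div]
          gcongr; linarith
      _ = _ := by
          rw [lintegral_const_mul' _ _ ENNReal.ofReal_ne_top, lint_rpow_Ioc hc hR.le, ← ENNReal.ofReal_mul bp]
          congr 1
          rw [show c - 1 = (c + 1) - (2:ℕ) by push_cast; ring, Real.rpow_sub hR, Real.rpow_natCast]; ring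
  have h2 : ∫⁻ t in Ioi R, oR (t ^ c / (R + t) ^ 2) ≤ oR (1 / (1 - c) * R ^ (c - 1)) := by
    calc _ ≤ ∫⁻ t in Ioi R, oR (t ^ (c - 2)) := by
          refine setLIntegral_mono' measurableSet_Ioi fun t ht => ?_
          have ht0 : 0 < t := hR.trans ht
          apply ENNReal.ofReal_le_ofReal
          rw [show c - 2 = c - (2:ℕ) by norm_num, Real.rpow_sub ht0, Real.rpow_natCast]
          gcongr; linarith
      _ = _ := by
          rw [lint_rpow_Ioi bl hR]
          congr 1
          rw [show c - 2 + 1 = c - 1 by ring, show 1 - c = -(c - 1) by ring, one_div, inv_neg]; ring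
  have hc3 : 0 < 1 - c := by linarith
  have hc4 : 0 < c + 1 := by linarith
  rw [add_mul, ENNReal.ofReal_add bp bp]
  exact add_le_add h1 h2

lemma refl_int (F : ℝ → ℝ≥0∞) : ∫⁻ t in Ioo 0 π, F (π - t) = ∫⁻ t in Ioo 0 π, F t := by
  rw [← lintegral_indicator measurableSet_Ioo, ← lintegral_indicator measurableSet_Ioo, ← lintegral_sub_left_eq_self (fun t => indicator (Ioo 0 π) F t) π]
  refine lintegral_congr fun t => ?_
  simp only [indicator, mem_Ioo, sub_pos, sub_lt_self_iff]
  simp only [and_comm]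

lemma rh_int (F : ℝ → ℝ≥0∞) (hF : Measurable F) : ∫⁻ t in Ioo 0 π, F (rh t) ≤ 2 * ∫⁻ t in Ioi 0, F t := by
  calc _ ≤ ∫⁻ t in Ioo 0 π, (F t + F (π - t)) := by
        refine lintegral_mono fun t => ?_
        unfold rh
        rcases min_choice t (π - t) with h | h <;> rw [h]
        · exact le_self_add
        · exact le_add_self
    _ = 2 * ∫⁻ t in Ioo 0 π, F t := by
        rw [lintegral_add_left hF, refl_int, two_mul]
    _ ≤ _ := by gcongr; exact fun t ht => ht.1

lemma schur1 (c : ℝ) (hc : -1 < c) (hc1 : c < 1) (ω : R2) (hω : ω ∈ St) :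
    ∫⁻ z in St, oR (rh z.2 ^ c / DD ω z ^ 3) ≤
      oR (2 * (1 / (c + 1) + 1 / (1 - c))) * oR (rh ω.2 ^ (c - 1)) := by
  have hr := rh_meas
  have hR := rh_pos hω
  have hc3 : 0 < 1 - c := by linarith
  have hc4 : 0 < c + 1 := by linarith
  rw [St_lint _ (by unfold DD; fun_prop)]
  calc _ = ∫⁻ t in Ioo 0 π, oR (rh t ^ c / (rh ω.2 + rh t) ^ 2) := by
        refine setLIntegral_congr_fun measurableSet_Ioo fun t ht => ?_
        have hrt : 0 < rh t := rh_pos (z := (0, t)) ⟨mem_univ _, ht⟩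
        have : ∀ s : ℝ, oR (rh t ^ c / DD ω (s, t) ^ 3) = oR (rh t ^ c) * oR (1 / (|ω.1 - s| + (rh ω.2 + rh t)) ^ 3) := by
          intro s
          rw [← ENNReal.ofReal_mul bp]; unfold DD; congr 1; simp only; ring
        simp_rw [this]
        rw [lintegral_const_mul' _ _ ENNReal.ofReal_ne_top, line_int _ _ bl, ← ENNReal.ofReal_mul bp]
        congr 1; ring
    _ ≤ 2 * ∫⁻ t in Ioi 0, oR (t ^ c / (rh ω.2 + t) ^ 2) :=
        rh_int (fun x => oR (x ^ c / (rh ω.2 + x) ^ 2)) (by fun_prop)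
    _ ≤ 2 * oR ((1 / (c + 1) + 1 / (1 - c)) * rh ω.2 ^ (c - 1)) := by gcongr; exact half_int c _ hc hc1 hR
    _ = _ := by
        rw [show (2:ℝ≥0∞) = oR 2 by norm_num, ← ENNReal.ofReal_mul bn, ← ENNReal.ofReal_mul bp]
        congr 1; ring

lemma DD_symm (w z : R2) : DD w z = DD z w := by unfold DD; rw [abs_sub_comm]; ring

lemma schur (b p γ : ℝ) (hp : 1 < p) (h1 : -1 < γ) (h2 : γ < 2 * p - 1) : ∃ C : ℝ≥0∞, C ≠ ⊤ ∧ ∀ G : R2 → ℝ≥0∞, Measurable G →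
    ∫⁻ z in St, oR (rh z.2 ^ γ) * RR b G z ^ p ≤ C * ∫⁻ z in St, G z ^ p * oR (Wr b p γ z) := by
  obtain ⟨α, hα1, hα2⟩ : ∃ α, max 0 (γ - 1) < α ∧ α < min (2 * p - 2) (γ + 1) := by
    apply exists_between
    rw [max_lt_iff, lt_min_iff, lt_min_iff]
    refine ⟨⟨?_, ?_⟩, ?_, ?_⟩ <;> linarith
  rw [max_lt_iff] at hα1
  rw [lt_min_iff] at hα2
  have hp0 : 0 ≤ p := by linarith
  have hp1 : 0 < p - 1 := by linarith
  set β := α / (p - 1) with hβ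
  have hβα : β * (p - 1) = α := by rw [hβ]; field_simp
  have hβ0 : 0 < β := div_pos hα1.1 hp1
  have hβ2 : β < 2 := by rw [hβ, div_lt_iff₀ hp1]; linarith
  set c1 := oR (2 * (1 / ((1 - β) + 1) + 1 / (1 - (1 - β))))
  set c2 := oR (2 * (1 / ((γ - α) + 1) + 1 / (1 - (γ - α))))
  have hc1 : c1 ^ (p - 1) ≠ ⊤ := ENNReal.rpow_ne_top_of_nonneg hp1.le ENNReal.ofReal_ne_top
  refine ⟨c1 ^ (p - 1) * c2, ENNReal.mul_ne_top hc1 ENNReal.ofReal_ne_top, fun G hG => ?_⟩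
  have hr := rh_meas
  have hrc : Continuous rh := rh_cont
  have mDD : Measurable fun q : (R2) × (R2) => DD q.1 q.2 := by unfold DD; fun_prop
  have mD1 : ∀ ω, Measurable fun z => DD ω z := fun ω => mDD.comp measurable_prodMk_left
  have hJ : ∀ ω ∈ St, RR b G ω ^ p ≤ c1 ^ (p - 1) * (oR (rh ω.2 ^ (-α)) *
      ∫⁻ z in St, oR (rh z.2 ^ (1 + α) / DD ω z ^ 3) * (oR (rexp (-(b * p) * z.1)) * G z ^ p)) := by
    intro ω hω
    have mk : Measurable fun z : R2 => oR (rh z.2 ^ (1 - β) / DD ω z ^ 3) := by have := mD1 ω; fun_prop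
    have mf : Measurable fun z : R2 => oR (rh z.2 ^ β * rexp (-b * z.1)) * G z := by fun_prop
    have h := lint_jensen ((volume.restrict St).withDensity (fun z => oR (rh z.2 ^ (1 - β) / DD ω z ^ 3))) _ mf.aemeasurable p hp
    rw [lintegral_withDensity_eq_lintegral_mul _ mk mf, lintegral_withDensity_eq_lintegral_mul _ mk (mf.pow_const p), withDensity_apply _ MeasurableSet.univ,
          Measure.restrict_univ] at h
    have e1 : RR b G ω = ∫⁻ z in St, ((fun z : R2 => oR (rh z.2 ^ (1 - β) / DD ω z ^ 3)) * fun z => oR (rh z.2 ^ β * rexp (-b * z.1)) * G z) z := by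
      unfold RR
      refine setLIntegral_congr_fun St_meas fun z hz => ?_
      have := rh_pos hz
      have := DD_pos hω hz
      simp only [Pi.mul_apply]
      rw [← mul_assoc, ← ENNReal.ofReal_mul bp]
      congr 2
      rw [Real.rpow_sub (by assumption), Real.rpow_one]; field_simp
    have e2 : ∫⁻ z in St, ((fun z : R2 => oR (rh z.2 ^ (1 - β) / DD ω z ^ 3)) * fun z => (oR (rh z.2 ^ β * rexp (-b * z.1)) * G z) ^ p) z =
        ∫⁻ z in St, oR (rh z.2 ^ (1 + α) / DD ω z ^ 3) * (oR (rexp (-(b * p) * z.1)) * G z ^ p) := by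
      refine setLIntegral_congr_fun St_meas fun z hz => ?_
      have hz0 := rh_pos hz
      have := DD_pos hω hz
      simp only [Pi.mul_apply]
      rw [ENNReal.mul_rpow_of_nonneg _ _ hp0, ENNReal.ofReal_rpow_of_pos bp, ← mul_assoc, ← mul_assoc, ← ENNReal.ofReal_mul bp, ← ENNReal.ofReal_mul bp]
      congr 2
      rw [Real.mul_rpow bp bp, ← Real.rpow_mul hz0.le, ← exp_mul, show 1 + α = (1 - β) + β * p by rw [← hβα]; ring, Real.rpow_add hz0,
        show -b * z.1 * p = -(b * p) * z.1 by ring]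
      ring
    rw [e2, ← e1] at h
    refine h.trans ?_
    rw [← mul_assoc]
    gcongr
    have hs := schur1 (1 - β) bl bl ω hω
    refine (ENNReal.rpow_le_rpow hs hp1.le).trans (le_of_eq ?_)
    rw [ENNReal.mul_rpow_of_nonneg _ _ hp1.le, ENNReal.ofReal_rpow_of_pos (Real.rpow_pos_of_pos (rh_pos hω) _), ← Real.rpow_mul (rh_pos hω).le]
    congr 3
    rw [show 1 - β - 1 = -β by ring, neg_mul, hβα]
  calc _ ≤ ∫⁻ ω in St, c1 ^ (p - 1) * ∫⁻ z in St, (oR (rh ω.2 ^ (γ - α) / DD z ω ^ 3)) * (oR (rh z.2 ^ (1 + α)) * (oR (rexp (-(b * p) * z.1)) * G z ^ p)) := by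
        refine setLIntegral_mono' St_meas fun ω hω => ?_
        have hw0 := rh_pos hω
        refine (mul_le_mul' le_rfl (hJ ω hω)).trans (le_of_eq ?_)
        rw [mul_left_comm]
        congr 1
        rw [← mul_assoc, ← lintegral_const_mul' _ _ (ENNReal.mul_ne_top ENNReal.ofReal_ne_top ENNReal.ofReal_ne_top)]
        refine setLIntegral_congr_fun St_meas fun z hz => ?_
        have hz0 := rh_pos hz
        have := DD_pos hz hω
        simp only [← mul_assoc]
        congr 2
        rw [← ENNReal.ofReal_mul bp, ← ENNReal.ofReal_mul bp, ← ENNReal.ofReal_mul bp, DD_symm ω z]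
        congr 1
        rw [Real.rpow_sub hw0, Real.rpow_neg hw0.le]; ring
    _ = c1 ^ (p - 1) * ∫⁻ z in St, (∫⁻ ω in St, (oR (rh ω.2 ^ (γ - α) / DD z ω ^ 3))) * (oR (rh z.2 ^ (1 + α)) * (oR (rexp (-(b * p) * z.1)) * G z ^ p)) := by
        rw [lintegral_const_mul' _ _ hc1, lintegral_lintegral_swap]
        · congr 1
          refine lintegral_congr fun z => ?_
          rw [lintegral_mul_const]
          have := mD1 z; fun_prop
        · have : Measurable fun q : (R2) × (R2) => DD q.2 q.1 := mDD.comp measurable_swap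
          apply Measurable.aemeasurable
          unfold Function.uncurry
          fun_prop
    _ ≤ c1 ^ (p - 1) * ∫⁻ z in St, c2 * (G z ^ p * oR (Wr b p γ z)) := by
        gcongr _ * ?_
        refine setLIntegral_mono' St_meas fun z hz => ?_
        have hz0 := rh_pos hz
        refine (mul_le_mul' (schur1 (γ - α) bl bl z hz) le_rfl).trans (le_of_eq ?_)
        rw [mul_assoc]
        congr 1
        rw [mul_comm (G z ^ p), ← mul_assoc, ← mul_assoc]
        congr 1
        rw [← ENNReal.ofReal_mul bp, ← ENNReal.ofReal_mul bp]
        congr 1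
        rw [← Real.rpow_add hz0, Wr, mul_comm]; ring_nf
    _ = _ := by rw [lintegral_const_mul' _ _ ENNReal.ofReal_ne_top, mul_assoc]

def NN (b p γ : ℝ) (X : R2 → ℂ) : ℝ≥0∞ := ∫⁻ z in St, ‖X z‖ₑ ^ p * oR (Wr b p γ z)

def adm (v : R2 → ℂ) : Prop := ContDiff ℝ 3 v ∧ (∃ M, 0 < M ∧ ∀ z : R2, M < |z.1| → v z = 0) ∧ (∀ s, v (s, 0) = 0) ∧ ∀ s, v (s, π) = 0

lemma glob2 (b : ℝ) (hb : ∀ n : ℤ, n ≠ 0 → b ≠ n) (p : ℝ) (hp : 1 < p) (γ : ℝ) (h1 : -1 < γ) (h2 : γ < 2 * p - 1) :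
    ∃ C : ℝ≥0∞, C ≠ ⊤ ∧ ∀ v, adm v → NN b p γ (Dd (Dd v)) ≤ C * NN b p γ (Db (Dd v)) ∧ NN b p γ (Dd v) ≤ C * NN b p γ (Db (Dd v)) := by
  obtain ⟨C1, hC1, H1⟩ := glob1 b hb p hp γ
  obtain ⟨C2, hC2, H2⟩ := schur b p γ hp h1 h2
  refine ⟨C1 * (1 + C2), ENNReal.mul_ne_top hC1 (by simp [hC2]), fun v hv => ?_⟩
  obtain ⟨v3, vM, v0, v1⟩ := hv
  have hm : Measurable fun z => ‖Db (Dd v) z‖ₑ :=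
    ((Db_cd (n := 1) (Dd_cd (n := 2) (by norm_num; exact v3))).continuous.enorm).measurable
  have h := (H1 v v3 vM v0 v1).trans (mul_le_mul' le_rfl (add_le_add le_rfl (H2 _ hm)))
  have e : C1 * (1 + C2) * NN b p γ (Db (Dd v)) = C1 * (NN b p γ (Db (Dd v)) + C2 * NN b p γ (Db (Dd v))) := by ring
  rw [e]
  constructor <;> refine le_trans (lintegral_mono fun z => ?_) h <;> gcongr
  · exact le_self_add
  · exact le_add_self

lemma fd_conj (v : R2 → ℂ) (z e : R2) : fderiv ℝ (fun z => conj (v z)) z e = conj (fderiv ℝ v z e) := by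
  have := Complex.conjCLE.comp_fderiv (f := v) (x := z)
  rw [show (fun z => conj (v z)) = Complex.conjCLE ∘ v from rfl, this]; rfl

lemma Dd_conj (v : R2 → ℂ) : Dd (fun z => conj (v z)) = fun z => conj (Db v z) := by
  ext z; simp only [Dd, Db, dS, dT, fd_conj, map_add, map_mul, Complex.conj_I]; ring
lemma Db_conj (v : R2 → ℂ) : Db (fun z => conj (v z)) = fun z => conj (Dd v z) := by
  ext z; simp only [Dd, Db, dS, dT, fd_conj, map_sub, map_mul, Complex.conj_I]; ring

lemma NN_conj (b p γ : ℝ) (X : R2 → ℂ) : NN b p γ (fun z => conj (X z)) = NN b p γ X := by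
  unfold NN; congr 1; ext z; congr 2; simp [enorm]

lemma adm_conj {v : R2 → ℂ} (hv : adm v) : adm (fun z => conj (v z)) := by
  obtain ⟨v3, ⟨M, hM, h⟩, v0, v1⟩ := hv
  exact ⟨Complex.conjCLE.contDiff.comp v3, ⟨M, hM, fun z hz => by simp [h z hz]⟩, fun s => by simp [v0 s], fun s => by simp [v1 s]⟩

lemma green (f f1 f2 : ℝ → ℂ) (h1 : ∀ t, HasDerivAt f (f1 t) t) (h2 : ∀ t, HasDerivAt f1 (f2 t) t) (hc : Continuous f2)
    (h0 : f 0 = 0) (hπ : f π = 0) (t : ℝ) (ht : t ∈ Ioo 0 π) : ‖f t‖ₑ ≤ ∫⁻ x in Ioo 0 π, oR (rh x) * ‖f2 x‖ₑ := by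
  have A := intervalIntegral.integral_eq_sub_of_hasDerivAt (a := 0) (b := t) (f := fun x : ℝ => ((π - t : ℝ) : ℂ) * ((x : ℂ) * f1 x - f x))
    (f' := fun x : ℝ => (((π - t) * x : ℝ) : ℂ) * f2 x) (fun x _ => by
      refine (((((hasDerivAt_id x).ofReal_comp).mul (h2 x)).sub (h1 x)).const_mul _).congr_deriv ?_
      simp; ring) (Continuous.intervalIntegrable (by fun_prop) _ _)
  have B := intervalIntegral.integral_eq_sub_of_hasDerivAt (a := t) (b := π) (f := fun x : ℝ => ((t : ℝ) : ℂ) * (((π - x : ℝ) : ℂ) * f1 x + f x))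
    (f' := fun x : ℝ => ((t * (π - x) : ℝ) : ℂ) * f2 x) (fun x _ => by
      refine (((((hasDerivAt_id x).const_sub π).ofReal_comp.mul (h2 x)).add (h1 x)).const_mul _).congr_deriv ?_
      simp; ring) (Continuous.intervalIntegrable (by fun_prop) _ _)
  rw [intervalIntegral.integral_of_le ht.1.le] at A
  rw [intervalIntegral.integral_of_le ht.2.le] at B
  have key : (π : ℂ) * f t = -((∫ x in Ioc 0 t, (((π - t) * x : ℝ) : ℂ) * f2 x) + ∫ x in Ioc t π, ((t * (π - x) : ℝ) : ℂ) * f2 x) := by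
    rw [A, B]; simp [h0, hπ]; ring
  have bd : ∀ (a : ℝ) (S : Set ℝ) (k : ℝ → ℝ), MeasurableSet S → (∀ x ∈ S, 0 ≤ k x ∧ k x ≤ π * rh x) →
      ‖∫ x in S, (k x : ℂ) * f2 x‖ₑ ≤ ∫⁻ x in S, oR π * (oR (rh x) * ‖f2 x‖ₑ) := by
    intro _ S k hS hk
    refine (enorm_integral_le_lintegral_enorm _).trans (setLIntegral_mono' hS fun x hx => ?_)
    rw [enorm_mul, ← mul_assoc, ← ENNReal.ofReal_mul pi_pos.le]
    gcongr
    rw [← ofReal_norm, Complex.norm_real, Real.norm_eq_abs, abs_of_nonneg (hk x hx).1]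
    exact ENNReal.ofReal_le_ofReal (hk x hx).2
  have hk := congrArg enorm key
  rw [enorm_mul, enorm_neg] at hk
  have : ‖(π : ℂ)‖ₑ = oR π := by rw [← ofReal_norm, Complex.norm_real, Real.norm_eq_abs, abs_of_pos pi_pos]
  rw [this] at hk
  have hpi := pi_pos
  have fin : oR π * ‖f t‖ₑ ≤ oR π * ∫⁻ x in Ioo 0 π, oR (rh x) * ‖f2 x‖ₑ := by
    rw [hk, setLIntegral_congr Ioo_ae_eq_Ioc, ← lintegral_const_mul' _ _ ENNReal.ofReal_ne_top, ← Ioc_union_Ioc_eq_Ioc ht.1.le ht.2.le,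
      lintegral_union measurableSet_Ioc (Ioc_disjoint_Ioc_of_le le_rfl)]
    refine (enorm_add_le _ _).trans (add_le_add (bd 0 _ _ measurableSet_Ioc fun x hx => ?_) (bd 0 _ _ measurableSet_Ioc fun x hx => ?_))
    all_goals
      obtain ⟨a1, a2⟩ := ht
      obtain ⟨b1, b2⟩ := hx
      unfold rh
      rcases min_choice x (π - x) with h | h <;> rw [h] <;> constructor <;> nlinarith
  exact (ENNReal.mul_le_mul_iff_right (by simpa using pi_pos) ENNReal.ofReal_ne_top).1 fin

lemma rhpow_int (c : ℝ) (hc : -1 < c) : ∫⁻ t in Ioo 0 π, oR (rh t ^ c) ≠ ⊤ := by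
  have h := rh_int (fun x => indicator (Ioc 0 π) (fun x => oR (x ^ c)) x) (Measurable.indicator (by fun_prop) measurableSet_Ioc)
  rw [← lintegral_indicator measurableSet_Ioi, indicator_indicator, inter_eq_self_of_subset_right (fun x hx => hx.1), lintegral_indicator measurableSet_Ioc,
    lint_rpow_Ioc hc pi_pos.le] at h
  refine ne_top_of_le_ne_top (by finiteness) (le_trans (le_of_eq ?_) h)
  refine setLIntegral_congr_fun measurableSet_Ioo fun t ht => ?_
  have h1 : 0 < rh t := lt_min ht.1 (by linarith [ht.2])
  have h2 : rh t ≤ π := (min_le_left _ _).trans ht.2.le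
  simp [h1, h2]

lemma hold (p γ : ℝ) (hp : 1 < p) (h2 : γ < 2 * p - 1) : ∃ C : ℝ≥0∞, C ≠ ⊤ ∧ ∀ G : ℝ → ℝ≥0∞, Measurable G →
    (∫⁻ x in Ioo 0 π, oR (rh x) * G x) ^ p ≤ C * ∫⁻ x in Ioo 0 π, G x ^ p * oR (rh x ^ γ) := by
  have hp1 : 0 < p - 1 := by linarith
  set c := (p - γ) / (p - 1) with hc
  have hcc : c * (p - 1) = p - γ := by rw [hc]; field_simp
  have hc1 : -1 < c := by rw [hc, lt_div_iff₀ hp1]; linarith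
  refine ⟨(∫⁻ t in Ioo 0 π, oR (rh t ^ c)) ^ (p - 1), ENNReal.rpow_ne_top_of_nonneg hp1.le (rhpow_int c hc1), fun G hG => ?_⟩
  have hr := rh_meas
  have mk : Measurable fun x => oR (rh x ^ c) := by fun_prop
  have mf : Measurable fun x => oR (rh x ^ (1 - c)) * G x := by fun_prop
  have h := lint_jensen ((volume.restrict (Ioo 0 π)).withDensity fun x => oR (rh x ^ c)) _ mf.aemeasurable p hp
  rw [lintegral_withDensity_eq_lintegral_mul _ mk mf, lintegral_withDensity_eq_lintegral_mul _ mk (mf.pow_const p), withDensity_apply _ MeasurableSet.univ,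
    Measure.restrict_univ] at h
  convert h using 2
  · refine setLIntegral_congr_fun measurableSet_Ioo fun t ht => ?_
    have h1 : 0 < rh t := lt_min ht.1 (by linarith [ht.2])
    simp only [Pi.mul_apply]
    rw [← mul_assoc, ← ENNReal.ofReal_mul bp, ← Real.rpow_add h1]
    simp
  · refine setLIntegral_congr_fun measurableSet_Ioo fun t ht => ?_
    have h1 : 0 < rh t := lt_min ht.1 (by linarith [ht.2])
    simp only [Pi.mul_apply]
    rw [ENNReal.mul_rpow_of_nonneg _ _ bl, ENNReal.ofReal_rpow_of_nonneg bp bl, ← Real.rpow_mul h1.le, ← mul_assoc,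
      ← ENNReal.ofReal_mul bp, ← Real.rpow_add h1, mul_comm, show c + (1 - c) * p = γ by linarith]

lemma NN_v (b p γ : ℝ) (hp : 1 < p) (h1 : -1 < γ) (h2 : γ < 2 * p - 1) : ∃ C : ℝ≥0∞, C ≠ ⊤ ∧ ∀ v, adm v →
    NN b p γ v ≤ C * NN b p γ (dT (dT v)) := by
  obtain ⟨C, hC, H⟩ := hold p γ hp h2
  refine ⟨(∫⁻ t in Ioo 0 π, oR (rh t ^ γ)) * C, ENNReal.mul_ne_top (rhpow_int γ h1) hC, fun v hv => ?_⟩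
  obtain ⟨v3, vM, v0, v1⟩ := hv
  have hr := rh_meas
  have hp0 : 0 ≤ p := by linarith
  have c1 : ContDiff ℝ 2 (dT v) := dT_cd (by norm_num; exact v3)
  have c2 : Continuous (dT (dT v)) := (dT_cd (n := 1) (by norm_num; exact c1)).continuous
  have mW := Wr_meas b p γ
  have hv0 := v3.continuous.enorm.measurable
  have m2 := c2.enorm.measurable
  have hd : ∀ (w : R2 → ℂ) (s t : ℝ), Differentiable ℝ w → HasDerivAt (fun t => w (s, t)) (dT w (s, t)) t := fun w s t hw =>
    (hw (s, t)).hasFDerivAt.comp_hasDerivAt t ((hasDerivAt_const t s).prodMk (hasDerivAt_id t))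
  have pt : ∀ s t, t ∈ Ioo 0 π → ‖v (s, t)‖ₑ ^ p ≤ C * ∫⁻ x in Ioo 0 π, ‖dT (dT v) (s, x)‖ₑ ^ p * oR (rh x ^ γ) := by
    intro s t ht
    refine (ENNReal.rpow_le_rpow (green (fun t => v (s, t)) (fun t => dT v (s, t)) (fun t => dT (dT v) (s, t)) (fun t => hd v s t (v3.differentiable bn))
      (fun t => hd _ s t (c1.differentiable bn)) (by fun_prop) (v0 s) (v1 s) t ht) hp0).trans (H _ (m2.comp measurable_prodMk_left))
  unfold NN
  rw [St_lint _ (by fun_prop), St_lint _ (by fun_prop)]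
  conv_rhs => rw [lintegral_lintegral_swap (by apply Measurable.aemeasurable; exact (show Measurable fun z => ‖dT (dT v) z‖ₑ ^ p * oR (Wr b p γ z) by fun_prop).comp measurable_swap)]
  calc _ ≤ ∫⁻ t in Ioo 0 π, oR (rh t ^ γ) * (C * ∫⁻ s, ∫⁻ x in Ioo 0 π, ‖dT (dT v) (s, x)‖ₑ ^ p * oR (Wr b p γ (s, x))) := by
        refine setLIntegral_mono' measurableSet_Ioo fun t ht => ?_
        have h1 : 0 < rh t := lt_min ht.1 (by linarith [ht.2])
        rw [← lintegral_const_mul' _ _ hC, ← lintegral_const_mul' _ _ ENNReal.ofReal_ne_top]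
        refine lintegral_mono fun s => ?_
        refine (mul_le_mul' (pt s t ht) le_rfl).trans (le_of_eq ?_)
        have : ∀ x, Wr b p γ (s, x) = rexp (-(b * p) * s) * rh x ^ γ := fun x => rfl
        simp only [this, ENNReal.ofReal_mul (exp_pos _).le, mul_left_comm _ (oR (rexp _))]
        rw [lintegral_const_mul' _ _ ENNReal.ofReal_ne_top]
        ring
    _ = _ := by rw [lintegral_mul_const _ (by fun_prop), mul_assoc]

lemma NN_lin (b p γ : ℝ) (hp : 1 < p) (X Y : R2 → ℂ) (hX : Continuous X) (hY : Continuous Y) (c : ℂ) :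
    NN b p γ (fun z => X z + c * Y z) ≤ 2 ^ (p - 1) * (NN b p γ X + ‖c‖ₑ ^ p * NN b p γ Y) := by
  unfold NN
  have mW := Wr_meas b p γ
  have := hX.enorm.measurable
  have := hY.enorm.measurable
  rw [← lintegral_const_mul _ (by fun_prop), ← lintegral_add_left (by fun_prop), ← lintegral_const_mul _ (by fun_prop)]
  refine lintegral_mono fun z => ?_
  rw [← mul_assoc (_ ^ p), ← add_mul, ← mul_assoc]
  gcongr
  refine (ENNReal.rpow_le_rpow (enorm_add_le _ _) bl).trans ((ENNReal.rpow_add_le_mul_rpow_add_rpow _ _ hp.le).trans ?_)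
  rw [enorm_mul, ENNReal.mul_rpow_of_nonneg _ _ bl]

theorem stripEst (b : ℝ) (hb : ∀ n : ℤ, n ≠ 0 → b ≠ n) (p : ℝ) (hp : 1 < p) (γ : ℝ) (h1 : -1 < γ) (h2 : γ < 2 * p - 1) :
    ∃ C : ℝ≥0∞, C ≠ ⊤ ∧ ∀ v, adm v → NN b p γ (Dd (Dd v)) ≤ C * NN b p γ (Db (Dd v)) ∧ NN b p γ (Dd v) ≤ C * NN b p γ (Db (Dd v)) ∧
      NN b p γ (Db (Db v)) ≤ C * NN b p γ (Db (Dd v)) ∧ NN b p γ (Db v) ≤ C * NN b p γ (Db (Dd v)) ∧ NN b p γ v ≤ C * NN b p γ (Db (Dd v)) := by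
  obtain ⟨C1, hC1, H1⟩ := glob2 b hb p hp γ h1 h2
  obtain ⟨C2, hC2, H2⟩ := NN_v b p γ hp h1 h2
  set K : ℝ≥0∞ := 2 ^ (p - 1) * (2 ^ (p - 1) * (‖(2⁻¹ : ℂ)‖ₑ ^ p + ‖(-4⁻¹ : ℂ)‖ₑ ^ p * C1) + ‖(-4⁻¹ : ℂ)‖ₑ ^ p * C1) with hK
  have hKt : K ≠ ⊤ := by
    have : (2 : ℝ≥0∞) ^ (p - 1) ≠ ⊤ := ENNReal.rpow_ne_top_of_nonneg bl (by simp)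
    have a1 : ‖(2⁻¹ : ℂ)‖ₑ ^ p ≠ ⊤ := ENNReal.rpow_ne_top_of_nonneg bl enorm_ne_top
    have a2 : ‖(-4⁻¹ : ℂ)‖ₑ ^ p ≠ ⊤ := ENNReal.rpow_ne_top_of_nonneg bl enorm_ne_top
    rw [hK]; finiteness
  refine ⟨C1 + C2 * K, by finiteness, fun v hv => ?_⟩
  have l1 : C1 ≤ C1 + C2 * K := le_self_add
  have l2 : C2 * K ≤ C1 + C2 * K := le_add_self
  have hv2 : ContDiff ℝ 2 v := hv.1.of_le bn
  obtain ⟨e1, e2⟩ := H1 v hv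
  obtain ⟨e3, e4⟩ := H1 _ (adm_conj hv)
  have ee : Dd (Db v) = Db (Dd v) := by ext z; rw [(second hv2 z).1, (second hv2 z).2.1]
  simp only [Dd_conj, Db_conj, NN_conj, ee] at e3 e4
  have cD : ContDiff ℝ 1 (Dd v) := Dd_cd (by norm_num; exact hv2)
  have cB : ContDiff ℝ 1 (Db v) := Db_cd (by norm_num; exact hv2)
  have q1 : Continuous (Db (Dd v)) := (Db_cd (n := 0) (by norm_num; exact cD)).continuous
  have q2 : Continuous (Dd (Dd v)) := (Dd_cd (n := 0) (by norm_num; exact cD)).continuous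
  have q3 : Continuous (Db (Db v)) := (Db_cd (n := 0) (by norm_num; exact cB)).continuous
  have hT : dT (dT v) = fun z => (0 + 2⁻¹ * Db (Dd v) z + (-4⁻¹) * Dd (Dd v) z) + (-4⁻¹) * Db (Db v) z := by
    ext z; obtain ⟨a, -, b, c⟩ := second hv2 z
    rw [a, b, c]; ring
  have e5 : NN b p γ (dT (dT v)) ≤ K * NN b p γ (Db (Dd v)) := by
    have i1 := NN_lin b p γ hp _ _ (by fun_prop : Continuous fun z => 0 + 2⁻¹ * Db (Dd v) z + (-4⁻¹) * Dd (Dd v) z) q3 (-4⁻¹)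
    have i2 := NN_lin b p γ hp _ _ (by fun_prop : Continuous fun z => 0 + 2⁻¹ * Db (Dd v) z) q2 (-4⁻¹)
    have i3 : NN b p γ (fun z => 0 + 2⁻¹ * Db (Dd v) z) = ‖(2⁻¹ : ℂ)‖ₑ ^ p * NN b p γ (Db (Dd v)) := by
      unfold NN
      rw [← lintegral_const_mul' _ _ (ENNReal.rpow_ne_top_of_nonneg bl enorm_ne_top)]
      simp only [zero_add, enorm_mul, ENNReal.mul_rpow_of_nonneg _ _ (by linarith : 0 ≤ p), mul_assoc]
    rw [hT]
    refine i1.trans ((mul_le_mul' le_rfl (add_le_add (i2.trans (mul_le_mul' le_rfl (add_le_add i3.le (mul_le_mul' le_rfl e1)))) (mul_le_mul' le_rfl e3))).trans (le_of_eq ?_))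
    rw [hK]; ring
  refine ⟨e1.trans ?_, e2.trans ?_, e3.trans ?_, e4.trans ?_, (H2 v hv).trans ((mul_le_mul' le_rfl e5).trans ?_)⟩
  · gcongr
  · gcongr
  · gcongr
  · gcongr
  · rw [← mul_assoc]; gcongr

def Sec (a b : ℝ) : Set (R2) := {x | ∃ r φ : ℝ, 0 < r ∧ a < φ ∧ φ < b ∧ x = (r * cos φ, r * sin φ)}

lemma Sec_open (a b : ℝ) : IsOpen (Sec a b) := by
  have h : Sec a b = Complex.equivRealProdCLM '' (cE '' {ζ | a < ζ.im ∧ ζ.im < b}) := by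
    ext x; constructor
    · rintro ⟨r, φ, hr, h1, h2, rfl⟩
      refine ⟨_, ⟨⟨Real.log r, φ⟩, ⟨h1, h2⟩, rfl⟩, ?_⟩
      simp [Complex.equivRealProdCLM_apply, Complex.exp_re, Complex.exp_im, Real.exp_log hr]
    · rintro ⟨_, ⟨ζ, ⟨h1, h2⟩, rfl⟩, rfl⟩
      refine ⟨rexp ζ.re, ζ.im, exp_pos _, h1, h2, ?_⟩
      simp [Complex.equivRealProdCLM_apply, Complex.exp_re, Complex.exp_im]
  rw [h]
  refine Complex.equivRealProdCLM.toHomeomorph.isOpenMap _ (Complex.isOpenMap_exp _ ?_)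
  exact (isOpen_lt continuous_const Complex.continuous_im).inter (isOpen_lt Complex.continuous_im continuous_const)

lemma polar_inj {r t φ a : ℝ} (hr : 0 < r) (ht : 0 < t) (h1 : -(2 * π) < φ - a) (h2 : φ - a < 2 * π)
    (h : ((r * cos φ, r * sin φ) : R2) = (t * cos a, t * sin a)) : r = t ∧ φ = a := by
  rw [Prod.mk.injEq] at h
  obtain ⟨e1, e2⟩ := h
  have e3 : r = t := by
    have : r ^ 2 = t ^ 2 := by
      have i1 := sin_sq_add_cos_sq φ
      have i2 := sin_sq_add_cos_sq a
      calc r ^ 2 = (r * cos φ) ^ 2 + (r * sin φ) ^ 2 := by linear_combination (-r^2) * i1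
        _ = t ^ 2 := by rw [e1, e2]; linear_combination (t^2) * i2
    exact (pow_left_inj₀ hr.le ht.le bn).1 this
  subst e3
  have e4 := mul_left_cancel₀ hr.ne' e1
  have e5 := mul_left_cancel₀ hr.ne' e2
  have : cos (φ - a) = 1 := by rw [cos_sub, e4, e5]; nlinarith [sin_sq_add_cos_sq a]
  have := (cos_eq_one_iff_of_lt_of_lt h1 h2).1 this
  exact ⟨rfl, by linarith⟩

lemma polar_ex (y : R2) : ∃ t φ : ℝ, 0 ≤ t ∧ 0 ≤ φ ∧ φ < 2 * π ∧ y = (t * cos φ, t * sin φ) := by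
  have h1 := Complex.norm_mul_cos_arg ⟨y.1, y.2⟩
  have h2 := Complex.norm_mul_sin_arg ⟨y.1, y.2⟩
  set ζ : ℂ := ⟨y.1, y.2⟩
  have h3 := Complex.neg_pi_lt_arg ζ
  have h4 := Complex.arg_le_pi ζ
  have := pi_pos
  rcases le_or_gt 0 ζ.arg with h | h
  · exact ⟨‖ζ‖, ζ.arg, norm_nonneg _, h, by linarith, by rw [h1, h2]⟩
  · refine ⟨‖ζ‖, ζ.arg + 2 * π, norm_nonneg _, by linarith, by linarith, ?_⟩
    rw [cos_add_two_pi, sin_add_two_pi, h1, h2]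

lemma front_mem {κ t a : ℝ} (hκ : 0 < κ) (hκ' : κ < 2 * π) (ht : 0 < t) (ha : a = 0 ∨ a = κ) : (t * cos a, t * sin a) ∈ frontier (D2 κ) := by
  have ha' : a ∈ closure (Ioo 0 κ) := by
    rw [closure_Ioo hκ.ne]; rcases ha with rfl | rfl <;> constructor <;> linarith
  refine ⟨?_, fun h => ?_⟩
  · have hc : Continuous fun φ : ℝ => ((t * cos φ, t * sin φ) : R2) := by fun_prop
    refine closure_mono ?_ (image_closure_subset_closure_image hc ⟨a, ha', rfl⟩)
    rintro _ ⟨φ, hφ, rfl⟩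
    exact ⟨t, φ, ht, hφ.1, hφ.2, rfl⟩
  · obtain ⟨r, φ, hr, h1, h2, e⟩ := interior_subset h
    have := polar_inj hr ht (by rcases ha with rfl | rfl <;> linarith) (by rcases ha with rfl | rfl <;> linarith) e.symm
    rcases ha with rfl | rfl <;> linarith

lemma front_sub {κ : ℝ} (hκ : 0 < κ) (hκ' : κ < 2 * π) {y : R2} (hy : y ∈ frontier (D2 κ)) :
    ∃ t a : ℝ, 0 ≤ t ∧ (a = 0 ∨ a = κ) ∧ y = (t * cos a, t * sin a) := by
  obtain ⟨t, φ, ht, h0, h1, rfl⟩ := polar_ex y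
  have ho : IsOpen (D2 κ) := Sec_open 0 κ
  rw [ho.frontier_eq] at hy
  obtain ⟨hc, hn⟩ := hy
  rcases ht.eq_or_lt with rfl | ht'
  · exact ⟨0, 0, le_rfl, Or.inl rfl, by simp⟩
  rcases h0.eq_or_lt with rfl | h0'
  · exact ⟨t, 0, ht, Or.inl rfl, rfl⟩
  rcases lt_trichotomy φ κ with h | h | h
  · exact (hn ⟨t, φ, ht', h0', h, rfl⟩).elim
  · exact ⟨t, φ, ht, Or.inr h, rfl⟩
  · obtain ⟨x, ⟨r, ψ, a1, a2, a3, rfl⟩, r', φ', b1, b2, b3, e⟩ := mem_closure_iff.1 hc (Sec κ (2 * π)) (Sec_open _ _) ⟨t, φ, ht', h, h1, rfl⟩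
    have := polar_inj a1 b1 bl bl e
    linarith

lemma dist_pol (r φ t a : ℝ) : enorm2 ((r * cos φ, r * sin φ) - (t * cos a, t * sin a)) = √(r ^ 2 + t ^ 2 - 2 * r * t * cos (φ - a)) := by
  unfold enorm2
  congr 1
  simp only [Prod.mk_sub_mk, cos_sub]
  linear_combination (r^2) * sin_sq_add_cos_sq φ + t^2 * sin_sq_add_cos_sq a

lemma dist_low {r t δ : ℝ} (hr : 0 ≤ r) (ht : 0 ≤ t) (h : 0 ≤ sin (δ / 2)) : r * sin (δ / 2) ≤ √(r ^ 2 + t ^ 2 - 2 * r * t * cos δ) := by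
  apply le_sqrt_of_sq_le
  have e : cos δ = 1 - 2 * sin (δ / 2) ^ 2 := by
    have := cos_two_mul (δ / 2); rw [mul_div_cancel₀ _ bn] at this
    linarith [sin_sq_add_cos_sq (δ / 2)]
  have h1 := cos_le_one δ
  have h2 := neg_one_le_cos δ
  have hs : sin (δ / 2) ^ 2 = (1 - cos δ) / 2 := by linarith
  rw [mul_pow, hs]
  have hrt := mul_nonneg hr ht
  rcases le_total 0 (cos δ) with hc | hc
  · nlinarith [sq_nonneg (r * cos δ - t), mul_nonneg (sq_nonneg r) (mul_nonneg (by linarith : 0 ≤ 1 - cos δ) (by linarith : 0 ≤ 2 * cos δ + 1))]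
  · nlinarith [mul_nonneg hrt (neg_nonneg.2 hc), mul_nonneg (sq_nonneg r) (by linarith : 0 ≤ 1 + cos δ), sq_nonneg t]

lemma dist_up {r δ : ℝ} (hr : 0 ≤ r) (h : 0 ≤ δ) : √(r ^ 2 + r ^ 2 - 2 * r * r * cos δ) ≤ r * δ := by
  apply Real.sqrt_le_iff.2 ⟨by positivity, _⟩
  nlinarith [one_sub_sq_div_two_le_cos (x := δ), sq_nonneg r]

lemma sin_conc {κ θ : ℝ} (hκ : 0 < κ) (hκ' : κ < 2 * π) (h0 : 0 ≤ θ) (h1 : θ ≤ π) : θ / π * sin (κ / 2) ≤ sin (κ / π * θ / 2) := by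
  have hc := strictConcaveOn_sin_Icc.concaveOn
  have hp := pi_pos
  have i1 : (0:ℝ) ≤ 1 - θ / π := by rw [sub_nonneg, div_le_one hp]; exact h1
  have i2 : 0 ≤ θ / π := by positivity
  have := hc.2 ⟨le_rfl, hp.le⟩ (⟨by linarith, by linarith⟩ : κ / 2 ∈ Icc 0 π) i1 i2 (by ring)
  simp only [smul_eq_mul, sin_zero, mul_zero, zero_add] at this
  rwa [show θ / π * (κ / 2) = κ / π * θ / 2 by ring] at this

def Psi (m : ℝ) (z : R2) : R2 := (rexp (m * z.1) * cos (m * z.2), rexp (m * z.1) * sin (m * z.2))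

lemma Psi_norm (m : ℝ) (z : R2) : enorm2 (Psi m z) = rexp (m * z.1) := by
  have := dist_pol (rexp (m * z.1)) (m * z.2) 0 0
  simp only [zero_mul, mul_zero, Prod.mk_zero_zero, sub_zero] at this
  rw [Psi, this]
  simp [Real.sqrt_sq (exp_pos _).le]

lemma geo {κ : ℝ} (hκ : 0 < κ) (hκ' : κ < 2 * π) {z : R2} (hz : z ∈ St) :
    sin (κ / 2) / π * (rexp (κ / π * z.1) * rh z.2) ≤ rhoD2 κ (Psi (κ / π) z) ∧ rhoD2 κ (Psi (κ / π) z) ≤ κ / π * (rexp (κ / π * z.1) * rh z.2) := by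
  have hp := pi_pos
  obtain ⟨-, h0, h1⟩ := hz
  set m := κ / π with hm
  have hmκ : m * π = κ := by rw [hm]; field_simp
  have hm0 : 0 < m := by positivity
  set r := rexp (m * z.1) with hr
  have hr0 : 0 < r := exp_pos _
  have hs0 : 0 ≤ sin (κ / 2) := sin_nonneg_of_nonneg_of_le_pi bl bl
  constructor
  · apply le_csInf
    · exact ⟨_, _, front_mem (t := 1) (a := 0) hκ hκ' one_pos (Or.inl rfl), rfl⟩
    rintro _ ⟨y, hy, rfl⟩
    obtain ⟨t, a, ht, ha, rfl⟩ := front_sub hκ hκ' hy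
    simp only [Psi]
    rw [dist_pol]
    rcases ha with rfl | rfl
    · have c1 := sin_conc hκ hκ' h0.le h1.le
      rw [sub_zero]
      refine le_trans ?_ (dist_low hr0.le ht (le_trans (by have := h0; positivity) c1))
      calc _ ≤ sin (κ / 2) / π * (r * z.2) := by gcongr; exact min_le_left _ _
        _ = r * (z.2 / π * sin (κ / 2)) := by ring
        _ ≤ _ := by gcongr
    · have c1 := sin_conc hκ hκ' (sub_nonneg.2 h1.le) (by linarith : π - z.2 ≤ π)
      rw [show a / π * (π - z.2) / 2 = (a - m * z.2) / 2 by rw [← hm, ← hmκ]; ring] at c1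
      rw [← cos_neg, neg_sub]
      have h3 : 0 < π - z.2 := by linarith
      refine le_trans ?_ (dist_low hr0.le ht (le_trans bp c1))
      calc _ ≤ sin (a / 2) / π * (r * (π - z.2)) := by gcongr; exact min_le_right _ _
        _ = r * ((π - z.2) / π * sin (a / 2)) := by ring
        _ ≤ _ := by gcongr
  · have bd : BddBelow ((fun y => enorm2 (Psi m z - y)) '' frontier (D2 κ)) := ⟨0, by rintro _ ⟨y, -, rfl⟩; exact Real.sqrt_nonneg _⟩
    have key : ∀ a, (a = 0 ∨ a = κ) → rhoD2 κ (Psi m z) ≤ √(r ^ 2 + r ^ 2 - 2 * r * r * cos (m * z.2 - a)) := fun a ha => by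
      rw [← dist_pol]
      exact csInf_le bd ⟨_, front_mem hκ hκ' hr0 ha, rfl⟩
    unfold rh
    rcases min_choice z.2 (π - z.2) with h | h <;> rw [h]
    · refine (key 0 (Or.inl rfl)).trans ?_
      rw [sub_zero]
      exact (dist_up hr0.le bp).trans (le_of_eq (by ring))
    · refine (key κ (Or.inr rfl)).trans ?_
      rw [← cos_neg, neg_sub]
      have : 0 ≤ κ - m * z.2 := by rw [← hmκ]; nlinarith
      exact (dist_up hr0.le this).trans (le_of_eq (by rw [← hmκ]; ring))

lemma Psi_inj {κ : ℝ} (hκ : 0 < κ) (hκ' : κ < 2 * π) : InjOn (Psi (κ / π)) St := by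
  rintro z ⟨-, h0, h1⟩ w ⟨-, g0, g1⟩ h
  have hp := pi_pos
  have hm0 : 0 < κ / π := by positivity
  have hmκ : κ / π * π = κ := by field_simp
  obtain ⟨e1, e2⟩ := polar_inj (exp_pos _) (exp_pos _) (by nlinarith) (by nlinarith) h
  exact Prod.ext (mul_left_cancel₀ hm0.ne' (exp_injective e1)) (mul_left_cancel₀ hm0.ne' e2)

lemma Psi_im {κ : ℝ} (hκ : 0 < κ) : Psi (κ / π) '' St = D2 κ := by
  have hp := pi_pos
  have hm0 : 0 < κ / π := by positivity
  have hmκ : κ / π * π = κ := by field_simp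
  ext x; constructor
  · rintro ⟨z, ⟨-, h0, h1⟩, rfl⟩
    exact ⟨_, κ / π * z.2, exp_pos _, mul_pos hm0 h0, by rw [← mul_lt_mul_iff_right₀ hm0] at h1; linarith, rfl⟩
  · rintro ⟨r, φ, hr, h0, h1, rfl⟩
    refine ⟨(Real.log r / (κ / π), φ / (κ / π)), ⟨mem_univ _, by positivity, ?_⟩, ?_⟩
    · simp only; rw [div_lt_iff₀ hm0]; linarith
    · simp only [Psi, mul_div_cancel₀ _ hm0.ne', exp_log hr]

def Psi' (m : ℝ) (z : R2) : R2 →L[ℝ] R2 :=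
  (Matrix.toLin (.finTwoProd ℝ) (.finTwoProd ℝ) !![m * (Psi m z).1, -(m * (Psi m z).2); m * (Psi m z).2, m * (Psi m z).1]).toContinuousLinearMap

lemma Psi_fd (m : ℝ) (z : R2) : HasFDerivAt (Psi m) (Psi' m z) z := by
  unfold Psi'
  rw [Matrix.toLin_finTwoProd_toContinuousLinearMap]
  have he := ((hasFDerivAt_fst (𝕜 := ℝ) (p := z)).const_mul m).exp
  have ha := ((hasFDerivAt_snd (𝕜 := ℝ) (p := z)).const_mul m)
  refine ((he.mul ha.cos).prodMk (he.mul ha.sin)).congr_fderiv ?_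
  ext <;> simp [Psi] <;> ring

lemma Psi_det (m : ℝ) (z : R2) : |(Psi' m z).det| = m ^ 2 * rexp (m * z.1) ^ 2 := by
  unfold Psi' Psi
  rw [LinearMap.det_toContinuousLinearMap, LinearMap.det_toLin, Matrix.det_fin_two_of]
  rw [show ∀ E c s : ℝ, m * (E * c) * (m * (E * c)) - -(m * (E * s)) * (m * (E * s)) = m ^ 2 * E ^ 2 * (s ^ 2 + c ^ 2) from fun _ _ _ => by ring,
    sin_sq_add_cos_sq, mul_one, abs_of_nonneg bp]

lemma cov {κ : ℝ} (hκ : 0 < κ) (hκ' : κ < 2 * π) (f : R2 → ℝ≥0∞) :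
    ∫⁻ x in D2 κ, f x = ∫⁻ z in St, oR ((κ / π) ^ 2 * rexp (κ / π * z.1) ^ 2) * f (Psi (κ / π) z) := by
  rw [← Psi_im hκ, lintegral_image_eq_lintegral_abs_det_fderiv_mul volume St_meas (fun z _ => (Psi_fd _ z).hasFDerivWithinAt) (Psi_inj hκ hκ')]
  simp only [Psi_det]

lemma pow_two_side {c1 c2 x y : ℝ} (γ : ℝ) (h1 : 0 < c1) (h2 : 0 < c2) (hx : 0 < x) (l : c1 * x ≤ y) (u : y ≤ c2 * x) :
    y ^ γ ≤ (c1 ^ γ + c2 ^ γ) * x ^ γ := by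
  have hy : 0 < y := lt_of_lt_of_le bp l
  rw [add_mul, ← Real.mul_rpow h1.le hx.le, ← Real.mul_rpow h2.le hx.le]
  rcases le_total 0 γ with h | h
  · exact (Real.rpow_le_rpow hy.le u h).trans (le_add_of_nonneg_left bp)
  · exact (Real.rpow_le_rpow_of_nonpos bp l h).trans (le_add_of_nonneg_right bp)

lemma transf {κ : ℝ} (hκ : 0 < κ) (hκ' : κ < 2 * π) (p γ ν : ℝ) (hp : 1 < p) : ∃ A : ℝ, ∀ (F : R2 → ℂ) (k : ℝ),
    (∫⁻ x in D2 κ, oR ((enorm2 x ^ (k - 2) * ‖F x‖) ^ p * wgt2 κ γ ν x)) ≤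
      oR A * NN (κ / π * (2 - (ν + 2) / p)) p γ (fun z => ((rexp (κ / π * z.1) ^ k : ℝ) : ℂ) * F (Psi (κ / π) z)) ∧
    NN (κ / π * (2 - (ν + 2) / p)) p γ (fun z => ((rexp (κ / π * z.1) ^ k : ℝ) : ℂ) * F (Psi (κ / π) z)) ≤
      oR A * ∫⁻ x in D2 κ, oR ((enorm2 x ^ (k - 2) * ‖F x‖) ^ p * wgt2 κ γ ν x) := by
  have hpi := pi_pos
  set m := κ / π with hm
  have hm0 : 0 < m := by positivity
  set c1 := sin (κ / 2) / π with hc1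
  have hc0 : 0 < c1 := div_pos (sin_pos_of_pos_of_lt_pi bl bl) hpi
  set A := m ^ 2 * (c1 ^ γ + m ^ γ) + (m ^ 2)⁻¹ * (m⁻¹ ^ γ + c1⁻¹ ^ γ) with hA
  have hA0 : 0 ≤ A := by positivity
  have main : ∀ z ∈ St, m ^ 2 * rexp (m * z.1) ^ 2 * wgt2 κ γ ν (Psi m z) ≤ A * (rexp (m * z.1) ^ (ν + 2) * rh z.2 ^ γ) ∧
      rexp (m * z.1) ^ (ν + 2) * rh z.2 ^ γ ≤ A * (m ^ 2 * rexp (m * z.1) ^ 2 * wgt2 κ γ ν (Psi m z)) := by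
    intro z hz
    obtain ⟨g1, g2⟩ := geo hκ hκ' hz
    have hr := rh_pos hz
    rw [wgt2, Psi_norm]
    have hR : 0 < rexp (m * z.1) := exp_pos _
    set R := rexp (m * z.1)
    rw [← hc1] at g1
    set y := rhoD2 κ (Psi m z)
    have hy : 0 < y := lt_of_lt_of_le bp g1
    have i1 := pow_two_side γ hc0 hm0 bp g1 g2
    have i2 := pow_two_side (x := y) (y := R * rh z.2) γ (inv_pos.2 hm0) (inv_pos.2 hc0) hy (by rw [inv_mul_le_iff₀ hm0]; exact g2) (by rw [le_inv_mul_iff₀ hc0]; exact g1)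
    have e : R ^ (ν + 2) * rh z.2 ^ γ = R ^ 2 * R ^ (ν - γ) * (R * rh z.2) ^ γ := by
      rw [Real.mul_rpow hR.le hr.le, ← mul_assoc]; congr 1
      rw [← Real.rpow_natCast, ← Real.rpow_add hR, ← Real.rpow_add hR]; congr 1; push_cast; ring
    rw [e]
    have p1 : 0 ≤ (m ^ 2)⁻¹ * (m⁻¹ ^ γ + c1⁻¹ ^ γ) := by positivity
    have p2 : 0 ≤ m ^ 2 * (c1 ^ γ + m ^ γ) := by positivity
    constructor
    · calc _ = m ^ 2 * (R ^ 2 * R ^ (ν - γ)) * y ^ γ := by ring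
        _ ≤ m ^ 2 * (R ^ 2 * R ^ (ν - γ)) * ((c1 ^ γ + m ^ γ) * (R * rh z.2) ^ γ) := by gcongr
        _ = m ^ 2 * (c1 ^ γ + m ^ γ) * (R ^ 2 * R ^ (ν - γ) * (R * rh z.2) ^ γ) := by ring
        _ ≤ _ := by gcongr; rw [hA]; linarith
    · calc _ ≤ R ^ 2 * R ^ (ν - γ) * ((m⁻¹ ^ γ + c1⁻¹ ^ γ) * y ^ γ) := by gcongr
        _ = (m ^ 2)⁻¹ * (m⁻¹ ^ γ + c1⁻¹ ^ γ) * (m ^ 2 * R ^ 2 * (R ^ (ν - γ) * y ^ γ)) := by field_simp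
        _ ≤ _ := by gcongr; rw [hA]; linarith
  refine ⟨A, fun F k => ?_⟩
  rw [cov hκ hκ']
  unfold NN
  rw [← lintegral_const_mul' _ _ ENNReal.ofReal_ne_top, ← lintegral_const_mul' _ _ ENNReal.ofReal_ne_top]
  have pt : ∀ z ∈ St, ∃ Q : ℝ, 0 ≤ Q ∧ oR (m ^ 2 * rexp (m * z.1) ^ 2) * oR ((enorm2 (Psi m z) ^ (k - 2) * ‖F (Psi m z)‖) ^ p * wgt2 κ γ ν (Psi m z)) =
      oR (Q * (m ^ 2 * rexp (m * z.1) ^ 2 * wgt2 κ γ ν (Psi m z))) ∧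
      ‖((rexp (m * z.1) ^ k : ℝ) : ℂ) * F (Psi m z)‖ₑ ^ p * oR (Wr (m * (2 - (ν + 2) / p)) p γ z) = oR (Q * (rexp (m * z.1) ^ (ν + 2) * rh z.2 ^ γ)) := by
    intro z hz
    have hr := rh_pos hz
    refine ⟨(enorm2 (Psi m z) ^ (k - 2) * ‖F (Psi m z)‖) ^ p, ?_, ?_, ?_⟩
    · rw [Psi_norm]; positivity
    · rw [← ENNReal.ofReal_mul bp]; congr 1; ring
    · rw [← ofReal_norm, norm_mul, Complex.norm_real, Real.norm_eq_abs, abs_of_pos bp, ENNReal.ofReal_rpow_of_nonneg bp bl,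
        ← ENNReal.ofReal_mul bp, Psi_norm]
      congr 1
      have hR : 0 < rexp (m * z.1) := exp_pos _
      rw [Wr, Real.mul_rpow bp bp, Real.mul_rpow bp bp, ← Real.rpow_mul hR.le, ← Real.rpow_mul hR.le]
      simp only [← Real.exp_mul]
      have : rexp (m * z.1 * (k * p)) * rexp (-(m * (2 - (ν + 2) / p) * p) * z.1) = rexp (m * z.1 * ((k - 2) * p)) * rexp (m * z.1 * (ν + 2)) := by
        rw [← Real.exp_add, ← Real.exp_add]; congr 1
        field_simp; ring
      linear_combination (‖F (Psi m z)‖ ^ p * rh z.2 ^ γ) * this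
  constructor <;> refine setLIntegral_mono' St_meas fun z hz => ?_ <;> obtain ⟨Q, hQ, e1, e2⟩ := pt z hz <;>
    rw [e1, e2, ← ENNReal.ofReal_mul hA0] <;> apply ENNReal.ofReal_le_ofReal
  · nlinarith [mul_le_mul_of_nonneg_left (main z hz).1 hQ]
  · nlinarith [mul_le_mul_of_nonneg_left (main z hz).2 hQ]

lemma NN_sum (b p γ : ℝ) (hp : 1 < p) (n : ℕ) (a : ℝ) (ha : 0 ≤ a) : ∃ K : ℝ≥0∞, K ≠ ⊤ ∧ ∀ (X : R2 → ℂ) (Y : Fin n → R2 → ℂ), (∀ i, Continuous (Y i)) →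
    (∀ z, ‖X z‖ ≤ a * ∑ i, ‖Y i z‖) → NN b p γ X ≤ K * ∑ i, NN b p γ (Y i) := by
  have hp0 : 0 ≤ p := by linarith
  have t1 : oR a ^ p ≠ ⊤ := ENNReal.rpow_ne_top_of_nonneg hp0 ENNReal.ofReal_ne_top
  have t2 : (n : ℝ≥0∞) ^ (p - 1) ≠ ⊤ := ENNReal.rpow_ne_top_of_nonneg bl (by simp)
  refine ⟨oR a ^ p * (n : ℝ≥0∞) ^ (p - 1), by finiteness, fun X Y hY h => ?_⟩
  have mW := Wr_meas b p γ
  have mY : ∀ i, Measurable fun z => ‖Y i z‖ₑ := fun i => (hY i).enorm.measurable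
  unfold NN
  rw [← lintegral_finsetSum _ (fun i _ => by have := mY i; fun_prop), ← lintegral_const_mul' _ _ (by finiteness)]
  refine lintegral_mono fun z => ?_
  rw [← Finset.sum_mul, ← mul_assoc]
  gcongr
  have : ‖X z‖ₑ ≤ oR a * ∑ i, ‖Y i z‖ₑ := by
    simp only [← ofReal_norm]
    rw [← ENNReal.ofReal_sum_of_nonneg (fun i _ => norm_nonneg _), ← ENNReal.ofReal_mul ha]
    exact ENNReal.ofReal_le_ofReal (h z)
  refine (ENNReal.rpow_le_rpow this hp0).trans ?_
  rw [ENNReal.mul_rpow_of_nonneg _ _ hp0, mul_assoc]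
  gcongr
  simpa using ENNReal.rpow_sum_le_const_mul_sum_rpow Finset.univ (fun i => ‖Y i z‖ₑ) hp.le

lemma chain (m : ℝ) {F : R2 → ℂ} (hF : Differentiable ℝ F) (z : R2) :
    Dd (fun z => F (Psi m z)) z = m * cx (Psi m z) * Dd F (Psi m z) ∧ Db (fun z => F (Psi m z)) z = m * conj (cx (Psi m z)) * Db F (Psi m z) := by
  have h := ((hF (Psi m z)).hasFDerivAt.comp z (Psi_fd m z)).fderiv
  change fderiv ℝ (fun z => F (Psi m z)) z = _ at h
  have e1 : Psi' m z (1, 0) = (m * (Psi m z).1, m * (Psi m z).2) := by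
    unfold Psi'; rw [Matrix.toLin_finTwoProd_toContinuousLinearMap]; simp
  have e2 : Psi' m z (0, 1) = (-(m * (Psi m z).2), m * (Psi m z).1) := by
    unfold Psi'; rw [Matrix.toLin_finTwoProd_toContinuousLinearMap]; simp
  have d1 : dS (fun z => F (Psi m z)) z = (m * (Psi m z).1 : ℝ) * dS F (Psi m z) + (m * (Psi m z).2 : ℝ) * dT F (Psi m z) := by rw [dS, h, ContinuousLinearMap.comp_apply, e1, fd_lin]
  have d2 : dT (fun z => F (Psi m z)) z = (-(m * (Psi m z).2) : ℝ) * dS F (Psi m z) + (m * (Psi m z).1 : ℝ) * dT F (Psi m z) := by rw [dT, h, ContinuousLinearMap.comp_apply, e2, fd_lin]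
  unfold Dd Db
  rw [d1, d2]
  have hI := Complex.I_mul_I
  constructor
  · simp only [cx]; push_cast
    linear_combination (m * (Psi m z).2 * dT F (Psi m z)) * hI
  · simp only [cx, map_add, map_mul, Complex.conj_ofReal, Complex.conj_I]; push_cast
    linear_combination (m * (Psi m z).2 * dT F (Psi m z)) * hI

lemma Dd_mul {a b : R2 → ℂ} {z : R2} (ha : DifferentiableAt ℝ a z) (hb : DifferentiableAt ℝ b z) :
    Dd (fun z => a z * b z) z = a z * Dd b z + Dd a z * b z := by
  have h2 := (ha.hasFDerivAt.mul hb.hasFDerivAt).fderiv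
  simp only [Dd, dS, dT]
  change fderiv ℝ (fun z => a z * b z) z = _ at h2
  rw [h2]
  simp; ring

lemma D_mcx (m : ℝ) (z : R2) : Dd (fun z => m * cx z) z = 2 * m ∧ Db (fun z => m * cx z) z = 0 := by
  have h := ((cx_hasF z).const_mul (m : ℂ)).fderiv
  have hI := Complex.I_mul_I
  simp only [Dd, Db, dS, dT, h]
  constructor
  · simp [cxL]; linear_combination (m : ℂ) * hI * (-1)
  · simp [cxL]; linear_combination (m : ℂ) * hI

lemma chain2 (m : ℝ) {u : R2 → ℂ} (hu : ContDiff ℝ 2 u) (z : R2) :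
    Dd (Dd (fun z => u (Psi m z))) z = m ^ 2 * cx (Psi m z) ^ 2 * Dd (Dd u) (Psi m z) + 2 * m * Dd (fun z => u (Psi m z)) z ∧
    Db (Dd (fun z => u (Psi m z))) z = m ^ 2 * (cx (Psi m z) * conj (cx (Psi m z))) * Db (Dd u) (Psi m z) := by
  have hd : Differentiable ℝ u := hu.differentiable bn
  have hD : Differentiable ℝ (Dd u) := (Dd_cd (n := 1) (by norm_num; exact hu)).differentiable bn
  have hc : Differentiable ℝ fun z => (m : ℂ) * cx z := fun z => ((cx_hasF z).const_mul (m : ℂ)).differentiableAt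
  have e : Dd (fun z => u (Psi m z)) = fun z => (fun x => (m * cx x) * Dd u x) (Psi m z) := funext fun z => (chain m hd z).1
  have hp : Differentiable ℝ fun x => (m * cx x) * Dd u x := hc.mul hD
  rw [(chain m hd z).1, e, (chain m hp z).1, (chain m hp z).2, Dd_mul (hc _) (hD _), Db_mul (hc _) (hD _), (D_mcx m _).1, (D_mcx m _).2]
  constructor <;> ring

lemma cx_Psi (m : ℝ) (z : R2) : ‖cx (Psi m z)‖ = rexp (m * z.1) := by
  rw [← Psi_norm, enorm2, cx, Complex.norm_add_mul_I]

lemma ptw {m : ℝ} (hm : 0 < m) {u : R2 → ℂ} (hu : ContDiff ℝ 2 u) (z : R2) :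
    m * rexp (m * z.1) * ‖Dd u (Psi m z)‖ = ‖Dd (fun z => u (Psi m z)) z‖ ∧
    m ^ 2 * rexp (m * z.1) ^ 2 * ‖Dd (Dd u) (Psi m z)‖ ≤ ‖Dd (Dd (fun z => u (Psi m z))) z‖ + 2 * m * ‖Dd (fun z => u (Psi m z)) z‖ ∧
    m ^ 2 * rexp (m * z.1) ^ 2 * ‖Db (Dd u) (Psi m z)‖ = ‖Db (Dd (fun z => u (Psi m z))) z‖ := by
  have hd : Differentiable ℝ u := hu.differentiable bn
  have nm : ‖(m : ℂ)‖ = m := by rw [Complex.norm_real, Real.norm_eq_abs, abs_of_pos hm]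
  refine ⟨?_, ?_, ?_⟩
  · rw [(chain m hd z).1, norm_mul, norm_mul, nm, cx_Psi]
  · have e : (m : ℂ) ^ 2 * cx (Psi m z) ^ 2 * Dd (Dd u) (Psi m z) = Dd (Dd (fun z => u (Psi m z))) z - 2 * m * Dd (fun z => u (Psi m z)) z := by
      rw [(chain2 m hu z).1]; ring
    have := congrArg norm e
    rw [norm_mul, norm_mul, norm_pow, norm_pow, nm, cx_Psi] at this
    rw [this]
    refine (norm_sub_le _ _).trans (le_of_eq ?_)
    rw [norm_mul, norm_mul, nm]; norm_num
  · rw [(chain2 m hu z).2, norm_mul, norm_mul, norm_mul, norm_pow, nm, RCLike.norm_conj, cx_Psi]; ring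

lemma ptw' {m : ℝ} (hm : 0 < m) {u : R2 → ℂ} (hu : ContDiff ℝ 2 u) (z : R2) :
    m * rexp (m * z.1) * ‖Db u (Psi m z)‖ = ‖Db (fun z => u (Psi m z)) z‖ ∧
    m ^ 2 * rexp (m * z.1) ^ 2 * ‖Db (Db u) (Psi m z)‖ ≤ ‖Db (Db (fun z => u (Psi m z))) z‖ + 2 * m * ‖Db (fun z => u (Psi m z)) z‖ := by
  obtain ⟨a, b, -⟩ := ptw (u := fun z => conj (u z)) hm (Complex.conjCLE.contDiff.comp hu) z
  have e := Dd_conj (fun z => u (Psi m z))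
  simp only [Dd_conj, e, RCLike.norm_conj] at a b
  exact ⟨a, b⟩

lemma pd1_eq {f : R2 → ℂ} (hf : Differentiable ℝ f) : pd1 f = dS f := by
  ext x
  exact ((hf x).hasFDerivAt.comp_hasDerivAt x.1 ((hasDerivAt_id x.1).prodMk (hasDerivAt_const x.1 x.2))).deriv
lemma pd2_eq {f : R2 → ℂ} (hf : Differentiable ℝ f) : pd2 f = dT f := by
  ext x
  exact ((hf x).hasFDerivAt.comp_hasDerivAt x.2 ((hasDerivAt_const x.2 x.1).prodMk (hasDerivAt_id x.2))).deriv

lemma idx2 : idx 2 = {(0, 0), (0, 1), (0, 2), (1, 0), (1, 1), (2, 0)} := by decide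

def YY (v : R2 → ℂ) : Fin 6 → R2 → ℂ := ![v, Dd v, Db v, Dd (Dd v), Db (Db v), Db (Dd v)]

lemma ptA {m : ℝ} (hm : 0 < m) {u : R2 → ℂ} (hu : ContDiff ℝ 2 u) (z : R2) (α : ℕ × ℕ) (hα : α ∈ idx 2) :
    ‖((rexp (m * z.1) ^ (α.1 + α.2 : ℝ) : ℝ) : ℂ) * pdMix α u (Psi m z)‖ ≤ (1 + 1 / m + 1 / m ^ 2) * ∑ i, ‖YY (fun z => u (Psi m z)) i z‖ := by
  obtain ⟨a1, a2, a3⟩ := ptw hm hu z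
  obtain ⟨a4, a5⟩ := ptw' hm hu z
  have hu1 : Differentiable ℝ u := hu.differentiable bn
  have hS : Differentiable ℝ (dS u) := (dS_cd (n := 1) (by norm_num; exact hu)).differentiable bn
  have hT : Differentiable ℝ (dT u) := (dT_cd (n := 1) (by norm_num; exact hu)).differentiable bn
  obtain ⟨s1, -, s2, s3⟩ := second hu (Psi m z)
  rw [norm_mul, Complex.norm_real, Real.norm_eq_abs, abs_of_pos bp]
  have hsum : ∑ i, ‖YY (fun z => u (Psi m z)) i z‖ = ‖u (Psi m z)‖ + ‖Dd (fun z => u (Psi m z)) z‖ + ‖Db (fun z => u (Psi m z)) z‖ +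
      ‖Dd (Dd (fun z => u (Psi m z))) z‖ + ‖Db (Db (fun z => u (Psi m z))) z‖ + ‖Db (Dd (fun z => u (Psi m z))) z‖ := by
    simp [YY, Fin.sum_univ_six]
  rw [hsum]
  have hR : 0 < rexp (m * z.1) := exp_pos _
  set R := rexp (m * z.1)
  have n0 := norm_nonneg (u (Psi m z))
  have n1 := norm_nonneg (Dd (fun z => u (Psi m z)) z)
  have n2 := norm_nonneg (Db (fun z => u (Psi m z)) z)
  have n3 := norm_nonneg (Dd (Dd (fun z => u (Psi m z))) z)
  have n4 := norm_nonneg (Db (Db (fun z => u (Psi m z))) z)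
  have n5 := norm_nonneg (Db (Dd (fun z => u (Psi m z))) z)
  set x0 := ‖u (Psi m z)‖
  set x1 := ‖Dd (fun z => u (Psi m z)) z‖
  set x2 := ‖Db (fun z => u (Psi m z)) z‖
  set x3 := ‖Dd (Dd (fun z => u (Psi m z))) z‖
  set x4 := ‖Db (Db (fun z => u (Psi m z))) z‖
  set x5 := ‖Db (Dd (fun z => u (Psi m z))) z‖
  have f1 : ∀ w : ℂ, ‖w‖ ≤ (‖Dd u (Psi m z)‖ + ‖Db u (Psi m z)‖) / 2 → R * ‖w‖ ≤ (1 + 1 / m + 1 / m ^ 2) * (x0 + x1 + x2 + x3 + x4 + x5) := by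
    intro w hw
    calc R * ‖w‖ ≤ R * ((‖Dd u (Psi m z)‖ + ‖Db u (Psi m z)‖) / 2) := by gcongr
      _ = 1 / m * ((x1 + x2) / 2) := by rw [← a1, ← a4]; field_simp
      _ ≤ _ := by
        gcongr
        · have : 0 < 1 / m ^ 2 := by positivity
          linarith
        · linarith
  have f2 : ∀ w : ℂ, ‖w‖ ≤ (‖Dd (Dd u) (Psi m z)‖ + ‖Db (Db u) (Psi m z)‖ + 2 * ‖Db (Dd u) (Psi m z)‖) / 4 →
      R ^ 2 * ‖w‖ ≤ (1 + 1 / m + 1 / m ^ 2) * (x0 + x1 + x2 + x3 + x4 + x5) := by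
    intro w hw
    calc R ^ 2 * ‖w‖ ≤ R ^ 2 * ((‖Dd (Dd u) (Psi m z)‖ + ‖Db (Db u) (Psi m z)‖ + 2 * ‖Db (Dd u) (Psi m z)‖) / 4) := by gcongr
      _ = 1 / m ^ 2 * ((m ^ 2 * R ^ 2 * ‖Dd (Dd u) (Psi m z)‖ + m ^ 2 * R ^ 2 * ‖Db (Db u) (Psi m z)‖ + 2 * (m ^ 2 * R ^ 2 * ‖Db (Dd u) (Psi m z)‖)) / 4) := by field_simp
      _ ≤ 1 / m ^ 2 * (((x3 + 2 * m * x1) + (x4 + 2 * m * x2) + 2 * x5) / 4) := by gcongr; exact a3.le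
      _ = 1 / m * ((x1 + x2) / 2) + 1 / m ^ 2 * ((x3 + x4 + 2 * x5) / 4) := by field_simp; ring
      _ ≤ 1 / m * (x0 + x1 + x2 + x3 + x4 + x5) + 1 / m ^ 2 * (x0 + x1 + x2 + x3 + x4 + x5) := by gcongr <;> linarith
      _ ≤ _ := by nlinarith
  have nI : ‖cI‖ = 1 := Complex.norm_I
  have hI := Complex.I_mul_I
  rw [idx2] at hα
  simp only [Finset.mem_insert, Finset.mem_singleton] at hα
  rcases hα with rfl | rfl | rfl | rfl | rfl | rfl
  · simp only [pdMix, Function.iterate_zero, id, Nat.cast_zero, add_zero, Real.rpow_zero, one_mul]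
    have : 0 < 1 / m := by positivity
    have : 0 < 1 / m ^ 2 := by positivity
    change x0 ≤ _
    nlinarith
  · simp only [pdMix, Function.iterate_zero, Function.iterate_one, id, Nat.cast_zero, Nat.cast_one, zero_add, Real.rpow_one, pd2_eq hu1]
    apply f1
    have : dT u (Psi m z) = (cI * Dd u (Psi m z) - cI * Db u (Psi m z)) / 2 := by
      unfold Dd Db; linear_combination dT u (Psi m z) * hI
    rw [this, norm_div]
    refine (div_le_div_of_nonneg_right (norm_sub_le _ _) (norm_nonneg _)).trans (le_of_eq ?_)
    simp
  · simp only [pdMix, Function.iterate_zero, id, Nat.cast_zero, zero_add, Nat.cast_ofNat, Real.rpow_two, Function.iterate_succ, Function.comp, pd2_eq hu1, pd2_eq hT]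
    apply f2
    have : dT (dT u) (Psi m z) = (2 * Db (Dd u) (Psi m z) - Dd (Dd u) (Psi m z) - Db (Db u) (Psi m z)) / 4 := by rw [s1, s2, s3]; ring
    rw [this, norm_div]
    have i1 := norm_sub_le (2 * Db (Dd u) (Psi m z) - Dd (Dd u) (Psi m z)) (Db (Db u) (Psi m z))
    have i2 := norm_sub_le (2 * Db (Dd u) (Psi m z)) (Dd (Dd u) (Psi m z))
    rw [norm_mul] at i2
    norm_num at i2 ⊢
    linarith
  · simp only [pdMix, Function.iterate_zero, Function.iterate_one, id, Nat.cast_zero, Nat.cast_one, add_zero, Real.rpow_one, pd1_eq hu1]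
    apply f1
    have : dS u (Psi m z) = (Dd u (Psi m z) + Db u (Psi m z)) / 2 := by unfold Dd Db; ring
    rw [this, norm_div]
    refine (div_le_div_of_nonneg_right (norm_add_le _ _) (norm_nonneg _)).trans (le_of_eq ?_)
    simp
  · simp only [pdMix, Function.iterate_one, Nat.cast_one, one_add_one_eq_two, Real.rpow_two, pd2_eq hu1, pd1_eq hT]
    apply f2
    have : dS (dT u) (Psi m z) = (cI * Dd (Dd u) (Psi m z) - cI * Db (Db u) (Psi m z)) / 4 := by
      rw [s2, s3]; linear_combination dS (dT u) (Psi m z) * hI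
    rw [this, norm_div]
    have i1 := norm_sub_le (cI * Dd (Dd u) (Psi m z)) (cI * Db (Db u) (Psi m z))
    rw [norm_mul, norm_mul, nI, one_mul, one_mul] at i1
    have := norm_nonneg (Db (Dd u) (Psi m z))
    norm_num
    linarith
  · simp only [pdMix, Function.iterate_zero, id, Nat.cast_zero, add_zero, Nat.cast_ofNat, Real.rpow_two, Function.iterate_succ, Function.comp, pd1_eq hu1, pd1_eq hS]
    apply f2
    have : dS (dS u) (Psi m z) = (2 * Db (Dd u) (Psi m z) + Dd (Dd u) (Psi m z) + Db (Db u) (Psi m z)) / 4 := by rw [s1, s2, s3]; ring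
    rw [this, norm_div]
    have i1 := norm_add_le (2 * Db (Dd u) (Psi m z) + Dd (Dd u) (Psi m z)) (Db (Db u) (Psi m z))
    have i2 := norm_add_le (2 * Db (Dd u) (Psi m z)) (Dd (Dd u) (Psi m z))
    rw [norm_mul] at i2
    norm_num at i2 ⊢
    linarith

lemma v_adm {κ : ℝ} (hκ : 0 < κ) (hκ' : κ < 2 * π) {u : R2 → ℂ} (hu : ContDiff ℝ (⊤ : ℕ∞) u) (hc : HasCompactSupport u)
    (h0 : (0, 0) ∉ tsupport u) (hb : ∀ x ∈ frontier (D2 κ), x ≠ (0, 0) → u x = 0) : adm (fun z => u (Psi (κ / π) z)) := by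
  have hp := pi_pos
  have hm : 0 < κ / π := by positivity
  have nz : ∀ z, Psi (κ / π) z ≠ (0, 0) := fun z h => by
    have := Psi_norm (κ / π) z
    rw [h] at this; simp [enorm2] at this
    exact (exp_pos _).ne this
  refine ⟨?_, ?_, fun s => ?_, fun s => ?_⟩
  · have : ContDiff ℝ 3 (Psi (κ / π)) := by unfold Psi; fun_prop
    exact (hu.of_le (WithTop.coe_le_coe.2 le_top)).comp this
  · obtain ⟨B, hB⟩ := hc.isCompact.isBounded.exists_norm_le
    obtain ⟨ε, hε, hE⟩ := Metric.isOpen_iff.1 (isClosed_tsupport u).isOpen_compl _ h0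
    have key : ∀ z, u (Psi (κ / π) z) ≠ 0 → ε ≤ rexp (κ / π * z.1) ∧ rexp (κ / π * z.1) ≤ 2 * B := by
      intro z hz
      have hz' : Psi (κ / π) z ∈ tsupport u := subset_tsupport _ hz
      have l1 := hB _ hz'
      have l2 : ε ≤ ‖Psi (κ / π) z‖ := by
        by_contra h; push Not at h
        exact hE (show Psi (κ / π) z ∈ Metric.ball (0, 0) ε by rw [Metric.mem_ball, Prod.mk_zero_zero, dist_zero_right]; exact h) hz'
      rw [← Psi_norm]
      have e1 : ‖Psi (κ / π) z‖ ≤ enorm2 (Psi (κ / π) z) := by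
        rw [Prod.norm_def, enorm2]
        refine max_le ?_ ?_ <;> rw [Real.norm_eq_abs] <;> apply Real.abs_le_sqrt <;> nlinarith [sq_nonneg (Psi (κ / π) z).1, sq_nonneg (Psi (κ / π) z).2]
      have e2 : enorm2 (Psi (κ / π) z) ≤ 2 * ‖Psi (κ / π) z‖ := by
        rw [enorm2]
        apply Real.sqrt_le_iff.2 ⟨by positivity, _⟩
        have q1 := sq_le_sq' (abs_le.1 (norm_fst_le (Psi (κ / π) z))).1 (abs_le.1 (norm_fst_le (Psi (κ / π) z))).2
        have q2 := sq_le_sq' (abs_le.1 (norm_snd_le (Psi (κ / π) z))).1 (abs_le.1 (norm_snd_le (Psi (κ / π) z))).2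
        nlinarith [sq_nonneg ‖Psi (κ / π) z‖]
      exact ⟨l2.trans e1, e2.trans bl⟩
    refine ⟨(|Real.log ε| + |Real.log (2 * B)|) / (κ / π) + 1, by positivity, fun z hz => ?_⟩
    by_contra hne
    obtain ⟨k1, k2⟩ := key z hne
    have r1 := Real.log_le_log hε k1
    have r2 := Real.log_le_log (exp_pos _) k2
    rw [log_exp] at r1 r2
    have r3 : |κ / π * z.1| ≤ |Real.log ε| + |Real.log (2 * B)| := by
      rw [abs_le]
      constructor
      · linarith [neg_abs_le (Real.log ε), abs_nonneg (Real.log (2 * B))]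
      · linarith [le_abs_self (Real.log (2 * B)), abs_nonneg (Real.log ε)]
    rw [abs_mul, abs_of_pos hm, mul_comm, ← le_div_iff₀ hm] at r3
    linarith
  · exact hb _ (front_mem hκ hκ' (exp_pos _) (Or.inl (mul_zero _))) (nz _)
  · exact hb _ (front_mem hκ hκ' (exp_pos _) (Or.inr (by simp only; field_simp))) (nz _)

lemma b_ne {κ p ν : ℝ} (hκ : 0 < κ) (hp : 1 < p) (hν : ∀ n : ℕ, 0 < n → ν ≠ (2 + (n : ℝ) * π / κ) * p - 2 ∧ ν ≠ (2 - (n : ℝ) * π / κ) * p - 2) :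
    ∀ n : ℤ, n ≠ 0 → κ / π * (2 - (ν + 2) / p) ≠ n := by
  intro n hn h
  have hpi := pi_pos
  have hp0 : 0 < p := by linarith
  have e : ν = (2 - (n : ℝ) * π / κ) * p - 2 := by rw [← h]; field_simp; ring
  obtain ⟨k, rfl | rfl⟩ := n.eq_nat_or_neg
  · exact (hν k (by omega)).2 (by simpa using e)
  · exact (hν k (by omega)).1 (by rw [e]; push_cast; ring)

lemma lower {κ : ℝ} (hκ : 0 < κ) (hκ' : κ < 2 * π) (p γ ν : ℝ) (hp : 1 < p) (h1 : -1 < γ) (h2 : γ < 2 * p - 1)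
    (hν : ∀ n : ℕ, 0 < n → ν ≠ (2 + (n : ℝ) * π / κ) * p - 2 ∧ ν ≠ (2 - (n : ℝ) * π / κ) * p - 2) : ∃ K : ℝ≥0∞, K ≠ ⊤ ∧
      ∀ u : R2 → ℂ, ContDiff ℝ 2 u → adm (fun z => u (Psi (κ / π) z)) → ∀ α ∈ idx 2,
        (∫⁻ x in D2 κ, oR ((enorm2 x ^ ((α.1 + α.2 : ℝ) - 2) * ‖pdMix α u x‖) ^ p * wgt2 κ γ ν x)) ≤
        K * ∫⁻ x in D2 κ, oR (‖pd1 (pd1 u) x + pd2 (pd2 u) x‖ ^ p * wgt2 κ γ ν x) := by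
  have hm : 0 < κ / π := div_pos hκ pi_pos
  obtain ⟨A, hA⟩ := transf hκ hκ' p γ ν hp
  obtain ⟨C, hC, H⟩ := stripEst _ (b_ne hκ hp hν) p hp γ h1 h2
  set m := κ / π
  set b := m * (2 - (ν + 2) / p)
  obtain ⟨K1, hK1, H1⟩ := NN_sum b p γ hp 6 (1 + 1 / m + 1 / m ^ 2) bp
  obtain ⟨K2, hK2, H2⟩ := NN_sum b p γ hp 1 (m ^ 2) bp
  refine ⟨oR A * (K1 * ((5 * C + 1) * (K2 * oR A))), by finiteness, fun u hu hv α hα => ?_⟩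
  set v : R2 → ℂ := fun z => u (Psi m z) with hvd
  have hu1 : Differentiable ℝ u := hu.differentiable bn
  have cS : ContDiff ℝ 1 (dS u) := dS_cd (by norm_num; exact hu)
  have cT : ContDiff ℝ 1 (dT u) := dT_cd (by norm_num; exact hu)
  have cSS : Continuous (dS (dS u)) := (dS_cd (n := 0) (by norm_num; exact cS)).continuous
  have cTT : Continuous (dT (dT u)) := (dT_cd (n := 0) (by norm_num; exact cT)).continuous
  have hv2 : ContDiff ℝ 2 v := hv.1.of_le bn
  have cD : ContDiff ℝ 1 (Dd v) := Dd_cd (by norm_num; exact hv2)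
  have cB : ContDiff ℝ 1 (Db v) := Db_cd (by norm_num; exact hv2)
  have q1 : Continuous (Db (Dd v)) := (Db_cd (n := 0) (by norm_num; exact cD)).continuous
  have q2 : Continuous (Dd (Dd v)) := (Dd_cd (n := 0) (by norm_num; exact cD)).continuous
  have q3 : Continuous (Db (Db v)) := (Db_cd (n := 0) (by norm_num; exact cB)).continuous
  have cP : Continuous (Psi m) := by unfold Psi; fun_prop
  have s1 := H1 _ (YY v) (fun i => by
    fin_cases i
    exacts [hv2.continuous, cD.continuous, cB.continuous, q2, q3, q1]) (fun z => ptA hm hu z α hα)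
  have s2 : ∑ i, NN b p γ (YY v i) ≤ (5 * C + 1) * NN b p γ (Db (Dd v)) := by
    obtain ⟨t1, t2, t3, t4, t5⟩ := H v hv
    simp only [YY, Fin.sum_univ_six]
    refine (add_le_add (add_le_add (add_le_add (add_le_add (add_le_add t5 t2) t4) t1) t3) le_rfl).trans (le_of_eq ?_)
    change C * NN b p γ (Db (Dd v)) + C * NN b p γ (Db (Dd v)) + C * NN b p γ (Db (Dd v)) + C * NN b p γ (Db (Dd v)) + C * NN b p γ (Db (Dd v)) + NN b p γ (Db (Dd v)) = _
    ring
  have e1 : pd1 (pd1 u) = dS (dS u) := by rw [pd1_eq hu1, pd1_eq (cS.differentiable bn)]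
  have e2 : pd2 (pd2 u) = dT (dT u) := by rw [pd2_eq hu1, pd2_eq (cT.differentiable bn)]
  have s3 := H2 (Db (Dd v)) (fun _ z => ((rexp (m * z.1) ^ (2:ℝ) : ℝ) : ℂ) * (fun x => pd1 (pd1 u) x + pd2 (pd2 u) x) (Psi m z)) (fun _ => by
    simp only [e1, e2, Real.rpow_two]; fun_prop) (fun z => by
      simp only [Finset.univ_unique, Finset.sum_singleton, e1, e2, Real.rpow_two]
      rw [norm_mul, Complex.norm_real, Real.norm_eq_abs, abs_of_pos bp, ← (second hu (Psi m z)).1, ← (ptw hm hu z).2.2, mul_assoc])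
  simp only [Finset.univ_unique, Finset.sum_singleton] at s3
  have s4 := (hA (fun x => pd1 (pd1 u) x + pd2 (pd2 u) x) 2).2
  simp only [sub_self, Real.rpow_zero, one_mul] at s4
  calc _ ≤ _ := (hA (pdMix α u) (α.1 + α.2)).1
    _ ≤ oR A * (K1 * ((5 * C + 1) * (K2 * (oR A * ∫⁻ x in D2 κ, oR (‖pd1 (pd1 u) x + pd2 (pd2 u) x‖ ^ p * wgt2 κ γ ν x))))) := by
        gcongr
        refine s1.trans ?_
        gcongr
        refine s2.trans ?_
        gcongr
        refine s3.trans ?_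
        gcongr
    _ = _ := by ring

lemma upper {κ : ℝ} (hκ : 0 < κ) (hκ' : κ < 2 * π) (p γ ν : ℝ) (hp : 1 < p) : ∃ K : ℝ≥0∞, K ≠ ⊤ ∧
      ∀ u : R2 → ℂ, ContDiff ℝ 2 u → ∀ S : ℝ≥0∞, (∀ α ∈ idx 2,
        (∫⁻ x in D2 κ, oR ((enorm2 x ^ ((α.1 + α.2 : ℝ) - 2) * ‖pdMix α u x‖) ^ p * wgt2 κ γ ν x)) ≤ S) →
        (∫⁻ x in D2 κ, oR (‖pd1 (pd1 u) x + pd2 (pd2 u) x‖ ^ p * wgt2 κ γ ν x)) ≤ K * S := by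
  have hm : 0 < κ / π := div_pos hκ pi_pos
  obtain ⟨A, hA⟩ := transf hκ hκ' p γ ν hp
  set m := κ / π
  set b := m * (2 - (ν + 2) / p)
  obtain ⟨K, hK, H⟩ := NN_sum b p γ hp 2 1 bp
  refine ⟨oR A * (K * (oR A + oR A)), by finiteness, fun u hu S hS => ?_⟩
  have hu1 : Differentiable ℝ u := hu.differentiable bn
  have cS : ContDiff ℝ 1 (dS u) := dS_cd (by norm_num; exact hu)
  have cT : ContDiff ℝ 1 (dT u) := dT_cd (by norm_num; exact hu)
  have cSS : Continuous (dS (dS u)) := (dS_cd (n := 0) (by norm_num; exact cS)).continuous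
  have cTT : Continuous (dT (dT u)) := (dT_cd (n := 0) (by norm_num; exact cT)).continuous
  have cP : Continuous (Psi m) := by unfold Psi; fun_prop
  have e1 : pd1 (pd1 u) = dS (dS u) := by rw [pd1_eq hu1, pd1_eq (cS.differentiable bn)]
  have e2 : pd2 (pd2 u) = dT (dT u) := by rw [pd2_eq hu1, pd2_eq (cT.differentiable bn)]
  have S1 := hS (2, 0) (by decide)
  have S2 := hS (0, 2) (by decide)
  rw [show pdMix (2, 0) u = dS (dS u) from e1] at S1
  rw [show pdMix (0, 2) u = dT (dT u) from e2] at S2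
  simp only [Nat.cast_ofNat, Nat.cast_zero, zero_add, add_zero] at S1 S2
  have a0 := (hA (fun x => dS (dS u) x + dT (dT u) x) 2).1
  have h := H (fun z => ((rexp (m * z.1) ^ (2:ℝ) : ℝ) : ℂ) * (fun x => dS (dS u) x + dT (dT u) x) (Psi m z))
    ![fun z => ((rexp (m * z.1) ^ (2:ℝ) : ℝ) : ℂ) * dS (dS u) (Psi m z), fun z => ((rexp (m * z.1) ^ (2:ℝ) : ℝ) : ℂ) * dT (dT u) (Psi m z)]
    (fun i => by
      simp only [Real.rpow_two]
      fin_cases i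
      · change Continuous fun z : R2 => ((rexp (m * z.1) ^ 2 : ℝ) : ℂ) * dS (dS u) (Psi m z); fun_prop
      · change Continuous fun z : R2 => ((rexp (m * z.1) ^ 2 : ℝ) : ℂ) * dT (dT u) (Psi m z); fun_prop)
    (fun z => by
      rw [Fin.sum_univ_two, one_mul, mul_add]; exact norm_add_le _ _)
  rw [Fin.sum_univ_two] at h
  rw [e1, e2]
  simp only [sub_self, Real.rpow_zero, one_mul] at a0
  refine a0.trans ?_
  rw [mul_assoc (oR A), mul_assoc K, add_mul]
  gcongr
  refine h.trans ?_
  gcongr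
  · exact ((hA (dS (dS u)) 2).2).trans (by gcongr)
  · exact ((hA (dT (dT u)) 2).2).trans (by gcongr)

theorem stmt16 (κ : ℝ) (hκ : 0 < κ) (hκ' : κ < 2 * π)
    (p γ ν : ℝ) (hp : 1 < p)
    (hγ1 : -1 < γ) (hγ2 : γ < 2 * p - 1) (hγ3 : γ ≠ p - 1)
    (hν : ∀ n : ℕ, 0 < n →
      ν ≠ (2 + (n : ℝ) * π / κ) * p - 2 ∧ ν ≠ (2 - (n : ℝ) * π / κ) * p - 2) :
    ∃ c C : ℝ, 0 < c ∧ c ≤ C ∧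
      ∀ u : ℝ × ℝ → ℂ, ContDiff ℝ (⊤ : ℕ∞) u → HasCompactSupport u →
        (0, 0) ∉ tsupport u → (∀ x ∈ frontier (D2 κ), x ≠ (0, 0) → u x = 0) →
        ENNReal.ofReal c *
            ∑ α ∈ idx 2,
              (∫⁻ x in D2 κ, ENNReal.ofReal
                ((enorm2 x ^ ((α.1 + α.2 : ℝ) - 2) * ‖pdMix α u x‖) ^ p *
                  wgt2 κ γ ν x)) ^ (1 / p)
          ≤ (∫⁻ x in D2 κ, ENNReal.ofReal
              (‖pd1 (pd1 u) x + pd2 (pd2 u) x‖ ^ p * wgt2 κ γ ν x)) ^ (1 / p) ∧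
        (∫⁻ x in D2 κ, ENNReal.ofReal
            (‖pd1 (pd1 u) x + pd2 (pd2 u) x‖ ^ p * wgt2 κ γ ν x)) ^ (1 / p)
          ≤ ENNReal.ofReal C *
              ∑ α ∈ idx 2,
                (∫⁻ x in D2 κ, ENNReal.ofReal
                  ((enorm2 x ^ ((α.1 + α.2 : ℝ) - 2) * ‖pdMix α u x‖) ^ p *
                    wgt2 κ γ ν x)) ^ (1 / p) := by
  obtain ⟨K1, hK1, H1⟩ := lower hκ hκ' p γ ν hp hγ1 hγ2 hν
  obtain ⟨K2, hK2, H2⟩ := upper hκ hκ' p γ ν hp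
  have hp0 : 0 < p := by linarith
  have hpi : 0 ≤ 1 / p := by positivity
  have f1 : K1 ^ (1 / p) ≠ ⊤ := ENNReal.rpow_ne_top_of_nonneg hpi hK1
  have f2 : K2 ^ (1 / p) ≠ ⊤ := ENNReal.rpow_ne_top_of_nonneg hpi hK2
  set L : ℝ := (6 * K1 ^ (1 / p)).toReal + 1 with hL
  have hL0 : 0 < L := by positivity
  refine ⟨1 / L, max (1 / L) (K2 ^ (1 / p)).toReal, by positivity, le_max_left _ _, fun u hu hc h0 hb => ?_⟩
  have hu2 : ContDiff ℝ 2 u := hu.of_le (WithTop.coe_le_coe.2 le_top)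
  have h := H1 u hu2 (v_adm hκ hκ' hu hc h0 hb)
  have h' := H2 u hu2
  generalize (∫⁻ x in D2 κ, ENNReal.ofReal (‖pd1 (pd1 u) x + pd2 (pd2 u) x‖ ^ p * wgt2 κ γ ν x)) = R at *
  generalize hM : (fun α : ℕ × ℕ => ∫⁻ x in D2 κ, ENNReal.ofReal
    ((enorm2 x ^ ((α.1 + α.2 : ℝ) - 2) * ‖pdMix α u x‖) ^ p * wgt2 κ γ ν x)) = M
  have hM' : ∀ α, (∫⁻ x in D2 κ, ENNReal.ofReal
    ((enorm2 x ^ ((α.1 + α.2 : ℝ) - 2) * ‖pdMix α u x‖) ^ p * wgt2 κ γ ν x)) = M α := fun α => congrFun hM α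
  simp only [hM'] at h h' ⊢
  constructor
  · have g : ∑ α ∈ idx 2, M α ^ (1 / p) ≤ ENNReal.ofReal L * R ^ (1 / p) := by
      calc _ ≤ ∑ α ∈ idx 2, K1 ^ (1 / p) * R ^ (1 / p) := Finset.sum_le_sum fun α hα => by
            rw [← ENNReal.mul_rpow_of_nonneg _ _ hpi]
            exact ENNReal.rpow_le_rpow (h α hα) hpi
        _ = (6 * K1 ^ (1 / p)) * R ^ (1 / p) := by
            rw [Finset.sum_const, show (idx 2).card = 6 by decide, nsmul_eq_mul, mul_assoc]; norm_num
        _ ≤ _ := by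
            gcongr
            rw [ENNReal.le_ofReal_iff_toReal_le (by finiteness) hL0.le]
            linarith
    calc _ ≤ ENNReal.ofReal (1 / L) * (ENNReal.ofReal L * R ^ (1 / p)) := by gcongr
      _ = _ := by
        rw [← mul_assoc, ← ENNReal.ofReal_mul (by positivity), one_div_mul_cancel hL0.ne', ENNReal.ofReal_one, one_mul]
  · have g := h' ((∑ α ∈ idx 2, M α ^ (1 / p)) ^ p) (fun α hα => by
      calc M α = (M α ^ (1 / p)) ^ p := by rw [← ENNReal.rpow_mul, one_div_mul_cancel hp0.ne', ENNReal.rpow_one]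
        _ ≤ _ := ENNReal.rpow_le_rpow (Finset.single_le_sum (f := fun α => M α ^ (1 / p)) (fun _ _ => zero_le) hα) hp0.le)
    refine (ENNReal.rpow_le_rpow g hpi).trans ?_
    rw [ENNReal.mul_rpow_of_nonneg _ _ hpi, ← ENNReal.rpow_mul, mul_one_div_cancel hp0.ne', ENNReal.rpow_one]
    gcongr
    rw [ENNReal.le_ofReal_iff_toReal_le f2 (le_max_of_le_right ENNReal.toReal_nonneg)]
    exact le_max_right _ _
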